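/- Let χ^ν be a component of χ^α ⊗ χ^β. Then χ^ν is a minimal component (k(α,β,γ) = 0 for every partition γ strictly dominated by ν) if and only if k(α,β,ν) = lr*(α,β;ν'), where ν' is the conjugate of ν. -/

import Mathlib

open Finset Equiv
open scoped Classical

noncomputable section

/-- Value at `g` of the permutation character of `S_n` induced from the trivial character of
the Young subgroup of the composition `c`: the number of colorings of `Fin n` with fiber
sizes given by `c` that are fixed by `g`. -/
def permChar (n : ℕ) (c : ℕ → ℕ) (g : Perm (Fin n)) : ℚ :=
  Nat.card {f : Fin n → ℕ // (∀ k, Nat.card {x : Fin n // f x = k} = c k) ∧ ∀ x, f (g x) = f x}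

/-- Inner product of class functions (real-valued characters) of `S_n`. -/
def innerChar (n : ℕ) (χ ψ : Perm (Fin n) → ℚ) : ℚ :=
  (∑ g : Perm (Fin n), χ g * ψ g) / (n.factorial : ℚ)

/-- The trivial character `χ^{(n)}` of `S_n`. -/
def trivChar (n : ℕ) : Perm (Fin n) → ℚ := fun _ => 1

/-- The sign character `χ^{(1^n)}` of `S_n`. -/
def signChar (n : ℕ) : Perm (Fin n) → ℚ := fun g => ((Perm.sign g : ℤ) : ℚ)

/-- Permutation character for an integer vector: zero if some entry is negative. -/
def permCharZ (n : ℕ) (c : ℕ → ℤ) (g : Perm (Fin n)) : ℚ :=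
  if ∀ k, 0 ≤ c k then permChar n (fun k => (c k).toNat) g else 0

/-- The irreducible character `χ^a` of `S_n` indexed by the partition `a`, given by the
Jacobi–Trudi determinantal formula `χ^a = ∑_σ sgn(σ) φ^{(a_i - i + σ(i))_i}`. -/
def irrChar (n : ℕ) (a : ℕ → ℕ) (g : Perm (Fin n)) : ℚ :=
  ∑ σ : Perm (Fin n), ((Perm.sign σ : ℤ) : ℚ) *
    permCharZ n (fun i => if h : i < n then (a i : ℤ) - i + ((σ ⟨i, h⟩ : Fin n) : ℕ) else 0) g

/-- Kronecker coefficient `k(a,b,c) = ⟨χ^a ⊗ χ^b, χ^c⟩`. -/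
def kron (n : ℕ) (a b c : ℕ → ℕ) : ℚ :=
  innerChar n (fun g => irrChar n a g * irrChar n b g) (irrChar n c)

/-- Extend a vector indexed by `Fin p` to `ℕ` by zeros. -/
def extc {p : ℕ} (l : Fin p → ℕ) : ℕ → ℕ := fun i => if h : i < p then l ⟨i, h⟩ else 0

/-- Dominance order: `a ⊵ b`. -/
def Dominates (a b : ℕ → ℕ) : Prop :=
  ∀ k, ∑ i ∈ Finset.range k, b i ≤ ∑ i ∈ Finset.range k, a i

/-- Conjugate (transpose) of a partition with at most `n` parts. -/
def conjFun (n : ℕ) (a : ℕ → ℕ) : ℕ → ℕ :=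
  fun j => ((Finset.range n).filter (fun i => j < a i)).card

/-- `a` is a partition of `n` (weakly decreasing, supported on the first `n` parts). -/
def IsPartitionFun (n : ℕ) (a : ℕ → ℕ) : Prop :=
  (∀ i j, i ≤ j → a j ≤ a i) ∧ (∀ i, n ≤ i → a i = 0) ∧ ∑ i ∈ Finset.range n, a i = n

/-- The weakly decreasing sequence of parts of `P : Nat.Partition n`. -/
def pf {n : ℕ} (P : n.Partition) : ℕ → ℕ :=
  fun i => ((P.parts.sort (· ≤ ·)).reverse).getD i 0

/-- The parts of `P : Nat.Partition n` as a vector of length `n`. -/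
def pfin {n : ℕ} (P : n.Partition) : Fin n → ℕ := fun k => pf P k

/-- Number of cells of the skew shape `a/b` where the filling `T` has entry `k`. -/
def skewContent (a b : ℕ → ℕ) (T : ℕ → ℕ → ℕ) (k : ℕ) : ℕ :=
  Nat.card {p : ℕ × ℕ // b p.1 ≤ p.2 ∧ p.2 < a p.1 ∧ T p.1 p.2 = k}

/-- Number of cells of the skew shape `a/b`. -/
def skewSize (a b : ℕ → ℕ) : ℕ :=
  Nat.card {p : ℕ × ℕ // b p.1 ≤ p.2 ∧ p.2 < a p.1}

/-- `T` is a semistandard filling of the shape `a` (zero outside, rows weakly increasing,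
columns strictly increasing). -/
def IsSSYT (a : ℕ → ℕ) (T : ℕ → ℕ → ℕ) : Prop :=
  (∀ i j, a i ≤ j → T i j = 0) ∧
  (∀ i j₁ j₂, j₁ ≤ j₂ → j₂ < a i → T i j₁ ≤ T i j₂) ∧
  (∀ i₁ i₂ j, i₁ < i₂ → j < a i₂ → T i₁ j < T i₂ j)

/-- The Kostka number: the number of semistandard Young tableaux of shape `a`
and content `c`. -/
def kostka (a c : ℕ → ℕ) : ℕ :=
  Nat.card {T : ℕ → ℕ → ℕ // IsSSYT a T ∧ ∀ k, skewContent a (fun _ => 0) T k = c k}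

/-- Number of entries equal to `k` in the prefix of the (right-to-left, top-to-bottom)
reading word of `T` ending at position `(i,j)`. -/
def lrCount (a b : ℕ → ℕ) (T : ℕ → ℕ → ℕ) (i j k : ℕ) : ℕ :=
  Nat.card {p : ℕ × ℕ //
    (p.1 < i ∨ (p.1 = i ∧ j ≤ p.2)) ∧ b p.1 ≤ p.2 ∧ p.2 < a p.1 ∧ T p.1 p.2 = k}

/-- `T` is a Littlewood–Richardson skew tableau of shape `a/b`: semistandard and its
reverse reading word is a lattice word. -/
def IsLR (a b : ℕ → ℕ) (T : ℕ → ℕ → ℕ) : Prop :=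
  (∀ i j, ¬(b i ≤ j ∧ j < a i) → T i j = 0) ∧
  (∀ i j₁ j₂, b i ≤ j₁ → j₁ ≤ j₂ → j₂ < a i → T i j₁ ≤ T i j₂) ∧
  (∀ i₁ i₂ j, i₁ < i₂ → b i₁ ≤ j → j < a i₁ → b i₂ ≤ j → j < a i₂ → T i₁ j < T i₂ j) ∧
  (∀ i j k, lrCount a b T i j (k + 1) ≤ lrCount a b T i j k)

/-- A Littlewood–Richardson multitableau of shape `α` with `r` parts: a chain of
partitions `0 = α(0) ⊆ α(1) ⊆ ⋯ ⊆ α(r) = α` together with Littlewood–Richardson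
fillings of the successive skew shapes. -/
structure LRMultiF (r : ℕ) (α : ℕ → ℕ) where
  chain : Fin (r + 1) → ℕ → ℕ
  antitone : ∀ k i j, i ≤ j → chain k j ≤ chain k i
  zero : ∀ i, chain 0 i = 0
  last : ∀ i, chain (Fin.last r) i = α i
  mono : ∀ (k : Fin r) (i : ℕ), chain k.castSucc i ≤ chain k.succ i
  T : Fin r → ℕ → ℕ → ℕ
  lr : ∀ k : Fin r, IsLR (chain k.succ) (chain k.castSucc) (T k)

/-- Content of the `k`-th tableau of a Littlewood–Richardson multitableau. -/
def LRMultiF.cont {r : ℕ} {α : ℕ → ℕ} (M : LRMultiF r α) (k : Fin r) : ℕ → ℕ :=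
  skewContent (M.chain k.succ) (M.chain k.castSucc) (M.T k)

/-- Size of the `k`-th tableau of a Littlewood–Richardson multitableau. -/
def LRMultiF.size {r : ℕ} {α : ℕ → ℕ} (M : LRMultiF r α) (k : Fin r) : ℕ :=
  skewSize (M.chain k.succ) (M.chain k.castSucc)

/-- `LR(α,β;ν)`: pairs of Littlewood–Richardson multitableaux of shapes `α`, `β`,
type `ν`, with equal contents. -/
def LRPairs (r : ℕ) (α β : ℕ → ℕ) (ν : Fin r → ℕ) :=
  {TS : LRMultiF r α × LRMultiF r β //
    (∀ k, TS.1.size k = ν k) ∧ (∀ k, TS.2.size k = ν k) ∧ ∀ k, TS.1.cont k = TS.2.cont k}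

/-- `LR*(α,β;ν)`: pairs of Littlewood–Richardson multitableaux of shapes `α`, `β`,
type `ν`, with termwise conjugate contents. -/
def LRPairsStar (n r : ℕ) (α β : ℕ → ℕ) (ν : Fin r → ℕ) :=
  {TS : LRMultiF r α × LRMultiF r β //
    (∀ k, TS.1.size k = ν k) ∧ (∀ k, TS.2.size k = ν k) ∧
      ∀ k m, TS.2.cont k m = conjFun n (TS.1.cont k) m}

/-- `lr(α,β;ν)`. -/
def lrNum (r : ℕ) (α β : ℕ → ℕ) (ν : Fin r → ℕ) : ℕ := Nat.card (LRPairs r α β ν)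

/-- `lr*(α,β;ν)`. -/
def lrStarNum (n r : ℕ) (α β : ℕ → ℕ) (ν : Fin r → ℕ) : ℕ :=
  Nat.card (LRPairsStar n r α β ν)

/-- A semistandard Young tableau (of arbitrary partition shape). -/
structure SSYTP where
  shape : ℕ → ℕ
  T : ℕ → ℕ → ℕ
  antitone : ∀ i j, i ≤ j → shape j ≤ shape i
  finite : ∃ N, ∀ i, N ≤ i → shape i = 0
  ssyt : IsSSYT shape T

/-- Content of a semistandard Young tableau. -/
def SSYTP.cont (P : SSYTP) : ℕ → ℕ := skewContent P.shape (fun _ => 0) P.T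

/-- The multiset of entries of a matrix. -/
def entriesM {p q : ℕ} (A : Fin p → Fin q → ℕ) : Multiset ℕ :=
  (Finset.univ : Finset (Fin p × Fin q)).val.map (fun ij => A ij.1 ij.2)

/-- The π-sequence of `A` is the partition `ν` (the weakly decreasing rearrangement of
the entries of `A` is `ν`). -/
def HasPiSeq {p q : ℕ} (A : Fin p → Fin q → ℕ) {n : ℕ} (ν : n.Partition) : Prop :=
  (entriesM A).filter (· ≠ 0) = ν.parts

end

namespace KroneckerMinimal

section
/-- Coefficient of a polynomial at an exponent vector given as a function. -/
noncomputable def cf {N : ℕ} (A : MvPolynomial (Fin N) ℚ) (v : Fin N → ℕ) : ℚ :=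
  A.coeff (Finsupp.equivFunOnFinite.symm v)

/-- Sum of the monomials of degree `r` in the weights `w` with all exponents in `S`;
complete homogeneous for `S = univ`, elementary for `S = {0, 1}`. -/
noncomputable def cs {Y R : Type*} [Fintype Y] [CommRing R] (S : Set ℕ) (w : Y → R) (r : ℕ) : R :=
  ∑ m ∈ (piAntidiag (univ : Finset Y) r).filter (fun m => ∀ y, m y ∈ S), ∏ y, w y ^ m y

/-- Alternating polynomials. -/
def IsAlt {N : ℕ} (A : MvPolynomial (Fin N) ℚ) : Prop :=
  ∀ σ : Perm (Fin N), MvPolynomial.rename σ A = ((Perm.sign σ : ℤ) : ℚ) • A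

lemma cf_add {N : ℕ} (A B : MvPolynomial (Fin N) ℚ) (v : Fin N → ℕ) :
    cf (A + B) v = cf A v + cf B v := MvPolynomial.coeff_add _ _ _

lemma cf_smul {N : ℕ} (c : ℚ) (A : MvPolynomial (Fin N) ℚ) (v : Fin N → ℕ) :
    cf (c • A) v = c * cf A v := MvPolynomial.coeff_smul _ _ _

lemma cf_sum {N : ℕ} {ι : Type*} (s : Finset ι) (A : ι → MvPolynomial (Fin N) ℚ)
    (v : Fin N → ℕ) : cf (∑ i ∈ s, A i) v = ∑ i ∈ s, cf (A i) v :=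
  MvPolynomial.coeff_sum _ _ _

lemma cf_ext {N : ℕ} {A B : MvPolynomial (Fin N) ℚ} (h : ∀ v, cf A v = cf B v) : A = B := by
  ext m
  simpa [cf] using h (Finsupp.equivFunOnFinite m)

lemma prod_X_pow {N : ℕ} (m : Fin N → ℕ) :
    (∏ i, (MvPolynomial.X i : MvPolynomial (Fin N) ℚ) ^ m i) =
      MvPolynomial.monomial (Finsupp.equivFunOnFinite.symm m) 1 := by
  rw [MvPolynomial.monomial_eq, Finsupp.prod_fintype _ _ (by simp)]
  simp

lemma cf_mul_monomial {N : ℕ} (A : MvPolynomial (Fin N) ℚ) (m l : Fin N → ℕ) :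
    cf (A * MvPolynomial.monomial (Finsupp.equivFunOnFinite.symm m) 1) l =
      if m ≤ l then cf A (l - m) else 0 := by
  unfold cf
  rw [MvPolynomial.coeff_mul_monomial', mul_one]
  have : (Finsupp.equivFunOnFinite.symm m ≤ Finsupp.equivFunOnFinite.symm l) ↔ m ≤ l := by
    simp [Finsupp.le_def, Pi.le_def]
  simp only [this]
  congr 2
  ext i
  simp

lemma cf_mul_cs {N : ℕ} (S : Set ℕ) (A : MvPolynomial (Fin N) ℚ) (r : ℕ) (l : Fin N → ℕ) :
    cf (A * cs S MvPolynomial.X r) l =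
      ∑ q ∈ (Iic l).filter (fun q => ∑ i, l i = ∑ i, q i + r ∧ ∀ i, l i - q i ∈ S), cf A q := by
  simp only [cs, prod_X_pow, mul_sum, cf_sum, cf_mul_monomial]
  rw [← sum_filter]
  refine sum_nbij' (fun m => l - m) (fun q => l - q) ?_ ?_ ?_ ?_ ?_
  · intro m hm
    simp only [mem_filter, mem_piAntidiag, mem_Iic] at hm ⊢
    obtain ⟨⟨⟨h1, -⟩, h2⟩, h3⟩ := hm
    refine ⟨fun i => Nat.sub_le _ _, ?_, ?_⟩
    · rw [← h1, ← sum_add_distrib]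
      exact sum_congr rfl fun i _ => by
        have : m i ≤ l i := h3 i
        simp only [Pi.sub_apply]; omega
    · intro i
      have h4 : m i ≤ l i := h3 i
      have : l i - (l - m) i = m i := by simp only [Pi.sub_apply]; omega
      rw [this]; exact h2 i
  · intro q hq
    simp only [mem_filter, mem_piAntidiag, mem_Iic] at hq ⊢
    obtain ⟨h1, h2, h3⟩ := hq
    refine ⟨⟨⟨?_, by simp⟩, h3⟩, fun i => Nat.sub_le _ _⟩
    have : ∑ i, l i = ∑ i, q i + ∑ i, (l - q) i := by
      rw [← sum_add_distrib]
      exact sum_congr rfl fun i _ => by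
        have : q i ≤ l i := h1 i
        simp only [Pi.sub_apply]; omega
    change univ.sum (l - q) = r
    change _ = _ + univ.sum (l - q) at this
    omega
  · intro m hm
    simp only [mem_filter] at hm
    funext i
    have : m i ≤ l i := hm.2 i
    simp only [Pi.sub_apply]; omega
  · intro q hq
    simp only [mem_filter, mem_Iic] at hq
    funext i
    have : q i ≤ l i := hq.1 i
    simp only [Pi.sub_apply]; omega
  · intro m hm; rfl

lemma cs_isSymmetric {N : ℕ} (S : Set ℕ) (r : ℕ) :
    (cs S (MvPolynomial.X : Fin N → MvPolynomial (Fin N) ℚ) r).IsSymmetric := by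
  intro e
  simp only [cs, map_sum, map_prod, map_pow, MvPolynomial.rename_X]
  refine sum_nbij' (fun m => m ∘ e.symm) (fun m => m ∘ e) ?_ ?_ ?_ ?_ ?_
  · intro m hm
    simp only [mem_filter, mem_piAntidiag] at hm ⊢
    refine ⟨⟨?_, by simp⟩, fun y => hm.2 _⟩
    rw [← hm.1.1]; exact Equiv.sum_comp e.symm m
  · intro m hm
    simp only [mem_filter, mem_piAntidiag] at hm ⊢
    refine ⟨⟨?_, by simp⟩, fun y => hm.2 _⟩
    rw [← hm.1.1]; exact Equiv.sum_comp e m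
  · intro m _; funext i; simp
  · intro m _; funext i; simp
  · intro m _
    rw [← Equiv.prod_comp e (fun x => (MvPolynomial.X x : MvPolynomial (Fin N) ℚ) ^ (m ∘ e.symm) x)]
    simp

lemma IsAlt.mul {N : ℕ} {A F : MvPolynomial (Fin N) ℚ} (hA : IsAlt A) (hF : F.IsSymmetric) :
    IsAlt (A * F) := by
  intro σ
  rw [map_mul, hA σ, hF σ, smul_mul_assoc]

lemma rename_coeff {N : ℕ} (σ : Perm (Fin N)) (A : MvPolynomial (Fin N) ℚ) (v : Fin N → ℕ) :
    cf (MvPolynomial.rename σ A) v = cf A (v ∘ σ) := by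
  unfold cf
  rw [← MvPolynomial.coeff_rename_mapDomain σ σ.injective A]
  congr 1
  ext i
  obtain ⟨j, rfl⟩ := σ.surjective i
  rw [Finsupp.mapDomain_apply σ.injective]
  simp

lemma IsAlt.cf_comp {N : ℕ} {A : MvPolynomial (Fin N) ℚ} (hA : IsAlt A) (σ : Perm (Fin N))
    (v : Fin N → ℕ) : cf A (v ∘ σ) = ((Perm.sign σ : ℤ) : ℚ) * cf A v := by
  rw [← rename_coeff, hA σ, cf_smul]

lemma IsAlt.cf_swap {N : ℕ} {A : MvPolynomial (Fin N) ℚ} (hA : IsAlt A) {i j : Fin N} (h : i ≠ j)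
    (v : Fin N → ℕ) : cf A (v ∘ swap i j) = - cf A v := by
  rw [hA.cf_comp, Perm.sign_swap h]; simp

lemma IsAlt.cf_eq_zero {N : ℕ} {A : MvPolynomial (Fin N) ℚ} (hA : IsAlt A) {i j : Fin N}
    (h : i ≠ j) (v : Fin N → ℕ) (hv : v i = v j) : cf A v = 0 := by
  have h1 := hA.cf_swap h v
  have : v ∘ swap i j = v := by
    funext k
    simp only [Function.comp, swap_apply_def]
    split_ifs with h1 h2 <;> simp_all
  rw [this] at h1
  linarith

/-- Partitions with at most `N` parts, as sequences. -/
def IsPt (N : ℕ) (κ : ℕ → ℕ) : Prop := (∀ i j, i ≤ j → κ j ≤ κ i) ∧ ∀ i, N ≤ i → κ i = 0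

/-- The sum of the first `N` entries. -/
def sz (N : ℕ) (κ : ℕ → ℕ) : ℕ := ∑ i ∈ range N, κ i

/-- `κ / μ` is a horizontal strip. -/
def HStrip (μ κ : ℕ → ℕ) : Prop := ∀ i, κ (i + 1) ≤ μ i ∧ μ i ≤ κ i

/-- `κ / μ` is a vertical strip. -/
def VStrip (μ κ : ℕ → ℕ) : Prop := (∀ i j, i ≤ j → μ j ≤ μ i) ∧ ∀ i, μ i ≤ κ i ∧ κ i ≤ μ i + 1

/-- The shifted vector `κ + δ`. -/
def dl (N : ℕ) (κ : ℕ → ℕ) : Fin N → ℕ := fun i => κ i + (N - 1 - i)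

/-- Extension by zero after removal of the staircase. -/
def undl {N : ℕ} (q : Fin N → ℕ) : ℕ → ℕ := fun i => if h : i < N then q ⟨i, h⟩ - (N - 1 - i) else 0

lemma HStrip.isPt {N : ℕ} {μ κ : ℕ → ℕ} (h : HStrip μ κ) (hκ : IsPt N κ) : IsPt N μ := by
  refine ⟨fun i j hij => ?_, fun i hi => ?_⟩
  · rcases hij.eq_or_lt with rfl | hlt
    · rfl
    · exact (h j).2.trans ((hκ.1 (i + 1) j hlt).trans (h i).1)
  · have := (h i).2; have := hκ.2 i hi; omega

lemma VStrip.isPt {N : ℕ} {μ κ : ℕ → ℕ} (h : VStrip μ κ) (hκ : IsPt N κ) : IsPt N μ := by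
  refine ⟨h.1, fun i hi => ?_⟩
  have := (h.2 i).1; have := hκ.2 i hi; omega

lemma sum_dl (N : ℕ) (κ : ℕ → ℕ) : ∑ i, dl N κ i = sz N κ + ∑ i : Fin N, (N - 1 - (i : ℕ)) := by
  unfold dl sz
  rw [sum_add_distrib, ← Fin.sum_univ_eq_sum_range]

lemma dl_undl {N : ℕ} (q : Fin N → ℕ) (hq : ∀ i : Fin N, N - 1 - (i : ℕ) ≤ q i) :
    dl N (undl q) = q := by
  funext i
  have := hq i
  simp only [dl, undl, i.2, dif_pos, Fin.eta]
  omega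

lemma le_of_strictAnti {N : ℕ} {q : Fin N → ℕ}
    (hq : ∀ i j : Fin N, (i : ℕ) + 1 = j → q j < q i) (i : Fin N) : N - 1 - (i : ℕ) ≤ q i := by
  obtain ⟨d, hd⟩ : ∃ d, d = N - 1 - (i : ℕ) := ⟨_, rfl⟩
  induction d generalizing i with
  | zero => omega
  | succ d ih =>
    have hi : (i : ℕ) + 1 < N := by omega
    have h1 := ih ⟨i + 1, hi⟩ (by simp only; omega)
    have h2 := hq i ⟨i + 1, hi⟩ rfl
    simp only at h1
    omega

lemma dl_lt {N : ℕ} {κ : ℕ → ℕ} (hκ : IsPt N κ) (i j : Fin N) (h : i < j) :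
    dl N κ j < dl N κ i := by
  have := hκ.1 i j (by exact_mod_cast h.le)
  have h2 : (i : ℕ) < j := h
  simp only [dl]
  omega

lemma isPt_undl {N : ℕ} {q : Fin N → ℕ}
    (hq : ∀ i j : Fin N, (i : ℕ) + 1 = j → q j < q i) : IsPt N (undl q) := by
  refine ⟨antitone_nat_of_succ_le (fun i => ?_), fun i hi => by simp [undl, hi]⟩
  unfold undl
  split_ifs with h1 h2
  · have := hq ⟨i, h2⟩ ⟨i + 1, h1⟩ rfl
    have := le_of_strictAnti hq ⟨i + 1, h1⟩
    simp only at this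
    omega
  · omega
  · exact Nat.zero_le _
  · exact Nat.zero_le _

/-- A Pieri rule: multiplication by `F r` adds strips of type `R` and size `r`. -/
structure Pieri (N : ℕ) (R : (ℕ → ℕ) → (ℕ → ℕ) → Prop) (F : ℕ → MvPolynomial (Fin N) ℚ) :
    Prop where
  symm : ∀ r, (F r).IsSymmetric
  le : ∀ μ κ i, R μ κ → μ i ≤ κ i
  isPt : ∀ μ κ, R μ κ → IsPt N κ → IsPt N μ
  rule : ∀ A κ r, IsAlt A → IsPt N κ → cf (A * F r) (dl N κ) =
    ∑ᶠ μ ∈ {μ | R μ κ ∧ sz N κ = sz N μ + r}, cf A (dl N μ)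

lemma sum_filter_interlacing {N : ℕ} {A : MvPolynomial (Fin N) ℚ} (hA : IsAlt A) (l : Fin N → ℕ)
    (hl : ∀ i j : Fin N, i < j → l j < l i) (r : ℕ) :
    ∑ q ∈ (Iic l).filter (fun q => ∑ i, l i = ∑ i, q i + r), cf A q =
    ∑ q ∈ (Iic l).filter (fun q => ∑ i, l i = ∑ i, q i + r ∧
      ∀ i j : Fin N, (i : ℕ) + 1 = j → l j < q i), cf A q := by
  rw [← sum_filter_add_sum_filter_not ((Iic l).filter (fun q => ∑ i, l i = ∑ i, q i + r))
    (fun q => ∀ i j : Fin N, (i : ℕ) + 1 = j → l j < q i), filter_filter, add_eq_left]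
  have key : ∀ q : Fin N → ℕ, (¬ ∀ i j : Fin N, (i : ℕ) + 1 = j → l j < q i) →
      ∃ ij : Fin N × Fin N, (ij.1 : ℕ) + 1 = ij.2 ∧ q ij.1 ≤ l ij.2 ∧
        ∀ i' j' : Fin N, i' < ij.1 → (i' : ℕ) + 1 = j' → l j' < q i' := by
    intro q hq
    push Not at hq
    have hex : ∃ i : ℕ, ∃ (h : i + 1 < N), q ⟨i, by omega⟩ ≤ l ⟨i + 1, h⟩ := by
      obtain ⟨i, j, hij, hle⟩ := hq
      refine ⟨i, by omega, ?_⟩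
      have : (⟨i + 1, by omega⟩ : Fin N) = j := Fin.ext hij
      rw [this]; exact hle
    obtain ⟨h1, h2⟩ := Nat.find_spec hex
    refine ⟨(⟨Nat.find hex, by omega⟩, ⟨Nat.find hex + 1, h1⟩), rfl, h2, ?_⟩
    intro i' j' hlt hij
    have := Nat.find_min hex (m := i') hlt
    push Not at this
    have h3 := this (by omega)
    have h4 : (⟨i' + 1, by omega⟩ : Fin N) = j' := Fin.ext hij
    rwa [h4] at h3
  rcases Nat.eq_zero_or_pos N with rfl | hN
  · refine sum_eq_zero fun q hq => ?_
    rw [mem_filter] at hq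
    exact absurd (fun i => i.elim0) hq.2
  let ij : (Fin N → ℕ) → Fin N × Fin N := fun q =>
    if h : ¬ ∀ i j : Fin N, (i : ℕ) + 1 = j → l j < q i then (key q h).choose
    else (⟨0, hN⟩, ⟨0, hN⟩)
  have hij : ∀ q, (¬ ∀ i j : Fin N, (i : ℕ) + 1 = j → l j < q i) →
      ((ij q).1 : ℕ) + 1 = (ij q).2 ∧ q (ij q).1 ≤ l (ij q).2 ∧
        ∀ i' j' : Fin N, i' < (ij q).1 → (i' : ℕ) + 1 = j' → l j' < q i' := by
    intro q hq
    simp only [ij, dif_pos hq]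
    exact (key q hq).choose_spec
  have huniq : ∀ q (hq : ¬ ∀ i j : Fin N, (i : ℕ) + 1 = j → l j < q i) (a : Fin N × Fin N),
      ((a.1 : ℕ) + 1 = a.2 ∧ q a.1 ≤ l a.2 ∧
        ∀ i' j' : Fin N, i' < a.1 → (i' : ℕ) + 1 = j' → l j' < q i') → ij q = a := by
    intro q hq a ⟨h1, h2, h3⟩
    obtain ⟨g1, g2, g3⟩ := hij q hq
    have : (ij q).1 = a.1 := by
      rcases lt_trichotomy (ij q).1 a.1 with h | h | h
      · have := h3 _ _ h g1; omega
      · exact h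
      · have := g3 _ _ h h1; omega
    refine Prod.ext this (Fin.ext ?_)
    rw [← g1, ← h1, this]
  have hnew : ∀ q ≤ l, (hq : ¬ ∀ i j : Fin N, (i : ℕ) + 1 = j → l j < q i) →
      q ∘ swap (ij q).1 (ij q).2 ≤ l ∧
      (((ij q).1 : ℕ) + 1 = (ij q).2 ∧ (q ∘ swap (ij q).1 (ij q).2) (ij q).1 ≤ l (ij q).2 ∧
        ∀ i' j' : Fin N, i' < (ij q).1 → (i' : ℕ) + 1 = j' →
          l j' < (q ∘ swap (ij q).1 (ij q).2) i') := by
    intro q hle hq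
    obtain ⟨g1, g2, g3⟩ := hij q hq
    have hlt : (ij q).1 < (ij q).2 := by rw [Fin.lt_def]; omega
    refine ⟨fun k => ?_, g1, ?_, ?_⟩
    · simp only [Function.comp, swap_apply_def]
      split_ifs with h1 h2
      · rw [h1]; exact (hle _).trans (hl _ _ hlt).le
      · rw [h2]; exact g2
      · exact hle k
    · simp only [Function.comp, swap_apply_left]; exact hle _
    · intro i' j' h1 h2
      simp only [Function.comp]
      rw [swap_apply_of_ne_of_ne h1.ne (h1.trans hlt).ne]
      exact g3 i' j' h1 h2
  refine sum_involution (fun q _ => q ∘ swap (ij q).1 (ij q).2) ?_ ?_ ?_ ?_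
  · intro q hq
    rw [mem_filter] at hq
    obtain ⟨g1, -, -⟩ := hij q hq.2
    rw [hA.cf_swap (by intro h; rw [h] at g1; omega)]
    ring
  · intro q hq hne heq
    rw [mem_filter] at hq
    obtain ⟨g1, -, -⟩ := hij q hq.2
    have := hA.cf_swap (i := (ij q).1) (j := (ij q).2) (by intro h; rw [h] at g1; omega) q
    rw [heq] at this
    exact hne (by linarith)
  · intro q hq
    simp only [mem_filter, mem_Iic] at hq ⊢
    obtain ⟨h1, g1, g2, g3⟩ := hnew q hq.1.1 hq.2
    refine ⟨⟨h1, ?_⟩, fun h => ?_⟩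
    · rw [hq.1.2]; congr 1
      exact (Equiv.sum_comp (swap (ij q).1 (ij q).2) q).symm
    · have := h _ _ g1; omega
  · intro q hq
    simp only [mem_filter, mem_Iic] at hq
    obtain ⟨h1, g1, g2, g3⟩ := hnew q hq.1.1 hq.2
    have : ij (q ∘ swap (ij q).1 (ij q).2) = ij q :=
      huniq _ (fun h => by have := h _ _ g1; omega) _ ⟨g1, g2, g3⟩
    rw [this]
    funext k
    simp

lemma pieri_h (N : ℕ) : Pieri N HStrip (cs Set.univ MvPolynomial.X) where
  symm := cs_isSymmetric _
  le := fun μ κ i h => (h i).2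
  isPt := fun μ κ h hκ => h.isPt hκ
  rule := by
    intro A κ r hA hκ
    rw [cf_mul_cs]
    simp only [Set.mem_univ, implies_true, and_true]
    rw [sum_filter_interlacing hA _ (dl_lt hκ), ← finsum_mem_coe_finset]
    refine finsum_mem_eq_of_bijOn undl ?_ ?_
    · have han : ∀ q : Fin N → ℕ, q ≤ dl N κ →
          (∀ i j : Fin N, (i : ℕ) + 1 = j → dl N κ j < q i) →
          ∀ i j : Fin N, (i : ℕ) + 1 = j → q j < q i := fun q h1 h2 i j hij =>
        (h1 j).trans_lt (h2 i j hij)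
      refine ⟨fun q hq => ?_, fun q hq q' hq' heq => ?_, fun μ hμ => ?_⟩
      · simp only [coe_filter, Set.mem_ofPred_eq, mem_Iic] at hq
        obtain ⟨h1, h2, h3⟩ := hq
        have h4 := dl_undl q (le_of_strictAnti (han q h1 h3))
        refine ⟨fun i => ?_, ?_⟩
        · by_cases hi : i < N
          · have h5 := h1 ⟨i, hi⟩
            by_cases hi' : i + 1 < N
            · have h6 := h3 ⟨i, hi⟩ ⟨i + 1, hi'⟩ rfl
              simp only [dl, undl, hi, dif_pos] at h5 h6 ⊢
              omega
            · have := hκ.2 (i + 1) (by omega)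
              simp only [dl, undl, hi, dif_pos] at h5 ⊢
              omega
          · have := hκ.2 (i + 1) (by omega)
            simp [undl, hi, this]
        · have h6 := sum_dl N κ
          have h7 := sum_dl N (undl q)
          rw [h4] at h7
          omega
      · simp only [coe_filter, Set.mem_ofPred_eq, mem_Iic] at hq hq'
        rw [← dl_undl q (le_of_strictAnti (han q hq.1 hq.2.2)),
          ← dl_undl q' (le_of_strictAnti (han q' hq'.1 hq'.2.2)), heq]
      · obtain ⟨h1, h2⟩ := hμ
        refine ⟨dl N μ, ?_, ?_⟩
        · simp only [coe_filter, Set.mem_ofPred_eq, mem_Iic]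
          refine ⟨fun i => ?_, ?_, fun i j hij => ?_⟩
          · have := (h1 i).2; simp only [dl]; omega
          · rw [sum_dl, sum_dl]; omega
          · have := (h1 i).1; rw [hij] at this; simp only [dl]; omega
        · funext i
          by_cases hi : i < N
          · simp [undl, dl, hi]
          · have := (h1.isPt hκ).2 i (by omega)
            simp [undl, hi, this]
    · intro q hq
      simp only [coe_filter, Set.mem_ofPred_eq, mem_Iic] at hq
      rw [dl_undl q (le_of_strictAnti fun i j hij => (hq.1 j).trans_lt (hq.2.2 i j hij))]

lemma pieri_of_mem_iff (N : ℕ) (S : Set ℕ) (hS : ∀ x, x ∈ S ↔ x = 0 ∨ x = 1) :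
    Pieri N VStrip (cs S MvPolynomial.X) where
  symm := cs_isSymmetric _
  le := fun μ κ i h => (h.2 i).1
  isPt := fun μ κ h hκ => h.isPt hκ
  rule := by
    intro A κ r hA hκ
    rw [cf_mul_cs, ← sum_filter_add_sum_filter_not _
      (fun q : Fin N → ℕ => ∀ i j : Fin N, (i : ℕ) + 1 = j → q j < q i), filter_filter]
    rw [sum_eq_zero (s := filter _ (filter _ _)), add_zero, ← finsum_mem_coe_finset]
    · refine finsum_mem_eq_of_bijOn undl ?_ ?_
      · refine ⟨fun q hq => ?_, fun q hq q' hq' heq => ?_, fun μ hμ => ?_⟩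
        · simp only [coe_filter, Set.mem_ofPred_eq, mem_Iic, hS] at hq
          obtain ⟨h1, ⟨h2, h3⟩, h5⟩ := hq
          have h4 := dl_undl q (le_of_strictAnti h5)
          refine ⟨⟨(isPt_undl h5).1, fun i => ?_⟩, ?_⟩
          · by_cases hi : i < N
            · have h6 := h1 ⟨i, hi⟩
              have h7 := h3 ⟨i, hi⟩
              have h8 := congrFun h4 ⟨i, hi⟩
              simp only [dl] at h6 h7 h8
              omega
            · have := hκ.2 i (by omega)
              simp [undl, hi, this]
          · have h6 := sum_dl N κ
            have h7 := sum_dl N (undl q)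
            rw [h4] at h7
            omega
        · simp only [coe_filter, Set.mem_ofPred_eq, mem_Iic] at hq hq'
          rw [← dl_undl q (le_of_strictAnti hq.2.2), ← dl_undl q' (le_of_strictAnti hq'.2.2), heq]
        · obtain ⟨h1, h2⟩ := hμ
          refine ⟨dl N μ, ?_, ?_⟩
          · simp only [coe_filter, Set.mem_ofPred_eq, mem_Iic, hS]
            refine ⟨fun i => ?_, ⟨?_, fun i => ?_⟩, fun i j hij => ?_⟩
            · have := (h1.2 i).1; simp only [dl]; omega
            · rw [sum_dl, sum_dl]; omega
            · have := (h1.2 i); simp only [dl]; omega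
            · exact dl_lt (h1.isPt hκ) _ _ (by rw [Fin.lt_def]; omega)
          · funext i
            by_cases hi : i < N
            · simp [undl, dl, hi]
            · have := (h1.isPt hκ).2 i (by omega)
              simp [undl, hi, this]
      · intro q hq
        simp only [coe_filter, Set.mem_ofPred_eq, mem_Iic] at hq
        rw [dl_undl q (le_of_strictAnti hq.2.2)]
    · intro q hq
      simp only [mem_filter, mem_Iic, hS] at hq
      obtain ⟨⟨h1, h2, h3⟩, h4⟩ := hq
      push Not at h4
      obtain ⟨i, j, hij, hle⟩ := h4
      have hlt : i < j := by rw [Fin.lt_def]; omega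
      refine hA.cf_eq_zero hlt.ne q ?_
      have := dl_lt hκ i j hlt
      have := h3 i
      have : q i ≤ dl N κ i := h1 i
      have : q j ≤ dl N κ j := h1 j
      omega

lemma pieri_e (N : ℕ) : Pieri N VStrip (cs {0, 1} MvPolynomial.X) :=
  pieri_of_mem_iff N _ fun x => by simp

end

section
/-- Chains of length `r` ending in `κ` whose steps satisfy `R`. -/
def Ch (R : (ℕ → ℕ) → (ℕ → ℕ) → Prop) (r : ℕ) (κ : ℕ → ℕ) : Set (ℕ → ℕ → ℕ) :=
  {p | (∀ k < r, R (p k) (p (k + 1))) ∧ ∀ k, r ≤ k → p k = κ}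

/-- The `k`-th step of the chain `p` has size `c k` for `k < r`. -/
def HasSteps (N r : ℕ) (c : ℕ → ℕ) (p : ℕ → ℕ → ℕ) : Prop :=
  ∀ k < r, sz N (p (k + 1)) = sz N (p k) + c k

/-- Extension of a chain of length `r` by one step. -/
def chainExtend (r : ℕ) (κ : ℕ → ℕ) (p : ℕ → ℕ → ℕ) : ℕ → ℕ → ℕ := fun k => if k ≤ r then p k else κ

lemma finite_le (N : ℕ) (κ : ℕ → ℕ) (hκ : ∀ i, N ≤ i → κ i = 0) :
    {μ : ℕ → ℕ | ∀ i, μ i ≤ κ i}.Finite := by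
  refine Set.Finite.of_finite_image (f := fun μ (i : Fin N) => μ i)
    ((Set.finite_Iic (fun i : Fin N => κ i)).subset ?_) ?_
  · rintro _ ⟨μ, hμ, rfl⟩ i
    exact hμ i
  · intro μ hμ ν hν h
    funext i
    by_cases hi : i < N
    · exact congrFun h ⟨i, hi⟩
    · have := hμ i; have := hν i; have := hκ i (by omega); omega

variable {N : ℕ} {R : (ℕ → ℕ) → (ℕ → ℕ) → Prop} {F : ℕ → MvPolynomial (Fin N) ℚ}

lemma Pieri.finite (hP : Pieri N R F) {κ : ℕ → ℕ} (hκ : IsPt N κ) : {μ | R μ κ}.Finite :=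
  (finite_le N κ hκ.2).subset fun _ h i => hP.le _ _ i h

lemma chainExtend_bijOn (c : ℕ → ℕ) (r : ℕ) (κ : ℕ → ℕ) :
    Set.BijOn (chainExtend r κ)
      (⋃ μ ∈ {μ | R μ κ ∧ sz N κ = sz N μ + c r}, {p ∈ Ch R r μ | HasSteps N r c p})
      {p ∈ Ch R (r + 1) κ | HasSteps N (r + 1) c p} := by
  refine ⟨fun p hp => ?_, fun p hp p' hp' h => ?_, fun p hp => ?_⟩
  · simp only [Set.mem_iUnion] at hp
    obtain ⟨μ, ⟨h1, h2⟩, ⟨h3, h4⟩, h5⟩ := hp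
    have h6 := h4 r le_rfl
    refine ⟨⟨fun k hk => ?_, fun k hk => ?_⟩, fun k hk => ?_⟩
    · rcases Nat.lt_succ_iff_lt_or_eq.1 hk with h | rfl
      · simpa [chainExtend, h.le, Nat.succ_le_of_lt h] using h3 k h
      · simpa [chainExtend, h6] using h1
    · simp [chainExtend, show ¬ k ≤ r by omega]
    · rcases Nat.lt_succ_iff_lt_or_eq.1 hk with h | rfl
      · simpa [chainExtend, h.le, Nat.succ_le_of_lt h] using h5 k h
      · simpa [chainExtend, h6] using h2
  · simp only [Set.mem_iUnion] at hp hp'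
    obtain ⟨μ, -, ⟨h3, h4⟩, -⟩ := hp
    obtain ⟨μ', -, ⟨h3', h4'⟩, -⟩ := hp'
    have h5 : ∀ k ≤ r, p k = p' k := fun k hk => by
      simpa [chainExtend, hk] using congrFun h k
    funext k
    rcases le_total k r with hk | hk
    · rw [h5 k hk]
    · rw [h4 k hk, h4' k hk, ← h4 r le_rfl, ← h4' r le_rfl, h5 r le_rfl]
  · obtain ⟨⟨h1, h2⟩, h3⟩ := hp
    have h4 := h2 (r + 1) le_rfl
    refine ⟨fun k => if k ≤ r then p k else p r, ?_, ?_⟩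
    · simp only [Set.mem_iUnion]
      refine ⟨p r, ⟨?_, ?_⟩, ⟨fun k hk => ?_, fun k hk => ?_⟩, fun k hk => ?_⟩
      · have := h1 r (by omega)
        rwa [h4] at this
      · have := h3 r (by omega)
        rwa [h4] at this
      · simpa [hk.le, Nat.succ_le_of_lt hk] using h1 k (by omega)
      · dsimp only
        split_ifs with h
        · rw [le_antisymm h hk]
        · rfl
      · simpa [hk.le, Nat.succ_le_of_lt hk] using h3 k (by omega)
    · funext k
      unfold chainExtend
      split_ifs with h
      · exact if_pos h
      · rw [h2 k (by omega)]

lemma Pieri.ch_isPt (hP : Pieri N R F) {κ : ℕ → ℕ} (hκ : IsPt N κ) {r : ℕ} {p : ℕ → ℕ → ℕ}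
    (hp : p ∈ Ch R r κ) (k : ℕ) : IsPt N (p k) := by
  rcases le_total r k with h | h
  · rw [hp.2 k h]; exact hκ
  · induction h using Nat.decreasingInduction with
    | self => rw [hp.2 r le_rfl]; exact hκ
    | of_succ k hk ih => exact hP.isPt _ _ (hp.1 k hk) ih

lemma Pieri.finite_ch (hP : Pieri N R F) {κ : ℕ → ℕ} (hκ : IsPt N κ) (r : ℕ) :
    (Ch R r κ).Finite := by
  have hle : ∀ p ∈ Ch R r κ, ∀ k i, p k i ≤ κ i := by
    intro p hp k i
    rcases le_total r k with h | h
    · rw [hp.2 k h]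
    · induction h using Nat.decreasingInduction with
      | self => rw [hp.2 r le_rfl]
      | of_succ k hk ih => exact (hP.le _ _ i (hp.1 k hk)).trans ih
  refine Set.Finite.of_finite_image (f := fun p (k : Fin r) => p k)
    ((Set.Finite.pi' (fun _ : Fin r => finite_le N κ hκ.2)).subset ?_) ?_
  · rintro _ ⟨p, hp, rfl⟩ k
    exact hle p hp k
  · intro p hp q hq h
    funext k
    by_cases hk : k < r
    · exact congrFun h ⟨k, hk⟩
    · rw [hp.2 k (by omega), hq.2 k (by omega)]

lemma isSymmetric_prod {ι : Type*} (s : Finset ι) (G : ι → MvPolynomial (Fin N) ℚ)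
    (h : ∀ i, (G i).IsSymmetric) : (∏ i ∈ s, G i).IsSymmetric := by
  intro e
  rw [map_prod]
  exact prod_congr rfl fun i _ => h i e

lemma Pieri.iterate (hP : Pieri N R F) {A : MvPolynomial (Fin N) ℚ} (hA : IsAlt A)
    (c : ℕ → ℕ) (r : ℕ) {κ : ℕ → ℕ} (hκ : IsPt N κ) :
    cf (A * ∏ k ∈ range r, F (c k)) (dl N κ) =
      ∑ᶠ p ∈ {p ∈ Ch R r κ | HasSteps N r c p}, cf A (dl N (p 0)) := by
  induction r generalizing κ with
  | zero =>
    have : {p ∈ Ch R 0 κ | HasSteps N 0 c p} = {fun _ => κ} := by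
      ext p
      simp only [Ch, HasSteps, not_lt_zero, false_imp_iff, implies_true, true_and,
        Set.mem_ofPred_eq,
        and_true, zero_le, forall_const, Set.mem_singleton_iff, funext_iff]
    rw [this, finsum_mem_singleton]
    simp
  | succ r ih =>
    rw [prod_range_succ, ← mul_assoc,
      hP.rule _ _ _ (hA.mul (isSymmetric_prod _ _ fun i => hP.symm _)) hκ]
    have hpt : ∀ μ ∈ {μ | R μ κ ∧ sz N κ = sz N μ + c r}, IsPt N μ := fun μ hμ =>
      hP.isPt _ _ hμ.1 hκ
    rw [finsum_mem_congr rfl fun μ hμ => ih (hpt μ hμ)]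
    rw [← finsum_mem_biUnion]
    · refine finsum_mem_eq_of_bijOn (chainExtend r κ) (chainExtend_bijOn c r κ) ?_
      intro p hp
      simp [chainExtend]
    · intro μ _ μ' _ hne
      refine Set.disjoint_left.2 fun p hp hp' => hne ?_
      rw [← hp.1.2 r le_rfl, ← hp'.1.2 r le_rfl]
    · exact (hP.finite hκ).subset fun μ hμ => hμ.1
    · exact fun μ hμ => (hP.finite_ch (hpt μ hμ) r).subset fun p hp => hp.1

/-- The Vandermonde alternant `a_δ`. -/
noncomputable def ad (N : ℕ) : MvPolynomial (Fin N) ℚ :=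
  ∑ σ : Perm (Fin N), ((Perm.sign σ : ℤ) : ℚ) • ∏ i, MvPolynomial.X i ^ (N - 1 - (σ i : ℕ))

lemma sign_cast_mul {α : Type*} [Fintype α] [DecidableEq α] (σ τ : Perm α) :
    ((Perm.sign (σ * τ) : ℤ) : ℚ) = ((Perm.sign σ : ℤ) : ℚ) * ((Perm.sign τ : ℤ) : ℚ) := by
  rw [Perm.sign_mul]; push_cast; rfl

lemma sign_cast_mul_self {α : Type*} [Fintype α] [DecidableEq α] (σ : Perm α) :
    ((Perm.sign σ : ℤ) : ℚ) * ((Perm.sign σ : ℤ) : ℚ) = 1 := by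
  rw [← Int.cast_mul, ← Units.val_mul, Int.units_mul_self]; simp

lemma ad_isAlt : IsAlt (ad N) := by
  intro τ
  simp only [ad, map_sum, map_smul, map_prod, map_pow, MvPolynomial.rename_X, smul_sum, smul_smul]
  refine Fintype.sum_equiv (Equiv.mulRight τ⁻¹) _ _ fun σ => ?_
  have h1 : ((Perm.sign σ : ℤ) : ℚ) =
      ((Perm.sign τ : ℤ) : ℚ) * ((Perm.sign ((Equiv.mulRight τ⁻¹) σ) : ℤ) : ℚ) := by
    rw [Equiv.coe_mulRight, sign_cast_mul, Perm.sign_inv, mul_left_comm, sign_cast_mul_self,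
      mul_one]
  rw [h1]
  congr 1
  rw [← Equiv.prod_comp τ (fun j => (MvPolynomial.X j : MvPolynomial (Fin N) ℚ) ^
    (N - 1 - ((Equiv.mulRight τ⁻¹) σ j : ℕ)))]
  simp

lemma cf_ad_mul (G : MvPolynomial (Fin N) ℚ) (l : Fin N → ℕ) :
    cf (ad N * G) l = ∑ σ : Perm (Fin N), ((Perm.sign σ : ℤ) : ℚ) *
      if ∀ i, N - 1 - (σ i : ℕ) ≤ l i then cf G (fun i => l i - (N - 1 - (σ i : ℕ))) else 0 := by
  rw [ad, sum_mul, cf_sum]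
  refine sum_congr rfl fun σ _ => ?_
  rw [smul_mul_assoc, cf_smul, mul_comm (∏ _, _) G, prod_X_pow (fun i => N - 1 - (σ i : ℕ)),
    cf_mul_monomial]
  congr 1
  exact if_congr Iff.rfl rfl rfl

lemma cf_one (v : Fin N → ℕ) : cf 1 v = if v = 0 then 1 else 0 := by
  unfold cf
  rw [MvPolynomial.coeff_one]
  congr 1
  rw [eq_comm, eq_iff_iff]
  simp [Finsupp.ext_iff, funext_iff, eq_comm]

lemma sz_eq_zero {μ : ℕ → ℕ} (hμ : IsPt N μ) : sz N μ = 0 ↔ μ = 0 := by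
  unfold sz
  rw [sum_eq_zero_iff]
  refine ⟨fun h => ?_, fun h => by simp [h]⟩
  funext i
  by_cases hi : i < N
  · exact h i (mem_range.2 hi)
  · exact hμ.2 i (by omega)

lemma sum_staircase (σ : Perm (Fin N)) :
    ∑ i, (N - 1 - (σ i : ℕ)) = ∑ i : Fin N, (N - 1 - (i : ℕ)) :=
  Equiv.sum_comp σ (fun i : Fin N => N - 1 - (i : ℕ))

lemma cf_ad {μ : ℕ → ℕ} (hμ : IsPt N μ) : cf (ad N) (dl N μ) = if μ = 0 then 1 else 0 := by
  rw [← mul_one (ad N), cf_ad_mul]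
  have key : ∀ σ : Perm (Fin N), (∀ i, N - 1 - (σ i : ℕ) ≤ dl N μ i) →
      (fun i => dl N μ i - (N - 1 - (σ i : ℕ))) = 0 → μ = 0 ∧ σ = 1 := by
    intro σ h1 h2
    have h3 : ∀ i, dl N μ i = N - 1 - (σ i : ℕ) := fun i => by
      have := h1 i; have := congrFun h2 i; simp only [Pi.zero_apply] at this; omega
    have h4 := sum_dl N μ
    rw [sum_congr rfl fun i _ => h3 i, sum_staircase] at h4
    have h5 := (sz_eq_zero hμ).1 (by omega)
    refine ⟨h5, Equiv.ext fun i => Fin.ext ?_⟩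
    have h6 := h3 i
    have := (σ i).2
    simp only [dl, h5, Pi.zero_apply] at h6
    simp only [Perm.coe_one, id]
    omega
  split_ifs with h
  · rw [sum_eq_single 1]
    · subst h
      simp [dl, cf_one, funext_iff]
    · intro σ _ hσ
      split_ifs with h1
      · rw [cf_one, if_neg fun h2 => hσ (key σ h1 h2).2, mul_zero]
      · rw [mul_zero]
    · simp
  · refine sum_eq_zero fun σ _ => ?_
    split_ifs with h1
    · rw [cf_one, if_neg fun h2 => h (key σ h1 h2).1, mul_zero]
    · rw [mul_zero]

/-- The number of chains from `0` to `κ` of type `R` with step sizes `c`. -/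
noncomputable def nch (N : ℕ) (R : (ℕ → ℕ) → (ℕ → ℕ) → Prop) (c : ℕ → ℕ) (κ : ℕ → ℕ) : ℕ :=
  {p ∈ Ch R N κ | HasSteps N N c p ∧ p 0 = 0}.ncard

lemma finsum_mem_boole {α : Type*} (s : Set α) (hs : s.Finite) (P : α → Prop) :
    (∑ᶠ x ∈ s, if P x then (1 : ℚ) else 0) = ({x ∈ s | P x}.ncard : ℚ) := by
  rw [finsum_mem_eq_finite_toFinset_sum _ hs, sum_boole,
    Set.ncard_eq_toFinset_card _ (hs.subset fun x hx => hx.1)]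
  congr 2
  ext x
  simp

lemma Pieri.cf_ad_mul_prod (hP : Pieri N R F) (c : ℕ → ℕ) {κ : ℕ → ℕ} (hκ : IsPt N κ) :
    cf (ad N * ∏ k ∈ range N, F (c k)) (dl N κ) = nch N R c κ := by
  rw [hP.iterate ad_isAlt c N hκ]
  rw [finsum_mem_congr rfl fun p hp => cf_ad (hP.ch_isPt hκ hp.1 0), finsum_mem_boole]
  · unfold nch
    congr 3
    ext p
    simp only [Set.mem_ofPred_eq, and_assoc]
  · exact (hP.finite_ch hκ N).subset fun p hp => hp.1

end

section
variable {N : ℕ}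

/-- Row-cumulative number of cells added at step `k` of the chain `p` in the first `i` rows. -/
def cum (p : ℕ → ℕ → ℕ) (k i : ℕ) : ℕ := ∑ i' ∈ range i, (p (k + 1) i' - p k i')

/-- The lattice word condition for chains. -/
def Good (p : ℕ → ℕ → ℕ) : Prop := ∀ i k, cum p (k + 1) (i + 1) ≤ cum p k i

lemma IsPt.hstrip_self {κ : ℕ → ℕ} (hκ : IsPt N κ) : HStrip κ κ :=
  fun i => ⟨hκ.1 _ _ (Nat.le_succ i), le_rfl⟩

lemma Ch.hstrip {κ : ℕ → ℕ} (hκ : IsPt N κ) {p : ℕ → ℕ → ℕ} (hp : p ∈ Ch HStrip N κ) (k : ℕ) :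
    HStrip (p k) (p (k + 1)) := by
  rcases lt_or_ge k N with h | h
  · exact hp.1 k h
  · rw [hp.2 k h, hp.2 (k + 1) (by omega)]; exact hκ.hstrip_self

lemma Ch.isPt {κ : ℕ → ℕ} (hκ : IsPt N κ) {p : ℕ → ℕ → ℕ} (hp : p ∈ Ch HStrip N κ) (k : ℕ) :
    IsPt N (p k) := (pieri_h N).ch_isPt hκ hp k

lemma cum_add {p : ℕ → ℕ → ℕ} {k : ℕ} (h : HStrip (p k) (p (k + 1))) (i : ℕ) :
    cum p k i + ∑ i' ∈ range i, p k i' = ∑ i' ∈ range i, p (k + 1) i' := by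
  rw [cum, ← sum_add_distrib]
  exact sum_congr rfl fun i' _ => Nat.sub_add_cancel (h i').2

lemma cum_succ (p : ℕ → ℕ → ℕ) (k i : ℕ) :
    cum p k (i + 1) = cum p k i + (p (k + 1) i - p k i) := sum_range_succ _ _

lemma cum_zero (p : ℕ → ℕ → ℕ) (k : ℕ) : cum p k 0 = 0 := rfl

lemma cum_mono (p : ℕ → ℕ → ℕ) (k : ℕ) {i j : ℕ} (h : i ≤ j) : cum p k i ≤ cum p k j :=
  sum_le_sum_of_subset (range_subset_range.2 h)

lemma hasSteps_iff {κ : ℕ → ℕ} (hκ : IsPt N κ) {p : ℕ → ℕ → ℕ} (hp : p ∈ Ch HStrip N κ)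
    (c : ℕ → ℕ) : HasSteps N N c p ↔ ∀ k < N, cum p k N = c k := by
  refine forall₂_congr fun k _ => ?_
  have := cum_add (Ch.hstrip hκ hp k) N
  unfold sz
  omega

/-- Signed indicator that `z` is a dot-permutation of `ρ`. -/
noncomputable def dsign (N : ℕ) (ρ z : ℕ → ℕ) : ℚ :=
  ∑ τ : Perm (Fin N), ((Perm.sign τ : ℤ) : ℚ) *
    if ∀ j : Fin N, z j + (τ j : ℕ) = ρ (τ j) + j then 1 else 0

lemma dsign_dot_swap (ρ z z' : ℕ → ℕ) (k : ℕ) (hk : k + 1 < N) (h1 : z' k + 1 = z (k + 1))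
    (h2 : z' (k + 1) = z k + 1) (h3 : ∀ j, j ≠ k → j ≠ k + 1 → z' j = z j) :
    dsign N ρ z' = - dsign N ρ z := by
  have hk' : k < N := by omega
  set s : Perm (Fin N) := swap ⟨k, hk'⟩ ⟨k + 1, hk⟩ with hs
  have hne : (⟨k, hk'⟩ : Fin N) ≠ ⟨k + 1, hk⟩ := by simp
  have hz : ∀ j : Fin N, (z' j : ℤ) - j = z (s j) - (s j : ℕ) := by
    intro j
    by_cases hj1 : j = ⟨k, hk'⟩
    · subst hj1; rw [hs, swap_apply_left]; simp only; omega
    by_cases hj2 : j = ⟨k + 1, hk⟩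
    · subst hj2; rw [hs, swap_apply_right]; simp only; omega
    rw [hs, swap_apply_of_ne_of_ne hj1 hj2, h3]
    · exact fun h => hj1 (Fin.ext h)
    · exact fun h => hj2 (Fin.ext h)
  unfold dsign
  rw [← sum_neg_distrib]
  refine Fintype.sum_equiv (Equiv.mulRight s) _ _ fun τ => ?_
  rw [Equiv.coe_mulRight, sign_cast_mul, hs, Perm.sign_swap hne, ← hs]
  have : (∀ j : Fin N, z' j + (τ j : ℕ) = ρ (τ j) + j) ↔
      ∀ j : Fin N, z j + ((τ * s) j : ℕ) = ρ ((τ * s) j) + j := by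
    rw [← s.forall_congr_right]
    refine forall_congr' fun j => ?_
    have h4 := hz (s j)
    rw [hs, swap_apply_self, ← hs] at h4
    simp only [Perm.mul_apply]
    omega
  rw [if_congr this rfl rfl]
  push_cast
  ring

lemma dsign_of_antitone (ρ z : ℕ → ℕ) (hρ : ∀ i j, i ≤ j → ρ j ≤ ρ i)
    (hz : ∀ i j, i ≤ j → z j ≤ z i) :
    dsign N ρ z = if ∀ j < N, z j = ρ j then 1 else 0 := by
  unfold dsign
  have key : ∀ τ : Perm (Fin N), (∀ j : Fin N, z j + (τ j : ℕ) = ρ (τ j) + j) → τ = 1 := by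
    intro τ hτ
    have hmono : StrictMono τ := by
      intro i j hij
      by_contra hle
      have h1 : (τ j : ℕ) ≤ τ i := by exact_mod_cast not_lt.1 hle
      have h2 : (i : ℕ) < j := hij
      have := hτ i; have := hτ j; have := hρ _ _ h1; have := hz _ _ h2.le
      omega
    have h4 := Subsingleton.elim (hmono.orderIsoOfSurjective τ τ.surjective) (OrderIso.refl _)
    ext j
    exact congrArg Fin.val (DFunLike.congr_fun h4 j)
  rw [sum_eq_single 1]
  · rw [Perm.sign_one, Units.val_one, Int.cast_one, one_mul]
    refine if_congr ?_ rfl rfl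
    refine ⟨fun h j hj => by simpa using h ⟨j, hj⟩, fun h j => by simp [h j j.2]⟩
  · intro τ _ hτ
    rw [if_neg fun h => hτ (key τ h), mul_zero]
  · simp

/-- The Schur polynomial, by the Jacobi–Trudi formula. -/
noncomputable def sch (N : ℕ) (ρ : ℕ → ℕ) : MvPolynomial (Fin N) ℚ :=
  ∑ τ : Perm (Fin N), ((Perm.sign τ : ℤ) : ℚ) • ∏ k : Fin N,
    if (τ k : ℕ) ≤ ρ (τ k) + k then cs Set.univ MvPolynomial.X (ρ (τ k) + k - τ k) else 0

lemma isSymmetric_sum {ι : Type*} (s : Finset ι) (G : ι → MvPolynomial (Fin N) ℚ)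
    (h : ∀ i, (G i).IsSymmetric) : (∑ i ∈ s, G i).IsSymmetric := by
  intro e
  rw [map_sum]
  exact sum_congr rfl fun i _ => h i e

lemma sch_isSymmetric (ρ : ℕ → ℕ) : (sch N ρ).IsSymmetric := by
  refine isSymmetric_sum _ _ fun τ => MvPolynomial.IsSymmetric.smul _
    (isSymmetric_prod _ _ fun k => ?_)
  split_ifs
  · exact cs_isSymmetric _ _
  · exact MvPolynomial.IsSymmetric.zero

lemma cf_mul_sch {A : MvPolynomial (Fin N) ℚ} (hA : IsAlt A) (ρ : ℕ → ℕ) {κ : ℕ → ℕ}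
    (hκ : IsPt N κ) : cf (A * sch N ρ) (dl N κ) =
      ∑ p ∈ ((pieri_h N).finite_ch hκ N).toFinset,
        dsign N ρ (fun k => cum p k N) * cf A (dl N (p 0)) := by
  simp only [sch, dsign, mul_sum, sum_mul, cf_sum]
  rw [sum_comm]
  refine sum_congr rfl fun τ _ => ?_
  rw [mul_smul_comm, cf_smul]
  simp only [mul_assoc]
  rw [← mul_sum]
  congr 1
  by_cases hτ : ∀ k : Fin N, (τ k : ℕ) ≤ ρ (τ k) + k
  · have h1 : (∏ k : Fin N, if (τ k : ℕ) ≤ ρ (τ k) + k then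
        (cs Set.univ MvPolynomial.X (ρ (τ k) + k - τ k) : MvPolynomial (Fin N) ℚ) else 0) =
        ∏ k ∈ range N, cs Set.univ MvPolynomial.X
          (if h : k < N then ρ (τ ⟨k, h⟩) + k - τ ⟨k, h⟩ else 0) := by
      rw [Finset.prod_range]
      refine prod_congr rfl fun k _ => ?_
      rw [if_pos (hτ k), dif_pos k.2]
    rw [h1,
      (pieri_h N).iterate hA (fun k => if h : k < N then ρ (τ ⟨k, h⟩) + k - τ ⟨k, h⟩ else 0) N hκ,
      finsum_mem_eq_finite_toFinset_sum _ (((pieri_h N).finite_ch hκ N).subset fun p hp => hp.1)]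
    simp only [ite_mul, one_mul, zero_mul]
    rw [← sum_filter]
    refine sum_congr ?_ fun _ _ => rfl
    ext p
    simp only [Set.Finite.mem_toFinset, Set.mem_ofPred_eq, mem_filter]
    refine and_congr_right fun hp => ?_
    rw [hasSteps_iff hκ hp]
    refine ⟨fun h j => ?_, fun h k hk => ?_⟩
    · have h2 := h j j.2
      simp only [j.2, dif_pos, Fin.eta] at h2
      have := hτ j
      omega
    · have h2 := h ⟨k, hk⟩
      simp only at h2
      rw [dif_pos hk]
      omega
  · push Not at hτ
    obtain ⟨k, hk⟩ := hτ
    rw [prod_eq_zero (mem_univ k) (if_neg (by omega)), mul_zero, sum_eq_zero]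
    · simp [cf]
    · intro p _
      rw [if_neg, zero_mul]
      intro h
      have := h k
      omega

end

section
variable {N : ℕ}

/-- The lattice word condition fails first in row `i`, and last for the letter `k`. -/
def FirstFail (p : ℕ → ℕ → ℕ) (i k : ℕ) : Prop :=
  cum p k i < cum p (k + 1) (i + 1) ∧ (∀ i' < i, ∀ k', cum p (k' + 1) (i' + 1) ≤ cum p k' i') ∧
    ∀ k', k < k' → cum p (k' + 1) (i + 1) ≤ cum p k' i

/-- The involution on bad chains: reflect the entries of level `k + 1` in rows `≥ i`. -/
def reflect (p : ℕ → ℕ → ℕ) (i k : ℕ) : ℕ → ℕ → ℕ := fun j i' =>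
  if j = k + 1 then
    if i' < i then p (k + 1) i'
    else if i' = i then
      max (p k i) (p (k + 2) (i + 1)) + (p (k + 2) i + cum p (k + 1) i - (cum p k i + 1)) -
        p (k + 1) i
    else max (p k i') (p (k + 2) (i' + 1)) + min (p (k + 2) i') (p k (i' - 1)) - p (k + 1) i'
  else p j i'

lemma FirstFail.unique {p : ℕ → ℕ → ℕ} {i k i₂ k₂ : ℕ} (h : FirstFail p i k)
    (h₂ : FirstFail p i₂ k₂) : i = i₂ ∧ k = k₂ := by
  have hi : i = i₂ := by
    rcases lt_trichotomy i i₂ with hlt | heq | hlt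
    · exact absurd h.1 (not_lt.2 (h₂.2.1 i hlt k))
    · exact heq
    · exact absurd h₂.1 (not_lt.2 (h.2.1 i₂ hlt k₂))
  subst hi
  refine ⟨rfl, ?_⟩
  rcases lt_trichotomy k k₂ with hlt | heq | hlt
  · exact absurd h₂.1 (not_lt.2 (h.2.2 k₂ hlt))
  · exact heq
  · exact absurd h.1 (not_lt.2 (h₂.2.2 k hlt))

lemma cum_of_le {κ : ℕ → ℕ} {p : ℕ → ℕ → ℕ} (hp : p ∈ Ch HStrip N κ) {k : ℕ}
    (hk : N ≤ k) (i : ℕ) : cum p k i = 0 := by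
  unfold cum
  rw [hp.2 k hk, hp.2 (k + 1) (by omega)]
  simp

lemma exists_firstFail {κ : ℕ → ℕ} {p : ℕ → ℕ → ℕ} (hp : p ∈ Ch HStrip N κ)
    (h : ¬ Good p) : ∃ i k, FirstFail p i k := by
  have hex : ∃ i, ∃ k, cum p k i < cum p (k + 1) (i + 1) := by
    unfold Good at h; push Not at h; exact h
  obtain ⟨k₀, hk₀⟩ := Nat.find_spec hex
  set i := Nat.find hex
  have hb : ∀ k, cum p k i < cum p (k + 1) (i + 1) → k ≤ N := by
    intro k hk
    by_contra hlt
    rw [cum_of_le hp (k := k + 1) (by omega)] at hk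
    omega
  refine ⟨i, Nat.findGreatest (fun k => cum p k i < cum p (k + 1) (i + 1)) N, ?_, ?_, ?_⟩
  · exact Nat.findGreatest_spec (P := fun k => cum p k i < cum p (k + 1) (i + 1)) (hb _ hk₀) hk₀
  · intro i' hi' k'
    have := Nat.find_min hex hi'
    push Not at this
    exact this k'
  · intro k' hk'
    by_contra hlt
    rw [not_le] at hlt
    exact Nat.findGreatest_is_greatest hk' (hb _ hlt) hlt

lemma FirstFail.bounds {κ : ℕ → ℕ} (hκ : IsPt N κ) {p : ℕ → ℕ → ℕ} (hp : p ∈ Ch HStrip N κ)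
    {i k : ℕ} (h : FirstFail p i k) : i < N ∧ k + 1 < N := by
  refine ⟨?_, ?_⟩
  · by_contra hi
    have h1 := h.1
    have h2 : p (k + 2) i = 0 := (Ch.isPt hκ hp _).2 i (by omega)
    rw [cum_succ, h2] at h1
    rcases Nat.eq_zero_or_pos i with rfl | hi0
    · simp [cum_zero] at h1
    · obtain ⟨i, rfl⟩ : ∃ i', i = i' + 1 := ⟨i - 1, by omega⟩
      have h3 := h.2.1 i (by omega) k
      have h4 := cum_mono p k (show i ≤ i + 1 by omega)
      omega
  · by_contra hk
    have h1 := h.1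
    rw [cum_of_le hp (k := k + 1) (by omega)] at h1
    omega

lemma FirstFail.cum_le {p : ℕ → ℕ → ℕ} {i k : ℕ} (h : FirstFail p i k) :
    cum p (k + 1) i ≤ cum p k i := by
  rcases Nat.eq_zero_or_pos i with rfl | hi
  · simp [cum_zero]
  · obtain ⟨i, rfl⟩ : ∃ i', i = i' + 1 := ⟨i - 1, by omega⟩
    exact (h.2.1 i (by omega) k).trans (cum_mono p k (Nat.le_succ i))

lemma FirstFail.not_good {p : ℕ → ℕ → ℕ} {i k : ℕ} (h : FirstFail p i k) : ¬ Good p :=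
  fun hg => absurd h.1 (not_lt.2 (hg i k))

lemma reflect_ne (p : ℕ → ℕ → ℕ) (i k : ℕ) {j : ℕ} (hj : j ≠ k + 1) : reflect p i k j = p j := by
  funext i'; simp [reflect, hj]

lemma reflect_lt (p : ℕ → ℕ → ℕ) {i k j i' : ℕ} (hi : i' < i) : reflect p i k j i' = p j i' := by
  unfold reflect
  split_ifs with h
  · rw [h]
  · rfl

lemma cum_reflect_of_le (p : ℕ → ℕ → ℕ) {i k j i' : ℕ} (hi : i' ≤ i) :
    cum (reflect p i k) j i' = cum p j i' := by
  unfold cum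
  refine sum_congr rfl fun x hx => ?_
  rw [mem_range] at hx
  rw [reflect_lt p (by omega), reflect_lt p (by omega)]

lemma reflect_diag (p : ℕ → ℕ → ℕ) (i k : ℕ) : reflect p i k (k + 1) i =
    max (p k i) (p (k + 2) (i + 1)) + (p (k + 2) i + cum p (k + 1) i - (cum p k i + 1))
      - p (k + 1) i := by
  simp [reflect]

lemma reflect_gt (p : ℕ → ℕ → ℕ) {i k i' : ℕ} (h : i < i') : reflect p i k (k + 1) i' =
    max (p k i') (p (k + 2) (i' + 1)) + min (p (k + 2) i') (p k (i' - 1)) - p (k + 1) i' := by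
  have h1 : ¬ i' < i := by omega
  have h2 : i' ≠ i := by omega
  simp [reflect, h1, h2]

lemma FirstFail.row_bounds {κ : ℕ → ℕ} (hκ : IsPt N κ) {p : ℕ → ℕ → ℕ} (hp : p ∈ Ch HStrip N κ)
    {i k : ℕ} (h : FirstFail p i k) :
    max (p k i) (p (k + 2) (i + 1)) ≤ p (k + 1) i ∧
    p (k + 1) i ≤ p (k + 2) i + cum p (k + 1) i - (cum p k i + 1) ∧
    p (k + 2) i + cum p (k + 1) i - (cum p k i + 1) ≤ p (k + 2) i ∧
    cum p k i + 1 ≤ p (k + 2) i + cum p (k + 1) i ∧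
    (0 < i → p (k + 2) i + cum p (k + 1) i - (cum p k i + 1) ≤ p k (i - 1)) := by
  have h1 := h.1
  have h0 := h.cum_le
  rw [cum_succ] at h1
  change _ < _ + (p (k + 2) i - p (k + 1) i) at h1
  have h2 := (Ch.hstrip hκ hp k i).2
  have h3 := Ch.hstrip hκ hp (k + 1) i
  change p (k + 2) (i + 1) ≤ _ ∧ _ ≤ p (k + 2) i at h3
  refine ⟨max_le h2 h3.1, by omega, by omega, by omega, fun hi => ?_⟩
  obtain ⟨i, rfl⟩ : ∃ i', i = i' + 1 := ⟨i - 1, by omega⟩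
  have h4 := h.2.1 i (by omega) k
  have h5 := Ch.hstrip hκ hp (k + 1) i
  change p (k + 2) (i + 1) ≤ _ ∧ _ ≤ p (k + 2) i at h5
  have h6 := Ch.hstrip hκ hp k i
  rw [cum_succ p k i] at *
  simp only [Nat.add_sub_cancel]
  omega

lemma strip_bounds {κ : ℕ → ℕ} (hκ : IsPt N κ) {p : ℕ → ℕ → ℕ} (hp : p ∈ Ch HStrip N κ)
    (k i : ℕ) : max (p k i) (p (k + 2) (i + 1)) ≤ p (k + 1) i ∧
    (0 < i → p (k + 1) i ≤ min (p (k + 2) i) (p k (i - 1))) := by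
  have h2 := (Ch.hstrip hκ hp k i).2
  have h3 := Ch.hstrip hκ hp (k + 1) i
  change p (k + 2) (i + 1) ≤ _ ∧ _ ≤ p (k + 2) i at h3
  refine ⟨max_le h2 h3.1, fun hi => ?_⟩
  obtain ⟨i, rfl⟩ : ∃ i', i = i' + 1 := ⟨i - 1, by omega⟩
  exact le_min h3.2 (Ch.hstrip hκ hp k i).1

lemma FirstFail.reflect_mem {κ : ℕ → ℕ} (hκ : IsPt N κ) {p : ℕ → ℕ → ℕ} (hp : p ∈ Ch HStrip N κ)
    {i k : ℕ} (h : FirstFail p i k) : reflect p i k ∈ Ch HStrip N κ := by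
  have hb := h.bounds hκ hp
  obtain ⟨r1, r2, r3, r4, r5⟩ := h.row_bounds hκ hp
  have hlo : ∀ x, max (p k x) (p (k + 2) (x + 1)) ≤ reflect p i k (k + 1) x := by
    intro x
    rcases lt_trichotomy x i with hx | rfl | hx
    · rw [reflect_lt p hx]; exact (strip_bounds hκ hp k x).1
    · rw [reflect_diag]; omega
    · rw [reflect_gt p hx]
      have := (strip_bounds hκ hp k x).2 (by omega); omega
  have hhi1 : ∀ x, reflect p i k (k + 1) x ≤ p (k + 2) x := by
    intro x
    rcases lt_trichotomy x i with hx | rfl | hx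
    · rw [reflect_lt p hx]; exact (Ch.hstrip hκ hp (k + 1) x).2
    · rw [reflect_diag]; omega
    · rw [reflect_gt p hx]
      have := (strip_bounds hκ hp k x); omega
  have hhi2 : ∀ x, reflect p i k (k + 1) (x + 1) ≤ p k x := by
    intro x
    rcases lt_trichotomy (x + 1) i with hx | hx | hx
    · rw [reflect_lt p hx]; exact (Ch.hstrip hκ hp k x).1
    · subst hx; rw [reflect_diag]
      have := r5 (by omega)
      simp only [Nat.add_sub_cancel] at this
      omega
    · rw [reflect_gt p hx]
      have := (strip_bounds hκ hp k (x + 1))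
      simp only [Nat.add_sub_cancel] at *
      omega
  refine ⟨fun j hj => ?_, fun j hj => ?_⟩
  · by_cases h1 : j = k
    · subst h1
      rw [reflect_ne p i j (j := j) (by omega)]
      exact fun x => ⟨hhi2 x, (le_max_left _ _).trans (hlo x)⟩
    by_cases h2 : j = k + 1
    · subst h2
      rw [reflect_ne p i k (j := k + 1 + 1) (by omega)]
      exact fun x => ⟨(le_max_right _ _).trans (hlo x), hhi1 x⟩
    rw [reflect_ne p i k h2, reflect_ne p i k (by omega)]
    exact hp.1 j hj
  · rw [reflect_ne p i k (by omega)]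
    exact hp.2 j hj

lemma FirstFail.reflect_firstFail {κ : ℕ → ℕ} (hκ : IsPt N κ) {p : ℕ → ℕ → ℕ}
    (hp : p ∈ Ch HStrip N κ) {i k : ℕ} (h : FirstFail p i k) :
    FirstFail (reflect p i k) i k := by
  obtain ⟨r1, r2, r3, r4, r5⟩ := h.row_bounds hκ hp
  refine ⟨?_, fun i' hi' k' => ?_, fun k' hk' => ?_⟩
  · rw [cum_succ, cum_reflect_of_le p le_rfl, cum_reflect_of_le p le_rfl, reflect_diag,
      reflect_ne p i k (j := k + 1 + 1) (by omega)]
    change _ < _ + (p (k + 2) i - _)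
    omega
  · rw [cum_reflect_of_le p (by omega), cum_reflect_of_le p (by omega)]
    exact h.2.1 i' hi' k'
  · rw [cum_reflect_of_le p le_rfl, cum_succ, cum_reflect_of_le p le_rfl,
      reflect_ne p i k (j := k' + 1) (by omega), reflect_ne p i k (j := k' + 1 + 1) (by omega),
      ← cum_succ]
    exact h.2.2 k' hk'

lemma FirstFail.reflect_reflect {κ : ℕ → ℕ} (hκ : IsPt N κ) {p : ℕ → ℕ → ℕ} (hp : p ∈ Ch HStrip N κ)
    {i k : ℕ} (h : FirstFail p i k) :
    reflect (reflect p i k) i k = p := by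
  obtain ⟨r1, r2, r3, r4, r5⟩ := h.row_bounds hκ hp
  funext j x
  by_cases hj : j = k + 1
  · subst hj
    rcases lt_trichotomy x i with hx | rfl | hx
    · rw [reflect_lt _ hx, reflect_lt _ hx]
    · rw [reflect_diag, cum_reflect_of_le p le_rfl, cum_reflect_of_le p le_rfl,
        reflect_ne p x k (j := k + 2) (by omega), reflect_ne p x k (j := k) (by omega),
        reflect_diag]
      omega
    · rw [reflect_gt _ hx, reflect_ne p i k (j := k + 2) (by omega),
        reflect_ne p i k (j := k) (by omega), reflect_gt _ hx]
      have := (strip_bounds hκ hp k x)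
      have := this.2 (by omega)
      omega
  · rw [reflect_ne _ _ _ hj, reflect_ne _ _ _ hj]

lemma FirstFail.sz_reflect {κ : ℕ → ℕ} (hκ : IsPt N κ) {p : ℕ → ℕ → ℕ} (hp : p ∈ Ch HStrip N κ)
    {i k : ℕ} (h : FirstFail p i k) :
    sz N (reflect p i k (k + 1)) + sz N (p (k + 1)) + 1 = sz N (p k) + sz N (p (k + 2)) := by
  obtain ⟨r1, r2, r3, r4, r5⟩ := h.row_bounds hκ hp
  have hb := h.bounds hκ hp
  have key : ∀ M, i + 1 ≤ M →
      ∑ x ∈ range M, reflect p i k (k + 1) x + ∑ x ∈ range M, p (k + 1) x + 1 +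
        min (p (k + 2) M) (p k (M - 1)) =
      ∑ x ∈ range M, p k x + ∑ x ∈ range M, p (k + 2) x + p (k + 2) M := by
    intro M hM
    induction M, hM using Nat.le_induction with
    | base =>
      have h1 := cum_add (Ch.hstrip hκ hp k) i
      have h2 := cum_add (Ch.hstrip hκ hp (k + 1)) i
      change _ = ∑ x ∈ range i, p (k + 2) x at h2
      have h3 : ∑ x ∈ range i, reflect p i k (k + 1) x = ∑ x ∈ range i, p (k + 1) x :=
        sum_congr rfl fun x hx => reflect_lt p (mem_range.1 hx)
      simp only [sum_range_succ, h3, reflect_diag, Nat.add_sub_cancel]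
      omega
    | succ M hM ih =>
      have := strip_bounds hκ hp k M
      have := this.2 (by omega)
      simp only [sum_range_succ, reflect_gt p (show i < M by omega), Nat.add_sub_cancel]
      omega
  have h1 := key N (by omega)
  have h2 := (Ch.isPt hκ hp (k + 2)).2 N le_rfl
  unfold sz
  omega

lemma FirstFail.dsign_reflect {κ : ℕ → ℕ} (hκ : IsPt N κ) {p : ℕ → ℕ → ℕ} (hp : p ∈ Ch HStrip N κ)
    {i k : ℕ} (h : FirstFail p i k) (ρ : ℕ → ℕ) :
    dsign N ρ (fun j => cum (reflect p i k) j N) = - dsign N ρ (fun j => cum p j N) := by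
  have hb := h.bounds hκ hp
  have hs := h.sz_reflect hκ hp
  have hm := h.reflect_mem hκ hp
  have c1 := cum_add (Ch.hstrip hκ hm k) N
  have c2 := cum_add (Ch.hstrip hκ hm (k + 1)) N
  have c3 := cum_add (Ch.hstrip hκ hp k) N
  have c4 := cum_add (Ch.hstrip hκ hp (k + 1)) N
  rw [reflect_ne p i k (j := k) (by omega)] at c1
  rw [reflect_ne p i k (j := k + 1 + 1) (by omega)] at c2
  change _ = ∑ x ∈ range N, p (k + 2) x at c2 c4
  unfold sz at hs
  refine dsign_dot_swap ρ _ _ k hb.2 (by omega) (by omega) fun j h1 h2 => ?_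
  simp only [cum]
  rw [reflect_ne p i k h2, reflect_ne p i k (by omega)]

lemma Good.antitone {p : ℕ → ℕ → ℕ} (h : Good p) (i j : ℕ) (hij : i ≤ j) :
    cum p j N ≤ cum p i N := by
  rcases Nat.eq_zero_or_pos N with rfl | hN
  · simp [cum_zero]
  · obtain ⟨M, rfl⟩ : ∃ M, N = M + 1 := ⟨N - 1, by omega⟩
    exact antitone_nat_of_succ_le (f := fun k => cum p k (M + 1))
      (fun k => (h M k).trans (cum_mono p k (Nat.le_succ M))) hij

lemma sum_eq_zero_of_reflect {A : MvPolynomial (Fin N) ℚ} {ρ : ℕ → ℕ} {κ : ℕ → ℕ}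
    (hκ : IsPt N κ) : ∑ p ∈ {p ∈ ((pieri_h N).finite_ch hκ N).toFinset | ¬ Good p},
      dsign N ρ (fun k => cum p k N) * cf A (dl N (p 0)) = 0 := by
  have key : ∀ p ∈ {p ∈ ((pieri_h N).finite_ch hκ N).toFinset | ¬ Good p},
      ∃ ik : ℕ × ℕ, FirstFail p ik.1 ik.2 := by
    intro p hp
    simp only [Set.Finite.mem_toFinset, mem_filter] at hp
    obtain ⟨i, k, h⟩ := exists_firstFail hp.1 hp.2
    exact ⟨(i, k), h⟩
  choose! ik hik using key
  have hmem : ∀ p ∈ {p ∈ ((pieri_h N).finite_ch hκ N).toFinset | ¬ Good p}, p ∈ Ch HStrip N κ := by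
    intro p hp
    simp only [Set.Finite.mem_toFinset, mem_filter] at hp
    exact hp.1
  have href : ∀ p ∈ {p ∈ ((pieri_h N).finite_ch hκ N).toFinset | ¬ Good p},
      reflect p (ik p).1 (ik p).2 ∈ {p ∈ ((pieri_h N).finite_ch hκ N).toFinset | ¬ Good p} := by
    intro p hp
    simp only [Set.Finite.mem_toFinset, mem_filter]
    exact ⟨(hik p hp).reflect_mem hκ (hmem p hp),
      ((hik p hp).reflect_firstFail hκ (hmem p hp)).not_good⟩
  have hneg : ∀ p ∈ {p ∈ ((pieri_h N).finite_ch hκ N).toFinset | ¬ Good p},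
      dsign N ρ (fun k => cum p k N) * cf A (dl N (p 0)) +
        dsign N ρ (fun k => cum (reflect p (ik p).1 (ik p).2) k N) *
          cf A (dl N (reflect p (ik p).1 (ik p).2 0)) = 0 := by
    intro p hp
    rw [(hik p hp).dsign_reflect hκ (hmem p hp), reflect_ne p _ _ (j := 0) (by omega)]
    ring
  refine sum_involution (fun p _ => reflect p (ik p).1 (ik p).2) hneg ?_ (fun p hp => href p hp) ?_
  · intro p hp hne heq
    have := hneg p hp
    rw [heq] at this
    exact hne (by linarith)
  · intro p hp
    have h1 := ((hik p hp).reflect_firstFail hκ (hmem p hp)).unique (hik _ (href p hp))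
    rw [← h1.1, ← h1.2]
    exact (hik p hp).reflect_reflect hκ (hmem p hp)

/-- The Littlewood–Richardson rule. -/
theorem cf_mul_sch_eq {A : MvPolynomial (Fin N) ℚ} (hA : IsAlt A) {ρ : ℕ → ℕ}
    (hρ : IsPt N ρ) {κ : ℕ → ℕ} (hκ : IsPt N κ) : cf (A * sch N ρ) (dl N κ) =
      ∑ᶠ p ∈ {p ∈ Ch HStrip N κ | Good p ∧ HasSteps N N ρ p}, cf A (dl N (p 0)) := by
  rw [cf_mul_sch hA ρ hκ, ← sum_filter_add_sum_filter_not _ Good, add_comm,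
    sum_eq_zero_of_reflect hκ, zero_add]
  · rw [finsum_mem_eq_finite_toFinset_sum _ (((pieri_h N).finite_ch hκ N).subset fun p hp => hp.1)]
    have : ∀ p ∈ {p ∈ ((pieri_h N).finite_ch hκ N).toFinset | Good p},
        dsign N ρ (fun k => cum p k N) * cf A (dl N (p 0)) =
          if HasSteps N N ρ p then cf A (dl N (p 0)) else 0 := by
      intro p hp
      simp only [Set.Finite.mem_toFinset, mem_filter] at hp
      rw [dsign_of_antitone _ _ hρ.1 hp.2.antitone, ite_mul, one_mul, zero_mul]
      exact if_congr (hasSteps_iff hκ hp.1 ρ).symm rfl rfl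
    rw [sum_congr rfl this, ← sum_filter]
    refine sum_congr ?_ fun _ _ => rfl
    ext p
    simp only [Set.Finite.mem_toFinset, Set.mem_ofPred_eq, mem_filter, and_assoc]

end

section
variable {N : ℕ}

/-- The chain of row truncations of `κ`. -/
def truncChain (κ : ℕ → ℕ) : ℕ → ℕ → ℕ := fun k i => if i < k then κ i else 0

lemma truncChain_mem {κ : ℕ → ℕ} (hκ : IsPt N κ) : truncChain κ ∈ Ch HStrip N κ := by
  refine ⟨fun k _ i => ?_, fun k hk => ?_⟩
  · have := hκ.1 i (i + 1) (Nat.le_succ i)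
    unfold truncChain
    constructor <;> split_ifs <;> omega
  · funext i
    unfold truncChain
    split_ifs with h
    · rfl
    · exact (hκ.2 i (by omega)).symm

lemma truncChain_zero (κ : ℕ → ℕ) : truncChain κ 0 = 0 := by
  funext i; simp [truncChain]

lemma cum_truncChain (κ : ℕ → ℕ) (k i : ℕ) :
    cum (truncChain κ) k i = if k < i then κ k else 0 := by
  have : ∀ x, truncChain κ (k + 1) x - truncChain κ k x = if x = k then κ k else 0 := by
    intro x
    unfold truncChain
    split_ifs with h1 h2 h3 h3 h4 <;> first | omega | (subst_vars; omega)
  unfold cum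
  simp only [this, sum_ite_eq', mem_range]

lemma truncChain_good {κ : ℕ → ℕ} (hκ : IsPt N κ) : Good (truncChain κ) := by
  intro i k
  rw [cum_truncChain, cum_truncChain]
  have := hκ.1 k (k + 1) (Nat.le_succ k)
  split_ifs <;> omega

lemma Ch.eq_zero_of_le {κ : ℕ → ℕ} (hκ : IsPt N κ) {p : ℕ → ℕ → ℕ} (hp : p ∈ Ch HStrip N κ)
    (h0 : p 0 = 0) {k i : ℕ} (hk : k ≤ i) : p k i = 0 := by
  induction k generalizing i with
  | zero => rw [h0]; rfl
  | succ k ih =>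
    obtain ⟨i, rfl⟩ : ∃ i', i = i' + 1 := ⟨i - 1, by omega⟩
    have h1 := ih (i := i) (by omega)
    have h2 := (Ch.hstrip hκ hp k i).1
    omega

lemma Ch.le {κ : ℕ → ℕ} (hκ : IsPt N κ) {p : ℕ → ℕ → ℕ} (hp : p ∈ Ch HStrip N κ) {k l : ℕ}
    (hkl : k ≤ l) (i : ℕ) : p k i ≤ p l i := by
  induction l, hkl using Nat.le_induction with
  | base => rfl
  | succ l _ ih => exact ih.trans (Ch.hstrip hκ hp l i).2

lemma Ch.le_top {κ : ℕ → ℕ} (hκ : IsPt N κ) {p : ℕ → ℕ → ℕ} (hp : p ∈ Ch HStrip N κ) (k i : ℕ) :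
    p k i ≤ κ i := by
  have := Ch.le hκ hp (le_max_left k N) i
  rwa [hp.2 _ (le_max_right k N)] at this

lemma eq_truncChain_of_good {κ : ℕ → ℕ} (hκ : IsPt N κ) {p : ℕ → ℕ → ℕ} (hp : p ∈ Ch HStrip N κ)
    (h0 : p 0 = 0) (hg : Good p) : p = truncChain κ := by
  have hcum : ∀ k i, i ≤ k → cum p k i = 0 := by
    intro k
    induction k with
    | zero => intro i hi; obtain rfl : i = 0 := by omega
              rfl
    | succ k ih =>
      intro i hi
      rcases Nat.eq_zero_or_pos i with rfl | hi0
      · rfl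
      · obtain ⟨i, rfl⟩ : ∃ i', i = i' + 1 := ⟨i - 1, by omega⟩
        have := hg i k
        rw [ih i (by omega)] at this
        omega
  have hstep : ∀ k i, i < k → p (k + 1) i = p k i := by
    intro k i hik
    have h1 := hcum k (i + 1) hik
    rw [cum_succ] at h1
    have h2 := (Ch.hstrip hκ hp k i).2
    omega
  have hconst : ∀ k i, i < k → ∀ l, k ≤ l → p l i = p k i := by
    intro k i hik l hl
    induction l, hl using Nat.le_induction with
    | base => rfl
    | succ l hl ih => rw [hstep l i (by omega), ih]
  funext k i
  unfold truncChain
  split_ifs with h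
  · rw [← hconst k i h (max k N) (le_max_left _ _), hp.2 _ (le_max_right _ _)]
  · exact Ch.eq_zero_of_le hκ hp h0 (by omega)

lemma hasSteps_truncChain_iff {κ μ : ℕ → ℕ} (hκ : IsPt N κ) (hμ : IsPt N μ) :
    HasSteps N N μ (truncChain κ) ↔ κ = μ := by
  rw [hasSteps_iff hκ (truncChain_mem hκ)]
  simp only [cum_truncChain]
  refine ⟨fun h => ?_, fun h k hk => by rw [if_pos hk, h]⟩
  funext k
  by_cases hk : k < N
  · have := h k hk; rwa [if_pos hk] at this
  · rw [hκ.2 k (by omega), hμ.2 k (by omega)]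

lemma cf_ad_mul_sch {κ μ : ℕ → ℕ} (hκ : IsPt N κ) (hμ : IsPt N μ) :
    cf (ad N * sch N μ) (dl N κ) = if κ = μ then 1 else 0 := by
  rw [cf_mul_sch_eq ad_isAlt hμ hκ,
    finsum_mem_congr rfl fun p hp => cf_ad (Ch.isPt hκ hp.1 0), finsum_mem_boole]
  · have : {p ∈ {p ∈ Ch HStrip N κ | Good p ∧ HasSteps N N μ p} | p 0 = 0} =
        if κ = μ then {truncChain κ} else ∅ := by
      ext p
      simp only [Set.mem_ofPred_eq]
      split_ifs with h
      · rw [Set.mem_singleton_iff]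
        refine ⟨fun hp => eq_truncChain_of_good hκ hp.1.1 hp.2 hp.1.2.1, ?_⟩
        rintro rfl
        exact ⟨⟨truncChain_mem hκ, truncChain_good hκ, (hasSteps_truncChain_iff hκ hμ).2 h⟩,
          truncChain_zero κ⟩
      · simp only [Set.mem_empty_iff_false, iff_false]
        rintro ⟨⟨h1, h2, h3⟩, h4⟩
        rw [eq_truncChain_of_good hκ h1 h4 h2, hasSteps_truncChain_iff hκ hμ] at h3
        exact h h3
    rw [this]
    split_ifs <;> simp
  · exact ((pieri_h N).finite_ch hκ N).subset fun p hp => hp.1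

lemma HasSteps.sz_eq {c : ℕ → ℕ} {p : ℕ → ℕ → ℕ} (h : HasSteps N N c p) (h0 : p 0 = 0) {k : ℕ}
    (hk : k ≤ N) : sz N (p k) = ∑ i ∈ range k, c i := by
  induction k with
  | zero => simp [h0, sz]
  | succ k ih => rw [h k hk, ih (by omega), sum_range_succ]

lemma Ch.sz_eq {κ : ℕ → ℕ} (hκ : IsPt N κ) {p : ℕ → ℕ → ℕ} (hp : p ∈ Ch HStrip N κ)
    (h0 : p 0 = 0) {k : ℕ} (hk : k ≤ N) : sz N (p k) = ∑ i ∈ range k, p k i := by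
  refine (sum_subset (range_subset_range.2 hk) fun i _ hi => ?_).symm
  exact Ch.eq_zero_of_le hκ hp h0 (by simpa using hi)

lemma finite_nch {R : (ℕ → ℕ) → (ℕ → ℕ) → Prop} {F : ℕ → MvPolynomial (Fin N) ℚ}
    (hP : Pieri N R F) {κ : ℕ → ℕ} (hκ : IsPt N κ) (c : ℕ → ℕ) :
    {p ∈ Ch R N κ | HasSteps N N c p ∧ p 0 = 0}.Finite :=
  (hP.finite_ch hκ N).subset fun _ hp => hp.1

lemma dominates_of_nch_ne_zero {κ c : ℕ → ℕ} (hκ : IsPt N κ) (h : nch N HStrip c κ ≠ 0) {k : ℕ}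
    (hk : k ≤ N) : ∑ i ∈ range k, c i ≤ ∑ i ∈ range k, κ i := by
  obtain ⟨p, hp, hs, h0⟩ := Set.nonempty_of_ncard_ne_zero h
  rw [← hs.sz_eq h0 hk, Ch.sz_eq hκ hp h0 hk]
  exact sum_le_sum fun i _ => Ch.le_top hκ hp k i

lemma nch_self {κ : ℕ → ℕ} (hκ : IsPt N κ) : nch N HStrip κ κ = 1 := by
  unfold nch
  rw [Set.ncard_eq_one]
  refine ⟨truncChain κ, Set.eq_singleton_iff_unique_mem.2
    ⟨⟨truncChain_mem hκ, (hasSteps_truncChain_iff hκ hκ).2 rfl, truncChain_zero κ⟩, ?_⟩⟩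
  rintro p ⟨hp, hs, h0⟩
  funext k i
  unfold truncChain
  split_ifs with h
  · rcases le_total N k with hk | hk
    · rw [hp.2 k hk]
    · have h1 := hs.sz_eq h0 hk
      rw [Ch.sz_eq hκ hp h0 hk] at h1
      exact (sum_eq_sum_iff_of_le fun i _ => Ch.le_top hκ hp k i).1 h1 i (mem_range.2 h)
  · exact Ch.eq_zero_of_le hκ hp h0 (by omega)

lemma exists_strip {t : ℕ} {κ μ : ℕ → ℕ} (hκ : IsPt (t + 1) κ) (hμ : ∀ i j, i ≤ j → μ j ≤ μ i)
    (hdom : ∀ k ≤ t + 1, ∑ i ∈ range k, μ i ≤ ∑ i ∈ range k, κ i)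
    (heq : ∑ i ∈ range (t + 1), μ i = ∑ i ∈ range (t + 1), κ i) :
    ∃ η, IsPt t η ∧ HStrip η κ ∧
      ∑ i ∈ range (t + 1), κ i = ∑ i ∈ range (t + 1), η i + μ t ∧
      ∀ k ≤ t, ∑ i ∈ range k, μ i ≤ ∑ i ∈ range k, η i := by
  have hlast : κ t ≤ μ t := by
    have := hdom t (by omega)
    rw [sum_range_succ, sum_range_succ] at heq
    omega
  have h0 : μ t ≤ κ 0 := by
    by_contra hlt
    have : ∑ i ∈ range (t + 1), κ i < ∑ i ∈ range (t + 1), μ i := by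
      refine sum_lt_sum_of_nonempty ⟨0, by simp⟩ fun i hi => ?_
      have := hκ.1 0 i (Nat.zero_le _)
      have := hμ i t (by simp at hi; omega)
      omega
    omega
  set s := Nat.findGreatest (fun s => μ t ≤ κ s) t with hs
  have hs1 : μ t ≤ κ s := Nat.findGreatest_spec (P := fun s => μ t ≤ κ s) (Nat.zero_le t) h0
  have hst : s ≤ t := Nat.findGreatest_le t
  have hs2 : κ (s + 1) ≤ μ t := by
    rcases hst.eq_or_lt with h | h
    · rw [h, hκ.2 (t + 1) le_rfl]; exact Nat.zero_le _
    · by_contra hlt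
      exact Nat.findGreatest_is_greatest (P := fun s => μ t ≤ κ s) (show s < s + 1 by omega) h
        (by omega)
  set η : ℕ → ℕ := fun i => if i < s then κ i else if i = s then κ s + κ (s + 1) - μ t
    else κ (i + 1)
    with hη
  have hstrip : HStrip η κ := by
    intro i
    have := hκ.1 i (i + 1) (Nat.le_succ i)
    simp only [hη]
    split_ifs with h1 h2
    · omega
    · subst h2; omega
    · omega
  have hsum1 : ∀ k ≤ s, ∑ i ∈ range k, η i = ∑ i ∈ range k, κ i := fun k hk =>
    sum_congr rfl fun i hi => if_pos (by simp at hi; omega)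
  have hsum2 : ∀ k, s + 1 ≤ k → ∑ i ∈ range k, η i + μ t = ∑ i ∈ range (k + 1), κ i := by
    intro k hk
    induction k, hk using Nat.le_induction with
    | base =>
      rw [sum_range_succ, hsum1 s le_rfl, sum_range_succ, sum_range_succ]
      have : η s = κ s + κ (s + 1) - μ t := by simp [hη]
      omega
    | succ k hk ih =>
      rw [sum_range_succ, sum_range_succ _ (k + 1), ← ih]
      have : η k = κ (k + 1) := by
        simp only [hη]; rw [if_neg (by omega), if_neg (by omega)]
      omega
  refine ⟨η, ⟨(hstrip.isPt hκ).1, fun i hi => ?_⟩, hstrip, ?_, fun k hk => ?_⟩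
  · simp only [hη]
    rcases hst.eq_or_lt with h | h
    · rw [if_neg (by omega)]
      split_ifs with h2
      · have := hκ.2 (s + 1) (by omega)
        rw [h] at this ⊢
        omega
      · exact hκ.2 _ (by omega)
    · rw [if_neg (by omega), if_neg (by omega)]
      exact hκ.2 _ (by omega)
  · rw [hsum2 (t + 1) (by omega), sum_range_succ _ (t + 1), hκ.2 (t + 1) le_rfl, add_zero]
  · rcases le_or_gt k s with h | h
    · rw [hsum1 k h]; exact hdom k (by omega)
    · have h1 := hsum2 k h
      have h2 := hdom (k + 1) (by omega)
      rw [sum_range_succ] at h2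
      have := hμ k t hk
      omega

lemma exists_chain (t : ℕ) (ht : t ≤ N) {κ μ : ℕ → ℕ} (hκ : IsPt t κ)
    (hμ : ∀ i j, i ≤ j → μ j ≤ μ i)
    (hdom : ∀ k ≤ t, ∑ i ∈ range k, μ i ≤ ∑ i ∈ range k, κ i)
    (heq : ∑ i ∈ range t, μ i = ∑ i ∈ range t, κ i) :
    ∃ p ∈ Ch HStrip t κ, HasSteps N t μ p ∧ p 0 = 0 := by
  induction t generalizing κ with
  | zero =>
    refine ⟨fun _ => 0, ⟨by simp, fun k _ => ?_⟩, by simp [HasSteps], rfl⟩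
    funext i
    exact (hκ.2 i (Nat.zero_le _)).symm
  | succ t ih =>
    obtain ⟨η, h1, h2, h3, h4⟩ := exists_strip hκ hμ hdom heq
    have h5 : ∑ i ∈ range (t + 1), η i = ∑ i ∈ range t, η i := by
      rw [sum_range_succ, h1.2 t le_rfl, add_zero]
    obtain ⟨p, hp, hs, h0⟩ := ih (by omega) h1 h4 (by rw [sum_range_succ] at heq; omega)
    have hsz : ∀ ξ : ℕ → ℕ, (∀ i, t + 1 ≤ i → ξ i = 0) → sz N ξ = ∑ i ∈ range (t + 1), ξ i :=
      fun ξ hξ => (sum_subset (range_subset_range.2 ht) fun i _ hi =>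
        hξ i (by simpa using hi)).symm
    have hbij := (chainExtend_bijOn (N := N) (R := HStrip) μ t κ).mapsTo (x := p) (by
      simp only [Set.mem_iUnion]
      refine ⟨η, ⟨h2, ?_⟩, hp, hs⟩
      rw [hsz κ hκ.2, hsz η fun i hi => h1.2 i (by omega), h3])
    exact ⟨_, hbij.1, hbij.2, by simpa [chainExtend] using h0⟩

lemma nch_pos {κ μ : ℕ → ℕ} (hκ : IsPt N κ) (hμ : IsPt N μ) (hdom : Dominates κ μ)
    (heq : sz N μ = sz N κ) : 0 < nch N HStrip μ κ := by
  obtain ⟨p, hp, hs, h0⟩ := exists_chain N le_rfl hκ hμ.1 (fun k _ => hdom k) heq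
  unfold nch
  rw [Set.ncard_pos (finite_nch (pieri_h N) hκ μ)]
  exact ⟨p, hp, hs, h0⟩

end

section
variable {N : ℕ}

lemma lt_conjFun {a : ℕ → ℕ} (ha : IsPt N a) (i j : ℕ) : i < conjFun N a j ↔ j < a i := by
  unfold conjFun
  constructor
  · intro h
    by_contra hle
    have : (range N).filter (fun x => j < a x) ⊆ range i := by
      intro x hx
      rw [mem_filter] at hx
      rw [mem_range]
      by_contra hxi
      have := ha.1 i x (by omega)
      omega
    have := card_le_card this
    rw [card_range] at this
    omega
  · intro h
    have : range (i + 1) ⊆ (range N).filter (fun x => j < a x) := by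
      intro x hx
      rw [mem_range] at hx
      have := ha.1 x i (by omega)
      rw [mem_filter, mem_range]
      refine ⟨?_, by omega⟩
      by_contra hN
      have := ha.2 i (by omega)
      omega
    have := card_le_card this
    rw [card_range] at this
    omega

/-- Partitions in an `N × N` box. -/
def IsBx (N : ℕ) (a : ℕ → ℕ) : Prop := IsPt N a ∧ ∀ i, a i ≤ N

lemma conj_isBx {a : ℕ → ℕ} (ha : IsBx N a) : IsBx N (conjFun N a) := by
  refine ⟨⟨fun i j hij => ?_, fun i hi => ?_⟩, fun i => ?_⟩
  · by_contra hlt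
    have h1 := (lt_conjFun ha.1 (conjFun N a i) j).1 (by omega)
    have h2 := (lt_conjFun ha.1 (conjFun N a i) i).2 (by omega)
    omega
  · by_contra hne
    have h1 := (lt_conjFun ha.1 0 i).1 (by omega)
    have := ha.2 0
    omega
  · exact (card_filter_le _ _).trans (by rw [card_range])

lemma conj_conj {a : ℕ → ℕ} (ha : IsBx N a) : conjFun N (conjFun N a) = a := by
  funext i
  have h : ∀ j, j < conjFun N (conjFun N a) i ↔ j < a i := fun j => by
    rw [lt_conjFun (conj_isBx ha).1, lt_conjFun ha.1]
  exact le_antisymm (le_of_not_gt fun h1 => by have := (h _).1 h1; omega)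
    (le_of_not_gt fun h1 => by have := (h _).2 h1; omega)

lemma conj_le_iff {a b : ℕ → ℕ} (ha : IsPt N a) (hb : IsPt N b) :
    (∀ j, conjFun N a j ≤ conjFun N b j) ↔ ∀ i, a i ≤ b i := by
  constructor
  · intro h i
    by_contra hlt
    have h1 := (lt_conjFun ha i (b i)).2 (by omega)
    have h2 := (lt_conjFun hb i (b i)).1 (h1.trans_le (h _))
    omega
  · exact fun h j => card_le_card fun x hx => by

      rw [mem_filter] at hx ⊢
      exact ⟨hx.1, hx.2.trans_le (h x)⟩

lemma sum_conj_eq_sum_min (a : ℕ → ℕ) (j : ℕ) :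
    ∑ k ∈ range j, conjFun N a k = ∑ i ∈ range N, min (a i) j := by
  unfold conjFun
  simp only [card_filter]
  rw [sum_comm]
  refine sum_congr rfl fun i _ => ?_
  rw [← card_filter, ← card_range (min (a i) j)]
  congr 1
  ext k
  simp only [mem_filter, mem_range]
  omega

lemma sz_conj {a : ℕ → ℕ} (ha : IsBx N a) : sz N (conjFun N a) = sz N a := by
  unfold sz
  rw [sum_conj_eq_sum_min]
  exact sum_congr rfl fun i _ => min_eq_left (ha.2 i)

lemma hstrip_iff_vstrip {μ κ : ℕ → ℕ} (hμ : IsBx N μ) (hκ : IsBx N κ) :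
    HStrip μ κ ↔ VStrip (conjFun N μ) (conjFun N κ) := by
  constructor
  · intro h
    refine ⟨(conj_isBx hμ).1.1, fun j => ⟨(conj_le_iff hμ.1 hκ.1).2 (fun i => (h i).2) j, ?_⟩⟩
    by_contra hlt
    have h1 := (lt_conjFun hκ.1 (conjFun N μ j + 1) j).1 (by omega)
    have h2 := (lt_conjFun hμ.1 (conjFun N μ j) j).2 (h1.trans_le (h _).1)
    omega
  · intro h i
    refine ⟨?_, (conj_le_iff hμ.1 hκ.1).1 (fun j => (h.2 j).1) i⟩
    by_contra hlt
    have h1 := (lt_conjFun hκ.1 (i + 1) (μ i)).2 (by omega)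
    have h2 := (h.2 (μ i)).2
    have h3 := (lt_conjFun hμ.1 i (μ i)).1 (by omega)
    omega

lemma Ch.le_of_vstrip {κ : ℕ → ℕ} {p : ℕ → ℕ → ℕ} (hp : p ∈ Ch VStrip N κ) (k i : ℕ) :
    p k i ≤ κ i := by
  rcases le_total N k with h | h
  · rw [hp.2 k h]
  · induction h using Nat.decreasingInduction with
    | self => rw [hp.2 N le_rfl]
    | of_succ k hk ih => exact ((hp.1 k hk).2 i).1.trans ih

lemma conj_zero : conjFun N 0 = 0 := by
  funext j; simp [conjFun]

lemma nch_vstrip {κ : ℕ → ℕ} (hκ : IsBx N κ) (c : ℕ → ℕ) :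
    nch N VStrip c κ = nch N HStrip c (conjFun N κ) := by
  have hκ' := conj_isBx hκ
  have hbV : ∀ p ∈ Ch VStrip N κ, ∀ k, IsBx N (p k) := fun p hp k =>
    ⟨(pieri_e N).ch_isPt hκ.1 hp k, fun i => (Ch.le_of_vstrip hp k i).trans (hκ.2 i)⟩
  have hbH : ∀ p ∈ Ch HStrip N (conjFun N κ), ∀ k, IsBx N (p k) := fun p hp k =>
    ⟨Ch.isPt hκ'.1 hp k, fun i => (Ch.le_top hκ'.1 hp k i).trans (hκ'.2 i)⟩
  unfold nch
  refine Set.ncard_congr (fun p _ k => conjFun N (p k)) ?_ ?_ ?_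
  · rintro p ⟨hp, hs, h0⟩
    refine ⟨⟨fun k hk => ?_, fun k hk => congrArg _ (hp.2 k hk)⟩, fun k hk => ?_, ?_⟩
    · rw [hstrip_iff_vstrip (conj_isBx (hbV p hp k)) (conj_isBx (hbV p hp (k + 1))),
        conj_conj (hbV p hp k), conj_conj (hbV p hp (k + 1))]
      exact hp.1 k hk
    · rw [sz_conj (hbV p hp _), sz_conj (hbV p hp _)]; exact hs k hk
    · exact (congrArg _ h0).trans conj_zero
  · rintro p q ⟨hp, -⟩ ⟨hq, -⟩ h
    funext k
    rw [← conj_conj (hbV p hp k), ← conj_conj (hbV q hq k)]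
    exact congrArg _ (congrFun h k)
  · rintro p ⟨hp, hs, h0⟩
    refine ⟨fun k => conjFun N (p k), ⟨⟨fun k hk => ?_, fun k hk => ?_⟩, fun k hk => ?_, ?_⟩, ?_⟩
    · rw [← hstrip_iff_vstrip (hbH p hp _) (hbH p hp _)]; exact hp.1 k hk
    · exact (congrArg _ (hp.2 k hk)).trans (conj_conj hκ)
    · rw [sz_conj (hbH p hp _), sz_conj (hbH p hp _)]; exact hs k hk
    · exact (congrArg _ h0).trans conj_zero
    · funext k
      exact conj_conj (hbH p hp k)

lemma sum_sub_conj {a : ℕ → ℕ} (ha : IsBx N a) (j : ℕ) :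
    ∑ i ∈ range N, (a i - j) = ∑ i ∈ range (conjFun N a j), (a i - j) := by
  refine (sum_subset (range_subset_range.2 ((conj_isBx ha).2 j)) fun i _ hi => ?_).symm
  rw [mem_range, lt_conjFun ha.1] at hi
  omega

lemma dominates_conj {a b : ℕ → ℕ} (hb : IsBx N b) (hs : sz N a = sz N b)
    (h : Dominates a b) : Dominates (conjFun N b) (conjFun N a) := by
  intro j
  rw [sum_conj_eq_sum_min, sum_conj_eq_sum_min]
  have key : ∑ i ∈ range N, (b i - j) ≤ ∑ i ∈ range N, (a i - j) := by
    rw [sum_sub_conj hb]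
    set m := conjFun N b j
    have h1 : ∑ i ∈ range m, (b i - j) + m * j = ∑ i ∈ range m, b i := by
      rw [← smul_eq_mul, ← card_range m, ← sum_const, card_range, ← sum_add_distrib]
      refine sum_congr rfl fun i hi => ?_
      have := (lt_conjFun hb.1 i j).1 (mem_range.1 hi)
      omega
    have h2 : ∑ i ∈ range m, a i ≤ ∑ i ∈ range m, (a i - j) + m * j := by
      rw [← smul_eq_mul, ← card_range m, ← sum_const, card_range, ← sum_add_distrib]
      exact sum_le_sum fun i _ => by omega
    have h3 : ∑ i ∈ range m, (a i - j) ≤ ∑ i ∈ range N, (a i - j) :=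
      sum_le_sum_of_subset (range_subset_range.2 ((conj_isBx hb).2 j))
    have := h m
    omega
  have hsplit : ∀ x : ℕ → ℕ, ∑ i ∈ range N, min (x i) j + ∑ i ∈ range N, (x i - j) = sz N x := by
    intro x
    rw [← sum_add_distrib]
    exact sum_congr rfl fun i _ => by omega
  have h1 := hsplit a
  have h2 := hsplit b
  omega

end

section
lemma cs_prod {ι κ R : Type*} [Fintype ι] [Fintype κ] [DecidableEq κ] [CommRing R]
    (S : Set ℕ) (x : ι → R)
    (y : κ → R) (m : ℕ) :
    cs S (fun p : ι × κ => x p.1 * y p.2) m =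
      ∑ v ∈ piAntidiag (univ : Finset κ) m, (∏ j, cs S x (v j)) * ∏ j, y j ^ v j := by
  simp only [cs]
  simp_rw [prod_univ_sum, sum_mul]
  rw [sum_sigma']
  refine sum_nbij' (fun M => ⟨fun j => ∑ i, M (i, j), fun j i => M (i, j)⟩)
    (fun q p => q.2 p.2 p.1) ?_ ?_ ?_ ?_ ?_
  · intro M hM
    simp only [mem_filter, mem_piAntidiag, mem_sigma, Fintype.mem_piFinset] at hM ⊢
    refine ⟨⟨?_, by simp⟩, fun j => ⟨by simp, fun i => hM.2 _⟩⟩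
    rw [← hM.1.1, Fintype.sum_prod_type_right]
  · rintro ⟨v, M⟩ hM
    simp only [mem_filter, mem_piAntidiag, mem_sigma, Fintype.mem_piFinset] at hM ⊢
    refine ⟨⟨?_, by simp⟩, fun p => (hM.2 _).2 _⟩
    rw [← hM.1.1, Fintype.sum_prod_type_right]
    exact sum_congr rfl fun j _ => (hM.2 j).1.1
  · intro M _; rfl
  · rintro ⟨v, M⟩ hM
    simp only [mem_filter, mem_piAntidiag, mem_sigma, Fintype.mem_piFinset] at hM
    have : (fun j => ∑ i, M j i) = v := funext fun j => (hM.2 j).1.1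
    subst this
    rfl
  · intro M _
    simp only
    simp_rw [mul_pow]
    rw [prod_mul_distrib, Fintype.prod_prod_type_right, Fintype.prod_prod_type_right]
    congr 1
    exact prod_congr rfl fun j _ => prod_pow_eq_pow_sum univ (fun i => M (i, j)) (y j)

lemma cs_comp_equiv {Y Y' R : Type*} [Fintype Y] [Fintype Y'] [CommRing R] (S : Set ℕ)
    (e : Y ≃ Y') (w : Y' → R) (r : ℕ) : cs S (w ∘ e) r = cs S w r := by
  unfold cs
  refine sum_nbij' (fun m => m ∘ e.symm) (fun m => m ∘ e) ?_ ?_ ?_ ?_ ?_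
  · intro m hm
    simp only [mem_filter, mem_piAntidiag] at hm ⊢
    refine ⟨⟨?_, by simp⟩, fun y => hm.2 _⟩
    rw [← hm.1.1]; exact Equiv.sum_comp e.symm m
  · intro m hm
    simp only [mem_filter, mem_piAntidiag] at hm ⊢
    refine ⟨⟨?_, by simp⟩, fun y => hm.2 _⟩
    rw [← hm.1.1]; exact Equiv.sum_comp e m
  · intro m _; funext i; simp
  · intro m _; funext i; simp
  · intro m _
    rw [← Equiv.prod_comp e]
    simp

lemma map_cs {Y R R' G : Type*} [Fintype Y] [CommRing R] [CommRing R'] [FunLike G R R']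
    [RingHomClass G R R'] (f : G) (S : Set ℕ) (w : Y → R) (r : ℕ) :
    f (cs S w r) = cs S (fun y => f (w y)) r := by
  simp [cs, map_sum, map_prod, map_pow]

variable {N : ℕ}

open scoped TensorProduct

/-- The product of two linear functionals, on the tensor product. -/
noncomputable def tf (L L' : MvPolynomial (Fin N) ℚ →ₗ[ℚ] ℚ) :
    MvPolynomial (Fin N) ℚ ⊗[ℚ] MvPolynomial (Fin N) ℚ →ₗ[ℚ] ℚ :=
  LinearMap.mul' ℚ ℚ ∘ₗ TensorProduct.map L L'

@[simp] lemma tf_tmul (L L' : MvPolynomial (Fin N) ℚ →ₗ[ℚ] ℚ) (a b : MvPolynomial (Fin N) ℚ) :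
    tf L L' (a ⊗ₜ b) = L a * L' b := by simp [tf]

/-- The product alphabet. -/
noncomputable def tX (p : Fin N × Fin N) : MvPolynomial (Fin N) ℚ ⊗[ℚ] MvPolynomial (Fin N) ℚ :=
  MvPolynomial.X p.1 ⊗ₜ MvPolynomial.X p.2

/-- The inclusion of the first alphabet. -/
noncomputable def iL : MvPolynomial (Fin N) ℚ →ₐ[ℚ]
    MvPolynomial (Fin N) ℚ ⊗[ℚ] MvPolynomial (Fin N) ℚ := Algebra.TensorProduct.includeLeft

/-- The inclusion of the second alphabet. -/
noncomputable def iR : MvPolynomial (Fin N) ℚ →ₐ[ℚ]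
    MvPolynomial (Fin N) ℚ ⊗[ℚ] MvPolynomial (Fin N) ℚ := Algebra.TensorProduct.includeRight

lemma iL_mul_iR (a b : MvPolynomial (Fin N) ℚ) : iL a * iR b = a ⊗ₜ b := by simp [iL, iR]

lemma cs_tX (S : Set ℕ) (m : ℕ) :
    cs S (tX (N := N)) m = ∑ v ∈ piAntidiag (univ : Finset (Fin N)) m,
      (∏ j, cs S MvPolynomial.X (v j)) ⊗ₜ
        MvPolynomial.monomial (Finsupp.equivFunOnFinite.symm v) 1 := by
  have h : (tX (N := N)) = fun p : Fin N × Fin N =>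
      iL (MvPolynomial.X p.1) * iR (MvPolynomial.X p.2) := by
    funext p
    simp [tX, iL, iR]
  rw [h, cs_prod S (fun i => iL (MvPolynomial.X i)) (fun i => iR (MvPolynomial.X i))]
  refine sum_congr rfl fun v _ => ?_
  simp only [← map_cs, ← map_prod, ← map_pow, prod_X_pow]
  rw [iL_mul_iR]

lemma cs_tX' (S : Set ℕ) (m : ℕ) :
    cs S (tX (N := N)) m = ∑ v ∈ piAntidiag (univ : Finset (Fin N)) m,
      MvPolynomial.monomial (Finsupp.equivFunOnFinite.symm v) 1 ⊗ₜ
        (∏ j, cs S MvPolynomial.X (v j)) := by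
  rw [← cs_comp_equiv S (Equiv.prodComm _ _)]
  have h : tX (N := N) ∘ Equiv.prodComm _ _ = fun p : Fin N × Fin N =>
      iR (MvPolynomial.X p.1) * iL (MvPolynomial.X p.2) := by
    funext p
    simp [tX, iL, iR]
  rw [h, cs_prod S (fun i => iR (MvPolynomial.X i)) (fun i => iL (MvPolynomial.X i))]
  refine sum_congr rfl fun v _ => ?_
  simp only [← map_cs, ← map_prod, ← map_pow, prod_X_pow]
  rw [mul_comm, iL_mul_iR]

/-- Coefficient extraction as a linear map. -/
noncomputable def cfL (v : Fin N → ℕ) : MvPolynomial (Fin N) ℚ →ₗ[ℚ] ℚ where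
  toFun A := cf A v
  map_add' A B := cf_add A B v
  map_smul' c A := cf_smul c A v

@[simp] lemma cfL_apply (v : Fin N → ℕ) (A : MvPolynomial (Fin N) ℚ) : cfL v A = cf A v := rfl

lemma cf_monomial (v w : Fin N → ℕ) :
    cf (MvPolynomial.monomial (Finsupp.equivFunOnFinite.symm v) 1) w = if v = w then 1 else 0 := by
  unfold cf
  rw [MvPolynomial.coeff_monomial]
  simp

/-- Matrices with prescribed row and column sums are counted symmetrically. -/
lemma cf_prod_cs_comm (S : Set ℕ) (c v : Fin N → ℕ) :
    cf (∏ j, cs S MvPolynomial.X (c j)) v = cf (∏ j, cs S MvPolynomial.X (v j)) c := by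
  have key : ∀ m, (if ∑ j, c j = m then cf (∏ j, cs S MvPolynomial.X (c j)) v else 0) =
      if ∑ j, v j = m then cf (∏ j, cs S MvPolynomial.X (v j)) c else 0 := by
    intro m
    have h1 := congrArg (tf (cfL v) (cfL c)) (cs_tX (N := N) S m)
    rw [cs_tX'] at h1
    simp only [map_sum, tf_tmul, cfL_apply, cf_monomial, mul_ite, ite_mul, one_mul, zero_mul,
      mul_one, mul_zero, sum_ite_eq', mem_piAntidiag, mem_univ, implies_true, and_true] at h1
    exact h1.symm
  have h1 := key (∑ j, c j)
  have h2 := key (∑ j, v j)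
  rw [if_pos rfl] at h1 h2
  by_cases h : ∑ j, c j = ∑ j, v j
  · rw [if_pos h] at h2; exact h2
  · rw [if_neg h] at h2; rw [if_neg (Ne.symm h)] at h1; rw [h1, ← h2]

lemma sch_eq_row (ρ : ℕ → ℕ) : sch N ρ = ∑ σ : Perm (Fin N), ((Perm.sign σ : ℤ) : ℚ) •
    if ∀ i : Fin N, (i : ℕ) ≤ ρ i + σ i then ∏ i : Fin N, cs Set.univ MvPolynomial.X (ρ i + σ i - i)
      else 0 := by
  unfold sch
  rw [← Equiv.sum_comp (Equiv.inv (Perm (Fin N)))]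
  refine sum_congr rfl fun σ _ => ?_
  rw [Equiv.inv_apply, Perm.sign_inv]
  congr 1
  rw [← Equiv.prod_comp σ]
  simp only [Perm.inv_def, symm_apply_apply]
  split_ifs with h
  · exact prod_congr rfl fun i _ => if_pos (h i)
  · push Not at h
    obtain ⟨i, hi⟩ := h
    exact prod_eq_zero (mem_univ i) (if_neg (by omega))

lemma cf_sch {ρ : ℕ → ℕ} (hρ : IsPt N ρ) (v : ℕ → ℕ) :
    cf (sch N ρ) (fun i => v i) = nch N HStrip v ρ := by
  rw [← (pieri_h N).cf_ad_mul_prod v hρ, cf_ad_mul, sch_eq_row, cf_sum]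
  refine sum_congr rfl fun σ _ => ?_
  rw [cf_smul]
  congr 1
  have hi : ∀ i : Fin N, (N - 1 - (σ i : ℕ) ≤ dl N ρ i ↔ (i : ℕ) ≤ ρ i + σ i) ∧
      dl N ρ i - (N - 1 - (σ i : ℕ)) = ρ i + σ i - i := by
    intro i
    have := (σ i).2
    have := i.2
    simp only [dl]
    omega
  simp only [fun i => (hi i).1, fun i => (hi i).2]
  split_ifs
  · rw [cf_prod_cs_comm, ← Fin.prod_univ_eq_prod_range (fun k => cs Set.univ MvPolynomial.X (v k))]
  · rfl

lemma extc_apply (v : Fin N → ℕ) (i : Fin N) : extc v i = v i := by simp [extc]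

lemma cf_sch_fin {ρ : ℕ → ℕ} (hρ : IsPt N ρ) (v : Fin N → ℕ) :
    cf (sch N ρ) v = nch N HStrip (extc v) ρ := by
  rw [← cf_sch hρ]
  congr 1
  funext i
  rw [extc_apply]

lemma IsAlt.eq_of_cf_dl {A B : MvPolynomial (Fin N) ℚ} (hA : IsAlt A) (hB : IsAlt B)
    (h : ∀ κ, IsPt N κ → cf A (dl N κ) = cf B (dl N κ)) : A = B := by
  refine cf_ext fun v => ?_
  by_cases hv : Function.Injective v
  · let σ : Perm (Fin N) := Fin.revPerm.trans (Tuple.sort v)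
    have hmono : StrictMono (v ∘ Tuple.sort v) :=
      (Tuple.monotone_sort v).strictMono_of_injective (hv.comp (Tuple.sort v).injective)
    have hanti : ∀ i j : Fin N, (i : ℕ) + 1 = j → (v ∘ σ) j < (v ∘ σ) i := by
      intro i j hij
      refine hmono (Fin.rev_lt_rev.2 ?_)
      rw [Fin.lt_def]; omega
    have h1 := h _ (isPt_undl hanti)
    rw [dl_undl _ (le_of_strictAnti hanti), hA.cf_comp, hB.cf_comp] at h1
    have h2 := sign_cast_mul_self σ
    calc cf A v = ((Perm.sign σ : ℤ) : ℚ) * (((Perm.sign σ : ℤ) : ℚ) * cf A v) := by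
          rw [← mul_assoc, h2, one_mul]
      _ = cf B v := by rw [h1, ← mul_assoc, h2, one_mul]
  · rw [Function.Injective] at hv
    push Not at hv
    obtain ⟨i, j, hij, hne⟩ := hv
    rw [hA.cf_eq_zero hne v hij, hB.cf_eq_zero hne v hij]

lemma ad_ne_zero : ad N ≠ 0 := by
  intro h
  have h1 := cf_ad (N := N) (μ := 0) ⟨fun _ _ _ => le_rfl, fun _ _ => rfl⟩
  rw [h, if_pos rfl] at h1
  simp [cf] at h1

lemma finite_parts (N m : ℕ) : {κ : ℕ → ℕ | IsPt N κ ∧ sz N κ = m}.Finite := by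
  refine (finite_le N (fun i => if i < N then m else 0) fun i hi => if_neg (by omega)).subset ?_
  rintro κ ⟨h1, h2⟩ i
  split_ifs with h
  · exact h2 ▸ single_le_sum (f := κ) (fun _ _ => Nat.zero_le _) (mem_range.2 h)
  · exact (h1.2 i (by omega)).le

/-- The partitions of `m` with at most `N` parts. -/
noncomputable def parts (N m : ℕ) : Finset (ℕ → ℕ) := (finite_parts N m).toFinset

lemma mem_parts {m : ℕ} {κ : ℕ → ℕ} : κ ∈ parts N m ↔ IsPt N κ ∧ sz N κ = m := by simp [parts]

lemma isBx_of_mem_parts {m : ℕ} (hm : m ≤ N) {κ : ℕ → ℕ} (hκ : κ ∈ parts N m) : IsBx N κ := by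
  rw [mem_parts] at hκ
  refine ⟨hκ.1, fun i => ?_⟩
  by_cases h : i < N
  · exact (single_le_sum (f := κ) (fun _ _ => Nat.zero_le _) (mem_range.2 h)).trans
      (hκ.2.le.trans hm)
  · rw [hκ.1.2 i (by omega)]; exact Nat.zero_le _

lemma conj_mem_parts {m : ℕ} (hm : m ≤ N) {κ : ℕ → ℕ} (hκ : κ ∈ parts N m) :
    conjFun N κ ∈ parts N m := by
  have h := isBx_of_mem_parts hm hκ
  exact mem_parts.2 ⟨(conj_isBx h).1, (sz_conj h).trans (mem_parts.1 hκ).2⟩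

/-- The Schur expansion of a symmetric polynomial whose antisymmetrization is supported in
size `m`. -/
lemma eq_sum_sch {F : MvPolynomial (Fin N) ℚ} (hF : F.IsSymmetric) (m : ℕ)
    (h : ∀ κ, IsPt N κ → sz N κ ≠ m → cf (ad N * F) (dl N κ) = 0) :
    F = ∑ κ ∈ parts N m, cf (ad N * F) (dl N κ) • sch N κ := by
  refine mul_left_cancel₀ (ad_ne_zero (N := N)) ?_
  refine (ad_isAlt.mul hF).eq_of_cf_dl (ad_isAlt.mul (isSymmetric_sum _ _ fun κ =>
    MvPolynomial.IsSymmetric.smul _ (sch_isSymmetric κ))) fun κ hκ => ?_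
  simp only [mul_sum, cf_sum, mul_smul_comm, cf_smul]
  rw [sum_congr rfl fun μ hμ => by rw [cf_ad_mul_sch hκ (mem_parts.1 hμ).1]]
  simp only [mul_ite, mul_one, mul_zero, sum_ite_eq, mem_parts, hκ, true_and]
  split_ifs with h1
  · rfl
  · exact h κ hκ h1

lemma nch_eq_zero_of_sz {R : (ℕ → ℕ) → (ℕ → ℕ) → Prop} {c κ : ℕ → ℕ} (h : sz N κ ≠ sz N c) :
    nch N R c κ = 0 := by
  unfold nch
  refine (congrArg Set.ncard ?_).trans (Set.ncard_empty _)
  refine Set.eq_empty_of_forall_notMem ?_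
  rintro p ⟨hp, hs, h0⟩
  apply h
  have : ∀ k ≤ N, sz N (p k) = ∑ i ∈ range k, c i := by
    intro k hk
    induction k with
    | zero => simp [h0, sz]
    | succ k ih => rw [hs k (by omega), ih (by omega), sum_range_succ]
  rw [← hp.2 N le_rfl, this N le_rfl, sz]

lemma sz_extc (v : Fin N → ℕ) : sz N (extc v) = ∑ i, v i := by
  rw [sz, ← Fin.sum_univ_eq_sum_range]
  exact sum_congr rfl fun i _ => extc_apply v i

lemma prod_cs_eq_sum_sch (S : Set ℕ) {R : (ℕ → ℕ) → (ℕ → ℕ) → Prop}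
    (hP : Pieri N R (cs S MvPolynomial.X)) (v : Fin N → ℕ) :
    ∏ j, cs S MvPolynomial.X (v j) =
      ∑ κ ∈ parts N (∑ i, v i), (nch N R (extc v) κ : ℚ) • sch N κ := by
  have h : ∀ κ, IsPt N κ → cf (ad N * ∏ j, cs S MvPolynomial.X (v j)) (dl N κ) =
      nch N R (extc v) κ := by
    intro κ hκ
    rw [← hP.cf_ad_mul_prod _ hκ, ← Fin.prod_univ_eq_prod_range
      (fun k => cs S MvPolynomial.X (extc v k))]
    simp only [extc_apply]
  rw [eq_sum_sch (isSymmetric_prod univ _ fun j => hP.symm (v j)) (∑ i, v i)]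
  · exact sum_congr rfl fun κ hκ => by rw [h κ (mem_parts.1 hκ).1]
  · intro κ hκ hs
    rw [h κ hκ, nch_eq_zero_of_sz (by rwa [sz_extc]), Nat.cast_zero]

lemma sch_eq_sum {ρ : ℕ → ℕ} {m : ℕ} (hρ : ρ ∈ parts N m) :
    sch N ρ = ∑ v ∈ piAntidiag (univ : Finset (Fin N)) m,
      (nch N HStrip (extc v) ρ : ℚ) •
        MvPolynomial.monomial (Finsupp.equivFunOnFinite.symm v) 1 := by
  rw [mem_parts] at hρ
  refine cf_ext fun v => ?_
  simp only [cf_sum, cf_smul, cf_monomial, mul_ite, mul_one, mul_zero, sum_ite_eq', mem_piAntidiag,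
    mem_univ, implies_true, and_true]
  rw [cf_sch_fin hρ.1]
  split_ifs with h
  · rfl
  · rw [nch_eq_zero_of_sz (by rw [sz_extc, hρ.2]; exact Ne.symm h), Nat.cast_zero]

/-- The dual Cauchy identity. -/
lemma dual_cauchy {m : ℕ} (hm : m ≤ N) :
    cs {0, 1} (tX (N := N)) m = ∑ κ ∈ parts N m, sch N κ ⊗ₜ sch N (conjFun N κ) := by
  rw [cs_tX]
  rw [sum_congr rfl fun v hv => by
    rw [prod_cs_eq_sum_sch {0, 1} (pieri_e N) v, (mem_piAntidiag.1 hv).1]]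
  simp only [TensorProduct.sum_tmul]
  rw [sum_comm]
  refine sum_congr rfl fun κ hκ => ?_
  rw [sch_eq_sum (conj_mem_parts hm hκ), TensorProduct.tmul_sum]
  refine sum_congr rfl fun v _ => ?_
  rw [nch_vstrip (isBx_of_mem_parts hm hκ), TensorProduct.smul_tmul]

end

section
variable {N : ℕ}

lemma natCard_cells {Q : ℕ × ℕ → Prop} (M : ℕ) (s : ℕ → Finset ℕ)
    (h : ∀ p, Q p ↔ p.1 < M ∧ p.2 ∈ s p.1) :
    Nat.card {p : ℕ × ℕ // Q p} = ∑ i ∈ range M, (s i).card := by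
  rw [← card_sigma, ← card_map (Equiv.sigmaEquivProd ℕ ℕ).toEmbedding]
  refine Nat.subtype_card _ fun p => ?_
  rw [h]
  obtain ⟨i, j⟩ := p
  simp

/-- The number of entries `k` in row `i` of the filling `T` of `κ / μ`. -/
noncomputable def rowCount (κ μ : ℕ → ℕ) (T : ℕ → ℕ → ℕ) (i k : ℕ) : ℕ :=
  ((Ico (μ i) (κ i)).filter (fun j => T i j = k)).card

lemma skewContent_eq {κ μ : ℕ → ℕ} (hκ : IsPt N κ) (T : ℕ → ℕ → ℕ) (k : ℕ) :
    skewContent κ μ T k = ∑ i ∈ range N, rowCount κ μ T i k := by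
  refine natCard_cells N _ fun ⟨i, j⟩ => ?_
  simp only [mem_filter, mem_Ico]
  constructor
  · rintro ⟨h1, h2, h3⟩
    refine ⟨?_, ⟨h1, h2⟩, h3⟩
    by_contra h
    have := hκ.2 i (by omega)
    omega
  · rintro ⟨-, h1, h2⟩
    exact ⟨h1.1, h1.2, h2⟩

lemma skewSize_eq {κ μ : ℕ → ℕ} (hκ : IsPt N κ) :
    skewSize κ μ = ∑ i ∈ range N, (κ i - μ i) := by
  simp only [← Nat.card_Ico]
  refine natCard_cells N _ fun ⟨i, j⟩ => ?_
  simp only [mem_Ico]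
  constructor
  · rintro ⟨h1, h2⟩
    refine ⟨?_, h1, h2⟩
    by_contra h
    have := hκ.2 i (by omega)
    omega
  · exact fun h => h.2

lemma lrCount_eq (κ μ : ℕ → ℕ) (T : ℕ → ℕ → ℕ) (i j k : ℕ) :
    lrCount κ μ T i j k = ∑ i' ∈ range i, rowCount κ μ T i' k +
      ((Ico (μ i) (κ i)).filter (fun j' => T i j' = k ∧ j ≤ j')).card := by
  have h : lrCount κ μ T i j k = ∑ i' ∈ range (i + 1),
      ((Ico (μ i') (κ i')).filter (fun j' => T i' j' = k ∧ (i' < i ∨ j ≤ j'))).card := by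
    refine natCard_cells (i + 1) _ fun ⟨i', j'⟩ => ?_
    simp only [mem_filter, mem_Ico]
    constructor
    · rintro ⟨h1, h2, h3, h4⟩
      exact ⟨by omega, ⟨h2, h3⟩, h4, by omega⟩
    · rintro ⟨h1, ⟨h2, h3⟩, h4, h5⟩
      exact ⟨by omega, h2, h3, h4⟩
  rw [h, sum_range_succ]
  congr 1
  · refine sum_congr rfl fun i' hi' => ?_
    simp [rowCount, mem_range.1 hi']
  · simp

/-- The filling `T` of `κ / μ` corresponds to the chain `p`. -/
structure Enc (κ μ : ℕ → ℕ) (T p : ℕ → ℕ → ℕ) : Prop where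
  lo : ∀ k i, μ i ≤ p k i
  hi : ∀ k i, p k i ≤ κ i
  zero : ∀ i j, ¬(μ i ≤ j ∧ j < κ i) → T i j = 0
  lt_iff : ∀ i j k, μ i ≤ j → j < κ i → (T i j < k ↔ j < p k i)

namespace Enc

variable {κ μ : ℕ → ℕ} {T p : ℕ → ℕ → ℕ}

lemma mono (h : Enc κ μ T p) (k i : ℕ) : p k i ≤ p (k + 1) i := by
  by_contra hlt
  have h1 := h.lo (k + 1) i
  have h2 := h.hi k i
  have h3 := (h.lt_iff i (p (k + 1) i) k h1 (by omega)).2 (by omega)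
  have h4 := (h.lt_iff i (p (k + 1) i) (k + 1) h1 (by omega)).1 (by omega)
  omega

lemma eq_iff (h : Enc κ μ T p) {i j : ℕ} (k : ℕ) (h1 : μ i ≤ j) (h2 : j < κ i) :
    T i j = k ↔ p k i ≤ j ∧ j < p (k + 1) i := by
  have h3 := h.lt_iff i j k h1 h2
  have h4 := h.lt_iff i j (k + 1) h1 h2
  omega

lemma zero_eq (h : Enc κ μ T p) : p 0 = μ := by
  funext i
  by_contra hne
  have h1 := h.lo 0 i
  have h2 := h.hi 0 i
  have := (h.lt_iff i (μ i) 0 le_rfl (by omega)).2 (by omega)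
  omega

lemma card_eq (h : Enc κ μ T p) (k i : ℕ) :
    p k i = μ i + ((Ico (μ i) (κ i)).filter (fun j => T i j < k)).card := by
  have h1 := h.lo k i
  have h2 := h.hi k i
  have : (Ico (μ i) (κ i)).filter (fun j => T i j < k) = Ico (μ i) (p k i) := by
    ext j
    simp only [mem_filter, mem_Ico]
    constructor
    · rintro ⟨⟨h3, h4⟩, h5⟩
      exact ⟨h3, (h.lt_iff i j k h3 h4).1 h5⟩
    · rintro ⟨h3, h4⟩
      exact ⟨⟨h3, by omega⟩, (h.lt_iff i j k h3 (by omega)).2 h4⟩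
  rw [this, Nat.card_Ico]
  omega

lemma rowCount_eq (h : Enc κ μ T p) (i k : ℕ) : rowCount κ μ T i k = p (k + 1) i - p k i := by
  rw [← Nat.card_Ico, rowCount]
  congr 1
  ext j
  have h1 := h.lo k i
  have h2 := h.hi (k + 1) i
  simp only [mem_filter, mem_Ico]
  constructor
  · rintro ⟨⟨h3, h4⟩, h5⟩
    exact (h.eq_iff k h3 h4).1 h5
  · rintro ⟨h3, h4⟩
    exact ⟨⟨by omega, by omega⟩, (h.eq_iff k (by omega) (by omega)).2 ⟨h3, h4⟩⟩

lemma sum_rowCount (h : Enc κ μ T p) (i k : ℕ) : ∑ i' ∈ range i, rowCount κ μ T i' k = cum p k i :=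
  sum_congr rfl fun i' _ => h.rowCount_eq i' k

lemma content (h : Enc κ μ T p) (hκ : IsPt N κ) (k : ℕ) : skewContent κ μ T k = cum p k N := by
  rw [skewContent_eq hκ, h.sum_rowCount]

lemma isLR_iff (h : Enc κ μ T p) (hκ : IsPt N κ) (hμ : IsPt N μ) :
    IsLR κ μ T ↔ (∀ k, HStrip (p k) (p (k + 1))) ∧ Good p := by
  constructor
  · rintro ⟨-, -, hcol, hlat⟩
    refine ⟨fun k i => ⟨?_, h.mono k i⟩, fun i k => ?_⟩
    · by_contra hlt
      have h1 := h.hi (k + 1) (i + 1)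
      have h2 := h.lo k i
      have h3 := hμ.1 i (i + 1) (by omega)
      have h4 := hκ.1 i (i + 1) (by omega)
      have h5 := (h.lt_iff (i + 1) (p k i) (k + 1) (by omega) (by omega)).2 (by omega)
      have h6 := hcol i (i + 1) (p k i) (by omega) (by omega) (by omega) (by omega) (by omega)
      have h7 := (h.lt_iff i (p k i) k (by omega) (by omega)).1 (by omega)
      omega
    · have h1 := hlat i (p (k + 1) i) k
      rw [lrCount_eq, lrCount_eq, h.sum_rowCount, h.sum_rowCount] at h1
      have h2 : (Ico (μ i) (κ i)).filter (fun j' => T i j' = k ∧ p (k + 1) i ≤ j') = ∅ := by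
        refine filter_eq_empty_iff.2 fun j hj h3 => ?_
        rw [mem_Ico] at hj
        have := (h.eq_iff k hj.1 hj.2).1 h3.1
        omega
      have h3 : (Ico (μ i) (κ i)).filter (fun j' => T i j' = k + 1 ∧ p (k + 1) i ≤ j') =
          (Ico (μ i) (κ i)).filter (fun j' => T i j' = k + 1) := by
        refine filter_congr fun j hj => ?_
        rw [mem_Ico] at hj
        have := (h.eq_iff (k + 1) hj.1 hj.2).1
        tauto
      rw [h2, h3, card_empty, ← rowCount, h.rowCount_eq] at h1
      rw [cum_succ]
      exact h1
  · rintro ⟨hs, hg⟩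
    refine ⟨h.zero, fun i j₁ j₂ h1 h2 h3 => ?_, fun i₁ i₂ j h1 h2 h3 h4 h5 => ?_, fun i j k => ?_⟩
    · by_contra hlt
      have h4 := (h.lt_iff i j₂ (T i j₁) (by omega) h3).1 (by omega)
      have h5 := (h.lt_iff i j₁ (T i j₁) h1 (by omega)).2 (by omega)
      omega
    · rw [h.lt_iff i₁ j _ h2 h3]
      have h6 := ((h.eq_iff (T i₂ j) h4 h5).1 rfl).2
      have h7 := (hs (T i₂ j) i₁).1
      have h8 : p (T i₂ j + 1) i₂ ≤ p (T i₂ j + 1) (i₁ + 1) := by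
        have hanti : Antitone (p (T i₂ j + 1)) := antitone_nat_of_succ_le fun i =>
          (h.mono _ (i + 1)).trans (hs (T i₂ j + 1) i).1
        exact hanti h1
      omega
    · rw [lrCount_eq, lrCount_eq, h.sum_rowCount, h.sum_rowCount]
      have h1 : ((Ico (μ i) (κ i)).filter (fun j' => T i j' = k + 1 ∧ j ≤ j')).card ≤
          p (k + 1 + 1) i - p (k + 1) i := by
        rw [← h.rowCount_eq, rowCount]
        exact card_le_card (monotone_filter_right _ fun j' _ hj' => hj'.1)
      have h2 := hg i k
      rw [cum_succ] at h2
      omega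

end Enc

lemma exists_enc_of_filling {κ μ : ℕ → ℕ} {T : ℕ → ℕ → ℕ} (hle : ∀ i, μ i ≤ κ i)
    (h0 : ∀ i j, ¬(μ i ≤ j ∧ j < κ i) → T i j = 0)
    (hrow : ∀ i j₁ j₂, μ i ≤ j₁ → j₁ ≤ j₂ → j₂ < κ i → T i j₁ ≤ T i j₂) :
    Enc κ μ T (fun k i => μ i + ((Ico (μ i) (κ i)).filter (fun j => T i j < k)).card) where
  lo k i := by simp
  hi k i := by
    have := card_filter_le (Ico (μ i) (κ i)) (fun j => T i j < k)
    rw [Nat.card_Ico] at this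
    have := hle i
    omega
  zero := h0
  lt_iff i j k h1 h2 := by
    constructor
    · intro h
      have : Ico (μ i) (j + 1) ⊆ (Ico (μ i) (κ i)).filter (fun j => T i j < k) := by
        intro x hx
        rw [mem_Ico] at hx
        rw [mem_filter, mem_Ico]
        have := hrow i x j (by omega) (by omega) h2
        omega
      have := card_le_card this
      rw [Nat.card_Ico] at this
      omega
    · intro h
      by_contra hT
      have : (Ico (μ i) (κ i)).filter (fun j => T i j < k) ⊆ Ico (μ i) j := by
        intro x hx
        rw [mem_filter, mem_Ico] at hx
        rw [mem_Ico]
        refine ⟨hx.1.1, ?_⟩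
        by_contra hxj
        have := hrow i j x h1 (by omega) hx.1.2
        omega
      have := card_le_card this
      rw [Nat.card_Ico] at this
      omega

lemma exists_enc_of_chain {κ μ : ℕ → ℕ} {p : ℕ → ℕ → ℕ} (h0 : p 0 = μ) (hN : ∀ k, N ≤ k → p k = κ)
    (hmono : ∀ k i, p k i ≤ p (k + 1) i) :
    Enc κ μ (fun i j => if μ i ≤ j ∧ j < κ i then
      ((range N).filter (fun k => p (k + 1) i ≤ j)).card else 0) p := by
  have hm : ∀ i, Monotone fun k => p k i := fun i => monotone_nat_of_le_succ fun k => hmono k i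
  refine ⟨fun k i => ?_, fun k i => ?_, fun i j h => if_neg h, fun i j k h1 h2 => ?_⟩
  · rw [← h0]; exact hm i (Nat.zero_le k)
  · rw [← hN (max k N) (le_max_right _ _)]; exact hm i (le_max_left _ _)
  · rw [if_pos ⟨h1, h2⟩]
    constructor
    · intro h
      by_contra hj
      have : range k ⊆ (range N).filter (fun k => p (k + 1) i ≤ j) := by
        intro x hx
        rw [mem_range] at hx
        have h3 : p (x + 1) i ≤ p k i := hm i hx
        rw [mem_filter, mem_range]
        refine ⟨?_, by omega⟩
        by_contra hxN
        rw [hN (x + 1) (by omega)] at h3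
        omega
      have := card_le_card this
      rw [card_range] at this
      omega
    · intro h
      rcases Nat.eq_zero_or_pos k with rfl | hk
      · rw [h0] at h; omega
      have : (range N).filter (fun k => p (k + 1) i ≤ j) ⊆ range (k - 1) := by
        intro x hx
        rw [mem_filter, mem_range] at hx
        rw [mem_range]
        by_contra hxk
        have h3 : p k i ≤ p (x + 1) i := hm i (by omega)
        omega
      have := card_le_card this
      rw [card_range] at this
      omega

lemma bijOn_isLR {κ μ ρ : ℕ → ℕ} (hκ : IsPt N κ) (hμ : IsPt N μ) (hρ : IsPt N ρ)
    (hle : ∀ i, μ i ≤ κ i) :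
    Set.BijOn (fun T k i => μ i + ((Ico (μ i) (κ i)).filter (fun j => T i j < k)).card)
      {T : ℕ → ℕ → ℕ | IsLR κ μ T ∧ ∀ k, skewContent κ μ T k = ρ k}
      {p ∈ Ch HStrip N κ | p 0 = μ ∧ Good p ∧ HasSteps N N ρ p} := by
  refine ⟨?_, ?_, ?_⟩
  · rintro T ⟨hT, hc⟩
    have e := exists_enc_of_filling hle hT.1 hT.2.1
    have h1 := (e.isLR_iff hκ hμ).1 hT
    have hCh : (fun k i => μ i + ((Ico (μ i) (κ i)).filter (fun j => T i j < k)).card) ∈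
        Ch HStrip N κ := by
      refine ⟨fun k _ => h1.1 k, fun k hk => ?_⟩
      funext i
      have h2 : ∀ j, μ i ≤ j → j < κ i → T i j < k := by
        intro j h3 h4
        by_contra hlt
        have h5 := hc (T i j)
        rw [hρ.2 _ (by omega), skewContent_eq hκ, sum_eq_zero_iff] at h5
        have h6 := h5 i (mem_range.2 (by
          by_contra h7
          have := hκ.2 i (by omega)
          omega))
        rw [rowCount, card_eq_zero, filter_eq_empty_iff] at h6
        exact h6 (mem_Ico.2 ⟨h3, h4⟩) rfl
      dsimp only
      rw [filter_true_of_mem fun j hj => h2 j (mem_Ico.1 hj).1 (mem_Ico.1 hj).2, Nat.card_Ico]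
      have := hle i
      omega
    refine ⟨hCh, e.zero_eq, h1.2, (hasSteps_iff hκ hCh _).2 fun k _ => ?_⟩
    rw [← e.content hκ, hc]
  · rintro T ⟨hT, -⟩ T' ⟨hT', -⟩ h
    have e := exists_enc_of_filling hle hT.1 hT.2.1
    have e' := exists_enc_of_filling hle hT'.1 hT'.2.1
    dsimp only at h
    rw [h] at e
    funext i j
    by_cases hj : μ i ≤ j ∧ j < κ i
    · rw [e.eq_iff _ hj.1 hj.2]
      exact (e'.eq_iff _ hj.1 hj.2).1 rfl
    · rw [e.zero i j hj, e'.zero i j hj]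
  · rintro p ⟨hp, h0, hg, hs⟩
    have e := exists_enc_of_chain h0 hp.2 fun k i => (Ch.hstrip hκ hp k i).2
    refine ⟨_, ⟨(e.isLR_iff hκ hμ).2 ⟨Ch.hstrip hκ hp, hg⟩, fun k => ?_⟩, ?_⟩
    · rw [e.content hκ]
      by_cases hk : k < N
      · exact (hasSteps_iff hκ hp _).1 hs k hk
      · rw [hρ.2 k (by omega), cum]
        refine sum_eq_zero fun i _ => ?_
        rw [hp.2 k (by omega), hp.2 (k + 1) (by omega), Nat.sub_self]
    · funext k i
      exact (e.card_eq k i).symm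

/-- Littlewood–Richardson tableaux of prescribed content are counted by good chains. -/
lemma card_isLR {κ μ ρ : ℕ → ℕ} (hκ : IsPt N κ) (hμ : IsPt N μ) (hρ : IsPt N ρ)
    (hle : ∀ i, μ i ≤ κ i) :
    Nat.card {T : ℕ → ℕ → ℕ // IsLR κ μ T ∧ ∀ k, skewContent κ μ T k = ρ k} =
      {p ∈ Ch HStrip N κ | p 0 = μ ∧ Good p ∧ HasSteps N N ρ p}.ncard :=
  (Nat.card_congr (bijOn_isLR hκ hμ hρ hle).equiv)

lemma finite_isLR {κ μ ρ : ℕ → ℕ} (hκ : IsPt N κ) (hμ : IsPt N μ) (hρ : IsPt N ρ)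
    (hle : ∀ i, μ i ≤ κ i) :
    Finite {T : ℕ → ℕ → ℕ // IsLR κ μ T ∧ ∀ k, skewContent κ μ T k = ρ k} := by
  have h := bijOn_isLR hκ hμ hρ hle
  exact (h.finite_iff_finite.2 (((pieri_h N).finite_ch hκ N).subset fun p hp => hp.1)).to_subtype

lemma isPt_skewContent {κ μ : ℕ → ℕ} {T : ℕ → ℕ → ℕ} (hκ : IsPt N κ)
    (hsz : sz N κ ≤ N) (hT : IsLR κ μ T) : IsPt N (skewContent κ μ T) := by
  have hanti : ∀ i j, i ≤ j → skewContent κ μ T j ≤ skewContent κ μ T i := by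
    refine antitone_nat_of_succ_le fun k => ?_
    have h := hT.2.2.2 N 0 k
    rw [lrCount_eq, lrCount_eq, ← skewContent_eq hκ, ← skewContent_eq hκ, hκ.2 N le_rfl] at h
    simpa using h
  refine ⟨hanti, fun k hk => ?_⟩
  by_contra hne
  have h1 : ∑ k' ∈ range (N + 1), 1 ≤ ∑ k' ∈ range (N + 1), skewContent κ μ T k' :=
    sum_le_sum fun k' hk' => by
      have := hanti k' k (by have := mem_range.1 hk'; omega)
      omega
  have h2 : ∑ k' ∈ range (N + 1), skewContent κ μ T k' ≤ sz N κ := by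
    simp only [skewContent_eq hκ]
    rw [sum_comm]
    refine sum_le_sum fun i _ => ?_
    unfold rowCount
    rw [← card_biUnion]
    · refine (card_le_card (t := Ico (μ i) (κ i)) ?_).trans (by rw [Nat.card_Ico]; omega)
      exact biUnion_subset.2 fun k _ => filter_subset _ _
    · intro a _ b _ hab
      exact disjoint_filter.2 fun j _ h3 h4 => hab (h3.symm.trans h4)
  simp at h1
  omega

lemma sum_skewContent {κ μ : ℕ → ℕ} {T : ℕ → ℕ → ℕ} (hκ : IsPt N κ)
    (hsz : sz N κ ≤ N) (hT : IsLR κ μ T) : sz N (skewContent κ μ T) = skewSize κ μ := by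
  rw [skewSize_eq hκ]
  unfold sz
  simp only [skewContent_eq hκ]
  rw [sum_comm]
  refine sum_congr rfl fun i hi => ?_
  rw [← Nat.card_Ico]
  refine (card_eq_sum_card_fiberwise fun j hj => ?_).symm
  have hj' := mem_Ico.1 hj
  rw [mem_coe, mem_range]
  by_contra hlt
  have h1 := (isPt_skewContent hκ hsz hT).2 (T i j) (by omega)
  rw [skewContent_eq hκ, sum_eq_zero_iff] at h1
  have h2 := h1 i hi
  rw [rowCount, card_eq_zero, filter_eq_empty_iff] at h2
  exact h2 hj rfl

end

section
variable {N : ℕ}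

/-- Multitableaux with prescribed contents. -/
abbrev MT (r : ℕ) (α : ℕ → ℕ) (ρ : Fin r → ℕ → ℕ) : Type :=
  {M : LRMultiF r α // ∀ k i, M.cont k i = ρ k i}

lemma LRMultiF_ext {r : ℕ} {α : ℕ → ℕ} {M M' : LRMultiF r α} (h1 : ∀ k, M.chain k = M'.chain k)
    (h2 : ∀ k, M.T k = M'.T k) : M = M' := by
  have h1' : M.chain = M'.chain := funext h1
  have h2' : M.T = M'.T := funext h2
  cases M
  cases M'
  subst h1'
  subst h2'
  rfl

lemma chain_le {r : ℕ} {α : ℕ → ℕ} (M : LRMultiF r α) (k : Fin (r + 1)) (i : ℕ) :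
    M.chain k i ≤ α i := by
  induction k using Fin.reverseInduction with
  | last => exact (M.last i).le
  | cast k ih => exact (M.mono k i).trans ih

lemma chain_isPt {r : ℕ} {α : ℕ → ℕ} (hα : IsPt N α) (M : LRMultiF r α) (k : Fin (r + 1)) :
    IsPt N (M.chain k) :=
  ⟨fun i j h => M.antitone k i j h, fun i hi =>
    Nat.le_zero.1 ((chain_le M k i).trans (hα.2 i hi).le)⟩

lemma chain_last {r : ℕ} {α : ℕ → ℕ} (M : LRMultiF r α) : M.chain (Fin.last r) = α :=
  funext M.last

/-- Subpartitions. -/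
noncomputable def subPt {α : ℕ → ℕ} (hα : IsPt N α) : Finset (ℕ → ℕ) :=
  ((finite_le N α hα.2).subset fun μ (h : IsPt N μ ∧ ∀ i, μ i ≤ α i) => h.2 :
    {μ | IsPt N μ ∧ ∀ i, μ i ≤ α i}.Finite).toFinset

lemma mem_subPt {α μ : ℕ → ℕ} {hα : IsPt N α} : μ ∈ subPt hα ↔ IsPt N μ ∧ ∀ i, μ i ≤ α i := by
  simp [subPt]

/-- Remove the last layer of a multitableau. -/
def initMT {r : ℕ} {α : ℕ → ℕ} (M : LRMultiF (r + 1) α) :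
    LRMultiF r (M.chain (Fin.last r).castSucc) where
  chain k := M.chain k.castSucc
  antitone k := M.antitone k.castSucc
  zero := M.zero
  last _ := rfl
  mono k := M.mono k.castSucc
  T k := M.T k.castSucc
  lr k := M.lr k.castSucc

/-- Add a last layer to a multitableau. -/
def snocMT {r : ℕ} {α μ : ℕ → ℕ} (hα : IsPt N α) (hμ : ∀ i, μ i ≤ α i) (M : LRMultiF r μ)
    (T : ℕ → ℕ → ℕ) (hT : IsLR α μ T) : LRMultiF (r + 1) α where
  chain := Fin.snoc (α := fun _ => ℕ → ℕ) M.chain α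
  antitone k := by
    refine Fin.lastCases ?_ (fun k => ?_) k
    · simpa using hα.1
    · simpa using M.antitone k
  zero i := by
    have : (0 : Fin (r + 1 + 1)) = (0 : Fin (r + 1)).castSucc := rfl
    rw [this, Fin.snoc_castSucc]
    exact M.zero i
  last i := by rw [Fin.snoc_last]
  mono k := by
    refine Fin.lastCases ?_ (fun k => ?_) k
    · rw [Fin.succ_last, Fin.snoc_last, Fin.snoc_castSucc, chain_last]
      exact hμ
    · rw [Fin.snoc_castSucc, Fin.succ_castSucc, Fin.snoc_castSucc]
      exact M.mono k
  T := Fin.snoc (α := fun _ => ℕ → ℕ → ℕ) M.T T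
  lr k := by
    refine Fin.lastCases ?_ (fun k => ?_) k
    · rw [Fin.succ_last, Fin.snoc_last, Fin.snoc_castSucc, Fin.snoc_last, chain_last]
      exact hT
    · rw [Fin.snoc_castSucc, Fin.succ_castSucc, Fin.snoc_castSucc, Fin.snoc_castSucc]
      exact M.lr k

/-- Assemble a multitableau with prescribed contents from its last layer and the rest. -/
noncomputable def assembleMT {r : ℕ} {α : ℕ → ℕ} (hα : IsPt N α) (ρ : Fin (r + 1) → ℕ → ℕ)
    (x : Σ μ : subPt hα,
      {T : ℕ → ℕ → ℕ // IsLR α μ T ∧ ∀ k, skewContent α μ T k = ρ (Fin.last r) k} ×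
        MT r μ (fun k => ρ k.castSucc)) : MT (r + 1) α ρ :=
  ⟨snocMT hα (mem_subPt.1 x.1.2).2 x.2.2.1 x.2.1.1 x.2.1.2.1, fun k => by
    refine Fin.lastCases ?_ (fun k => ?_) k
    · have h := x.2.1.2.2
      simp only [LRMultiF.cont, snocMT]
      rw [Fin.succ_last, Fin.snoc_last, Fin.snoc_castSucc, Fin.snoc_last, chain_last]
      exact h
    · have h := x.2.2.2 k
      simp only [LRMultiF.cont, snocMT] at h ⊢
      rw [Fin.snoc_castSucc, Fin.succ_castSucc, Fin.snoc_castSucc, Fin.snoc_castSucc]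
      exact h⟩

lemma assembleMT_bijective {r : ℕ} {α : ℕ → ℕ} (hα : IsPt N α) (ρ : Fin (r + 1) → ℕ → ℕ) :
    Function.Bijective (assembleMT hα ρ) := by
  constructor
  · rintro ⟨⟨μ, hμ⟩, ⟨T, hT⟩, ⟨M, hM⟩⟩ ⟨⟨μ', hμ'⟩, ⟨T', hT'⟩, ⟨M', hM'⟩⟩ h
    have h0 := congrArg Subtype.val h
    have hc : (Fin.snoc (α := fun _ => ℕ → ℕ) M.chain α : Fin (r + 2) → ℕ → ℕ) =
      Fin.snoc (α := fun _ => ℕ → ℕ) M'.chain α := congrArg LRMultiF.chain h0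
    have ht : (Fin.snoc (α := fun _ => ℕ → ℕ → ℕ) M.T T : Fin (r + 1) → ℕ → ℕ → ℕ) =
      Fin.snoc (α := fun _ => ℕ → ℕ → ℕ) M'.T T' := congrArg LRMultiF.T h0
    have hc' : ∀ k, M.chain k = M'.chain k := fun k => by
      simpa using congrFun hc k.castSucc
    have ht' : ∀ k, M.T k = M'.T k := fun k => by
      simpa using congrFun ht k.castSucc
    have hT0 : T = T' := by simpa using congrFun ht (Fin.last r)
    have hm : μ = μ' := (chain_last M).symm.trans ((hc' _).trans (chain_last M'))
    subst hm hT0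
    obtain rfl := LRMultiF_ext hc' ht'
    rfl
  · intro M
    refine ⟨⟨⟨M.1.chain (Fin.last r).castSucc,
      mem_subPt.2 ⟨chain_isPt hα M.1 _, chain_le M.1 _⟩⟩, ⟨M.1.T (Fin.last r), ?_⟩,
      ⟨initMT M.1, fun k => M.2 k.castSucc⟩⟩, ?_⟩
    · have h1 := M.1.lr (Fin.last r)
      have h2 := M.2 (Fin.last r)
      unfold LRMultiF.cont at h2
      rw [Fin.succ_last, chain_last] at h1 h2
      exact ⟨h1, h2⟩
    refine Subtype.ext (LRMultiF_ext (fun k => ?_) (fun k => ?_))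
    · refine Fin.lastCases ?_ (fun k => ?_) k
      · simp only [assembleMT, snocMT]
        rw [Fin.snoc_last, chain_last]
      · simp only [assembleMT, snocMT]
        rw [Fin.snoc_castSucc]
        rfl
    · refine Fin.lastCases ?_ (fun k => ?_) k
      · simp only [assembleMT, snocMT]
        rw [Fin.snoc_last]
      · simp only [assembleMT, snocMT]
        rw [Fin.snoc_castSucc]
        rfl

lemma finsum_chains_fiber {κ ρ : ℕ → ℕ} (hκ : IsPt N κ) (f : (ℕ → ℕ) → ℚ) :
    ∑ᶠ p ∈ {p ∈ Ch HStrip N κ | Good p ∧ HasSteps N N ρ p}, f (p 0) =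
      ∑ μ : subPt hκ,
        ({p ∈ Ch HStrip N κ | p 0 = μ ∧ Good p ∧ HasSteps N N ρ p}.ncard : ℚ) * f μ := by
  have hfin : {p ∈ Ch HStrip N κ | Good p ∧ HasSteps N N ρ p}.Finite :=
    ((pieri_h N).finite_ch hκ N).subset fun p hp => hp.1
  rw [finsum_mem_eq_finite_toFinset_sum _ hfin,
    sum_coe_sort (subPt hκ) (fun μ =>
      ({p ∈ Ch HStrip N κ | p 0 = μ ∧ Good p ∧ HasSteps N N ρ p}.ncard : ℚ) * f μ),
    ← sum_fiberwise_of_maps_to (t := subPt hκ) (g := fun p => p 0)]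
  · refine sum_congr rfl fun μ _ => ?_
    rw [sum_congr rfl fun p hp => by rw [(mem_filter.1 hp).2], sum_const, nsmul_eq_mul,
      ← Set.ncard_coe_finset]
    congr 3
    ext p
    simp
    tauto
  · intro p hp
    have hp' := (hfin.mem_toFinset.1 hp).1
    exact mem_subPt.2 ⟨Ch.isPt hκ hp' 0, Ch.le_top hκ hp' 0⟩

lemma card_MT (r : ℕ) {α : ℕ → ℕ} (hα : IsPt N α) {ρ : Fin r → ℕ → ℕ} (hρ : ∀ k, IsPt N (ρ k)) :
    Finite (MT r α ρ) ∧ (Nat.card (MT r α ρ) : ℚ) = cf (ad N * ∏ k, sch N (ρ k)) (dl N α) := by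
  induction r generalizing α with
  | zero =>
    have hsub : Subsingleton (MT 0 α ρ) := ⟨fun M M' => Subtype.ext (LRMultiF_ext (fun k => by
      have h0 := Fin.eq_zero k
      subst h0
      funext i
      rw [M.1.zero, M'.1.zero]) fun k => k.elim0)⟩
    refine ⟨Finite.of_subsingleton, ?_⟩
    simp only [univ_eq_empty, prod_empty, mul_one]
    rw [cf_ad hα]
    split_ifs with h
    · subst h
      have : Nonempty (MT 0 0 ρ) := ⟨⟨⟨fun _ => 0, fun _ _ _ _ => le_rfl, fun _ => rfl,
        fun _ => rfl, fun k => k.elim0, fun k => k.elim0, fun k => k.elim0⟩, fun k => k.elim0⟩⟩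
      rw [Nat.card_unique, Nat.cast_one]
    · have : IsEmpty (MT 0 α ρ) := ⟨fun M => h (by
        funext i
        exact (M.1.last i).symm.trans (M.1.zero i))⟩
      rw [Nat.card_of_isEmpty, Nat.cast_zero]
  | succ r ih =>
    have hfin : ∀ μ : subPt hα, Finite
        ({T : ℕ → ℕ → ℕ // IsLR α μ T ∧ ∀ k, skewContent α μ T k = ρ (Fin.last r) k} ×
          MT r μ (fun k => ρ k.castSucc)) := fun μ =>
      have h := mem_subPt.1 μ.2
      have := finite_isLR hα h.1 (hρ (Fin.last r)) h.2
      have := (ih h.1 fun k => hρ k.castSucc).1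
      inferInstance
    refine ⟨Finite.of_equiv _ (Equiv.ofBijective _ (assembleMT_bijective hα ρ)), ?_⟩
    rw [Nat.card_congr (Equiv.ofBijective _ (assembleMT_bijective hα ρ)).symm,
      Nat.card_sigma, Fin.prod_univ_castSucc, ← mul_assoc,
      cf_mul_sch_eq (ad_isAlt.mul (isSymmetric_prod _ _ fun k => sch_isSymmetric _))
        (hρ (Fin.last r)) hα, finsum_chains_fiber hα (fun μ => cf _ (dl N μ)), Nat.cast_sum]
    refine sum_congr rfl fun μ _ => ?_
    have h := mem_subPt.1 μ.2
    rw [Nat.card_prod, Nat.cast_mul, (ih h.1 fun k => hρ k.castSucc).2,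
      card_isLR hα h.1 (hρ (Fin.last r)) h.2]

end

section
open scoped TensorProduct

variable {N : ℕ}

lemma sz_cont {r : ℕ} {α : ℕ → ℕ} (hα : α ∈ parts N N) (M : LRMultiF r α) (k : Fin r) :
    M.cont k ∈ parts N (M.size k) := by
  rw [mem_parts] at hα
  have h1 := chain_isPt hα.1 M k.succ
  have h2 : sz N (M.chain k.succ) ≤ N :=
    (sum_le_sum fun i _ => chain_le M k.succ i).trans hα.2.le
  exact mem_parts.2 ⟨isPt_skewContent h1 h2 (M.lr k), sum_skewContent h1 h2 (M.lr k)⟩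

lemma size_eq {r m : ℕ} {α : ℕ → ℕ} (hα : α ∈ parts N N) (M : LRMultiF r α) (k : Fin r)
    (h : M.cont k ∈ parts N m) : M.size k = m :=
  (mem_parts.1 (sz_cont hα M k)).2.symm.trans (mem_parts.1 h).2

/-- Pairs of multitableaux with conjugate contents, sorted by the contents. -/
noncomputable def pairsEquiv {r : ℕ} {α β : ℕ → ℕ} (hα : α ∈ parts N N) (hβ : β ∈ parts N N)
    {c : Fin r → ℕ} (hc : ∀ k, c k ≤ N) :
    LRPairsStar N r α β c ≃ Σ ρ : Fintype.piFinset (fun k => parts N (c k)),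
      MT r α ρ × MT r β (fun k => conjFun N (ρ.1 k)) where
  toFun P := ⟨⟨P.1.1.cont, Fintype.mem_piFinset.2 fun k => P.2.1 k ▸ sz_cont hα P.1.1 k⟩,
    ⟨P.1.1, fun _ _ => rfl⟩, ⟨P.1.2, P.2.2.2⟩⟩
  invFun x := ⟨(x.2.1.1, x.2.2.1),
    fun k => size_eq hα _ k (by
      rw [funext (x.2.1.2 k)]
      exact Fintype.mem_piFinset.1 x.1.2 k),
    fun k => size_eq hβ _ k (by
      rw [funext (x.2.2.2 k)]
      exact conj_mem_parts (hc k) (Fintype.mem_piFinset.1 x.1.2 k)),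
    fun k m => by rw [x.2.2.2 k m, funext (x.2.1.2 k)]⟩
  left_inv _ := rfl
  right_inv := by
    rintro ⟨⟨ρ, hρ⟩, ⟨M, hM⟩, ⟨M', hM'⟩⟩
    obtain rfl : M.cont = ρ := funext fun k => funext (hM k)
    rfl

/-- Pairing of a symmetric polynomial with the Schur polynomial of `κ`. -/
noncomputable def schL (N : ℕ) (κ : ℕ → ℕ) : MvPolynomial (Fin N) ℚ →ₗ[ℚ] ℚ :=
  cfL (dl N κ) ∘ₗ LinearMap.mulLeft ℚ (ad N)

lemma schL_apply (κ : ℕ → ℕ) (F : MvPolynomial (Fin N) ℚ) :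
    schL N κ F = cf (ad N * F) (dl N κ) := rfl

lemma prod_tmul {ι : Type*} (s : Finset ι) (a b : ι → MvPolynomial (Fin N) ℚ) :
    ∏ i ∈ s, (a i ⊗ₜ[ℚ] b i) = (∏ i ∈ s, a i) ⊗ₜ ∏ i ∈ s, b i := by
  simp only [← iL_mul_iR, prod_mul_distrib, map_prod]

lemma lrStarNum_eq {r : ℕ} {α β : ℕ → ℕ} (hα : α ∈ parts N N) (hβ : β ∈ parts N N)
    {c : Fin r → ℕ} (hc : ∀ k, c k ≤ N) :
    (lrStarNum N r α β c : ℚ) =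
      tf (schL N α) (schL N β) (∏ k, cs {0, 1} (tX (N := N)) (c k)) := by
  simp only [fun k => dual_cauchy (hc k), prod_univ_sum, prod_tmul, map_sum, tf_tmul, schL_apply]
  have hfin : ∀ ρ : Fintype.piFinset (fun k => parts N (c k)),
      Finite (MT r α ρ × MT r β (fun k => conjFun N (ρ.1 k))) ∧
      (Nat.card (MT r α ρ × MT r β (fun k => conjFun N (ρ.1 k))) : ℚ) =
        cf (ad N * ∏ k, sch N (ρ.1 k)) (dl N α) *
          cf (ad N * ∏ k, sch N (conjFun N (ρ.1 k))) (dl N β) := fun ρ => by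
    have h1 := fun k => Fintype.mem_piFinset.1 ρ.2 k
    have h2 := card_MT r (mem_parts.1 hα).1 fun k => (mem_parts.1 (h1 k)).1
    have h3 := card_MT r (mem_parts.1 hβ).1
      fun k => (mem_parts.1 (conj_mem_parts (hc k) (h1 k))).1
    have := h2.1
    have := h3.1
    exact ⟨inferInstance, by rw [Nat.card_prod, Nat.cast_mul, h2.2, h3.2]⟩
  have := fun ρ => (hfin ρ).1
  rw [lrStarNum, Nat.card_congr (pairsEquiv hα hβ hc), Nat.card_sigma, Nat.cast_sum,
    sum_congr rfl fun ρ _ => (hfin ρ).2]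
  exact sum_coe_sort (Fintype.piFinset fun k => parts N (c k)) (fun ρ =>
    cf (ad N * ∏ k, sch N (ρ k)) (dl N α) *
      cf (ad N * ∏ k, sch N (conjFun N (ρ k))) (dl N β))

end

section
open scoped TensorProduct

variable {n : ℕ}

/-- Number of times a coloring takes a value. -/
noncomputable def cnt {X : Type} (f : Fin n → X) (x : X) : ℕ := #{i | f i = x}

lemma sum_cnt {X : Type} [Fintype X] (f : Fin n → X) : ∑ x, cnt f x = n := by
  have h := card_eq_sum_card_fiberwise (s := (univ : Finset (Fin n))) (t := univ) (f := f)
    (fun _ _ => mem_coe.2 (mem_univ _))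
  rw [card_univ, Fintype.card_fin] at h
  exact h.symm

lemma cnt_comp {X : Type} (f : Fin n → X) (g : Perm (Fin n)) : cnt (f ∘ g) = cnt f := by
  funext x
  refine card_bij' (fun i _ => g i) (fun i _ => g.symm i) ?_ ?_ ?_ ?_ <;> simp

lemma exists_comp_eq {X : Type} {f f' : Fin n → X} (h : cnt f' = cnt f) :
    ∃ g : Perm (Fin n), f ∘ g = f' := by
  have e : ∀ x, Nonempty ({i // f' i = x} ≃ {i // f i = x}) := fun x => by
    refine ⟨Fintype.equivOfCardEq ?_⟩
    rw [Fintype.card_subtype, Fintype.card_subtype]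
    exact congrFun h x
  exact ⟨Equiv.ofFiberEquiv fun x => (e x).some, funext fun i => Equiv.ofFiberEquiv_map _ i⟩

lemma exists_cnt_eq {X : Type} [Fintype X] {M : X → ℕ} (hM : ∑ x, M x = n) :
    ∃ f : Fin n → X, cnt f = M := by
  have e : Fin n ≃ Σ x, Fin (M x) := Fintype.equivOfCardEq (by simp [hM])
  refine ⟨fun i => (e i).1, funext fun x => ?_⟩
  have : ({i | (e i).1 = x} : Finset (Fin n)).card = (univ : Finset (Fin (M x))).card := by
    refine (card_bij (fun y _ => e.symm ⟨x, y⟩) ?_ ?_ ?_).symm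
    · intro y _; simp
    · intro y _ y' _ h; simpa using h
    · intro i hi
      rw [mem_filter] at hi
      obtain ⟨-, rfl⟩ := hi
      exact ⟨(e i).2, mem_univ _, by simp⟩
  simpa [cnt] using this

/-- Orbit-stabilizer for colorings. -/
lemma sum_stab {X : Type} [Fintype X] {M : X → ℕ} (hM : ∑ x, M x = n) :
    ∑ f : Fin n → X with cnt f = M, #{g : Perm (Fin n) | f ∘ g = f} = n.factorial := by
  obtain ⟨f₀, hf₀⟩ := exists_cnt_eq hM
  have h := card_eq_sum_card_fiberwise (s := (univ : Finset (Perm (Fin n))))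
    (t := ({f : Fin n → X | cnt f = M} : Finset _)) (f := fun g : Perm (Fin n) => f₀ ∘ g)
    (fun g _ => by simp [cnt_comp, hf₀])
  rw [card_univ, Fintype.card_perm, Fintype.card_fin] at h
  rw [h]
  refine sum_congr rfl fun f hf => ?_
  obtain ⟨g₀, hg₀⟩ := exists_comp_eq ((mem_filter.1 hf).2.trans hf₀.symm)
  refine card_bij' (fun s _ => g₀ * s) (fun g _ => g₀⁻¹ * g) ?_ ?_ ?_ ?_
  · intro s hs
    simp only [mem_filter, mem_univ, true_and] at hs ⊢
    rw [Perm.coe_mul, ← Function.comp_assoc, hg₀, hs]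
  · intro g hg
    simp only [mem_filter, mem_univ, true_and] at hg ⊢
    rw [← hg₀, Function.comp_assoc, ← Perm.coe_mul, mul_inv_cancel_left, hg, hg₀]
  · intro s _; simp
  · intro g _; simp

/-- The character `ε` selects the colorings with multiplicities in `S`. -/
def Selects (n : ℕ) (ε : Perm (Fin n) → ℚ) (S : Set ℕ) : Prop :=
  ∀ (X : Type) (f : Fin n → X), ∑ g with f ∘ (g : Perm (Fin n)) = f, ε g =
    if ∀ x, cnt f x ∈ S then (#{g : Perm (Fin n) | f ∘ g = f} : ℚ) else 0

lemma selects_triv (n : ℕ) : Selects n (fun _ => 1) Set.univ := fun X f => by simp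

lemma cnt_mem_iff {X : Type} (f : Fin n → X) :
    (∀ x, cnt f x ∈ ({0, 1} : Set ℕ)) ↔ Function.Injective f := by
  have : ∀ x, cnt f x ∈ ({0, 1} : Set ℕ) ↔ cnt f x ≤ 1 := fun x => by
    simp only [Set.mem_insert_iff, Set.mem_singleton_iff]; omega
  rw [forall_congr' this]
  simp only [cnt, card_le_one, mem_filter, mem_univ, true_and]
  exact ⟨fun h i j hij => h _ i rfl j hij.symm, fun h x i hi j hj => h (hi.trans hj.symm)⟩

lemma selects_sign (n : ℕ) : Selects n (fun g => ((Perm.sign g : ℤ) : ℚ)) {0, 1} := fun X f => by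
  simp only [cnt_mem_iff]
  split_ifs with h
  · have : ({g : Perm (Fin n) | f ∘ g = f} : Finset _) = {1} := by
      ext g
      simp only [mem_filter, mem_univ, true_and, mem_singleton]
      refine ⟨fun hg => Equiv.ext fun i => h (congrFun hg i), ?_⟩
      rintro rfl
      rfl
    rw [this]
    simp
  · simp only [Function.Injective, not_forall] at h
    obtain ⟨i, j, hij, hne⟩ := h
    have hsw : f ∘ swap i j = f := by
      funext k
      simp only [Function.comp, swap_apply_def]
      split_ifs with h1 h2
      · rw [h1, hij]
      · rw [h2, hij]
      · rfl
    refine sum_involution (fun g _ => swap i j * g) ?_ ?_ ?_ ?_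
    · intro g _
      simp [Perm.sign_swap hne]
    · intro g _ _ hg
      rw [mul_eq_right, swap_eq_one_iff] at hg
      exact hne hg
    · intro g hg
      simp only [mem_filter, mem_univ, true_and] at hg ⊢
      rw [Perm.coe_mul, ← Function.comp_assoc, hsw, hg]
    · intro g _
      simp

lemma sum_selects {X R : Type} [Fintype X] [CommRing R] [Algebra ℚ R] {ε : Perm (Fin n) → ℚ}
    {S : Set ℕ} (h : Selects n ε S) (W : (X → ℕ) → R) :
    ∑ g, ε g • ∑ f : Fin n → X with f ∘ (g : Perm (Fin n)) = f, W (cnt f) =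
      (n.factorial : ℚ) • ∑ M ∈ (piAntidiag (univ : Finset X) n).filter (fun M => ∀ x, M x ∈ S),
        W M := by
  simp only [smul_sum, sum_filter]
  rw [sum_comm]
  have h1 : ∀ f : Fin n → X, ∑ g : Perm (Fin n), ε g • (if f ∘ g = f then W (cnt f) else 0) =
      if ∀ x, cnt f x ∈ S then (#{g : Perm (Fin n) | f ∘ g = f} : ℚ) • W (cnt f) else 0 := by
    intro f
    rw [sum_congr rfl fun g _ => by rw [smul_ite_zero, ← ite_zero_smul], ← sum_smul, ← sum_filter,
      h X f, ite_zero_smul]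
    congr
  rw [sum_congr rfl fun f _ => h1 f, ← sum_fiberwise_of_maps_to (t := piAntidiag univ n)
    (g := cnt) (fun f _ => by simp [sum_cnt])]
  refine sum_congr rfl fun M hM => ?_
  rw [← sum_stab (mem_piAntidiag.1 hM).1, sum_congr rfl fun f hf => by rw [(mem_filter.1 hf).2]]
  split_ifs
  · rw [← sum_smul, Nat.cast_sum]
  · simp

end

section
open scoped TensorProduct

variable {n : ℕ}

/-- The power-sum generating function of the cycle type of `g`: the sum of the weights of the
colorings fixed by `g`. -/
noncomputable def pw {Y R : Type} [Fintype Y] [CommRing R] (w : Y → R) (g : Perm (Fin n)) : R :=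
  ∑ f : Fin n → Y with f ∘ g = f, ∏ i, w (f i)

lemma prod_comp_cnt {Y R : Type} [Fintype Y] [CommRing R] (w : Y → R) (f : Fin n → Y) :
    ∏ i, w (f i) = ∏ y, w y ^ cnt f y := by
  rw [← prod_fiberwise univ f]
  refine prod_congr rfl fun y _ => ?_
  rw [prod_congr rfl fun i hi => by rw [(mem_filter.1 hi).2], prod_const]
  rfl

lemma permChar_eq_card {c : ℕ → ℕ} (hc : ∀ k, n ≤ k → c k = 0) (g : Perm (Fin n)) :
    permChar n c g = #{f : Fin n → Fin n | f ∘ g = f ∧ ∀ k : Fin n, cnt f k = c k} := by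
  have hcard : ∀ (f : Fin n → ℕ) k, Nat.card {x // f x = k} = #{x | f x = k} := fun f k => by
    rw [Nat.card_eq_fintype_card, Fintype.card_subtype]
  unfold permChar
  rw [← Fintype.card_subtype, ← Nat.card_eq_fintype_card]
  congr 1
  symm
  refine Nat.card_congr (Equiv.ofBijective (fun f => ⟨fun i => (f.1 i : ℕ), fun k => ?_,
    fun x => congrArg Fin.val (congrFun f.2.1 x)⟩) ⟨?_, ?_⟩)
  · rw [hcard]
    by_cases hk : k < n
    · rw [← f.2.2 ⟨k, hk⟩]
      simp [cnt, Fin.ext_iff]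
    · rw [hc k (by omega), card_eq_zero]
      refine filter_eq_empty_iff.2 fun x _ h => hk ?_
      rw [← h]
      exact (f.1 x).2
  · intro f f' h
    have h' := congrArg Subtype.val h
    exact Subtype.ext (funext fun i => Fin.ext (congrFun h' i))
  · rintro ⟨f, hf, hg⟩
    have hlt : ∀ x, f x < n := fun x => by
      by_contra hx
      have h1 := hf (f x)
      rw [hcard, hc _ (by omega), card_eq_zero] at h1
      exact filter_eq_empty_iff.1 h1 (mem_univ x) rfl
    refine ⟨⟨fun i => ⟨f i, hlt i⟩, funext fun x => Fin.ext (hg x), fun k => ?_⟩, rfl⟩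
    rw [← hf, hcard]
    simp [cnt, Fin.ext_iff]

lemma permChar_eq_cf {c : ℕ → ℕ} (hc : ∀ k, n ≤ k → c k = 0) (g : Perm (Fin n)) :
    permChar n c g = cf (pw MvPolynomial.X g) (fun k : Fin n => c k) := by
  rw [permChar_eq_card hc, pw, cf_sum]
  simp only [prod_comp_cnt, prod_X_pow, cf_monomial, sum_boole, filter_filter, funext_iff]

lemma irrChar_eq (a : ℕ → ℕ) (g : Perm (Fin n)) :
    irrChar n a g = schL n a (pw MvPolynomial.X g) := by
  rw [schL_apply, cf_ad_mul]
  refine sum_congr rfl fun σ _ => ?_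
  congr 1
  unfold permCharZ
  have hiff : (∀ k : ℕ, 0 ≤ if h : k < n then (a k : ℤ) - k + ((σ ⟨k, h⟩ : Fin n) : ℕ) else 0) ↔
      ∀ i : Fin n, n - 1 - (σ i : ℕ) ≤ dl n a i := by
    constructor
    · intro h i
      have := h i
      rw [dif_pos i.2] at this
      simp only [dl, Fin.eta] at this ⊢
      omega
    · intro h k
      split_ifs with hk
      · have := h ⟨k, hk⟩
        have h2 := (σ ⟨k, hk⟩).2
        simp only [dl] at this
        omega
      · rfl
  rw [if_congr hiff rfl rfl]
  split_ifs with h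
  · rw [permChar_eq_cf (fun k hk => by simp only [dif_neg (not_lt.2 hk), Int.toNat_zero])]
    congr 1
    funext i
    have := h i
    have h2 := (σ i).2
    simp only [dif_pos i.2, dl, Fin.eta] at this ⊢
    omega
  · rfl

lemma sum_cnt_prod {X Y : Type} [Fintype Y] (f : Fin n → X × Y) (x : X) :
    ∑ y, cnt f (x, y) = cnt (fun i => (f i).1) x := by
  unfold cnt
  rw [card_eq_sum_card_fiberwise (s := ({i | (f i).1 = x} : Finset (Fin n))) (t := univ)
    (f := fun i => (f i).2) (fun _ _ => mem_coe.2 (mem_univ _))]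
  refine sum_congr rfl fun y _ => ?_
  rw [filter_filter]
  congr 1
  ext i
  simp [Prod.ext_iff]

lemma sum_matrix_eq_prod_cs {Y R : Type} [Fintype Y] [CommRing R] (S : Set ℕ) (w : Y → R)
    {c : Fin n → ℕ} (hs : ∑ k, c k = n) :
    ∑ M ∈ (piAntidiag (univ : Finset (Fin n × Y)) n).filter (fun M => ∀ x, M x ∈ S),
      (if ∀ k, ∑ y, M (k, y) = c k then ∏ p : Fin n × Y, w p.2 ^ M p else 0) =
      ∏ k, cs S w (c k) := by
  simp only [cs]
  rw [← sum_filter, prod_univ_sum]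
  refine sum_nbij' (fun M k y => M (k, y)) (fun q p => q p.1 p.2) ?_ ?_ ?_ ?_ ?_
  · intro M hM
    simp only [mem_filter, mem_piAntidiag, Fintype.mem_piFinset] at hM ⊢
    exact fun k => ⟨⟨hM.2 k, by simp⟩, fun y => hM.1.2 _⟩
  · intro q hq
    simp only [mem_filter, mem_piAntidiag, Fintype.mem_piFinset] at hq ⊢
    refine ⟨⟨⟨?_, by simp⟩, fun p => (hq _).2 _⟩, fun k => (hq k).1.1⟩
    rw [Fintype.sum_prod_type]
    exact (sum_congr rfl fun k _ => (hq k).1.1).trans hs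
  · intro M _; rfl
  · intro q _; rfl
  · intro M _
    exact Fintype.prod_prod_type _

/-- The average of `ε φ^c` against the power-sum generating function. -/
lemma sum_permChar_pw {Y R : Type} [Fintype Y] [CommRing R] [Algebra ℚ R] {ε : Perm (Fin n) → ℚ}
    {S : Set ℕ} (h : Selects n ε S) (w : Y → R) {c : ℕ → ℕ} (hc : ∀ k, n ≤ k → c k = 0)
    (hs : sz n c = n) :
    ∑ g, (ε g * permChar n c g) • pw w g = (n.factorial : ℚ) • ∏ k : Fin n, cs S w (c k) := by
  rw [← sum_matrix_eq_prod_cs S w (c := fun k => c k)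
    ((Fin.sum_univ_eq_sum_range c n).trans hs)]
  have key := sum_selects h (fun M : Fin n × Y → ℕ =>
    if ∀ k : Fin n, ∑ y, M (k, y) = c k then ∏ p : Fin n × Y, w p.2 ^ M p else 0)
  refine Eq.trans ?_ (key.trans (by congr!))
  refine sum_congr rfl fun g _ => ?_
  rw [mul_smul]
  congr 1
  simp only [sum_cnt_prod, ← prod_comp_cnt (fun p : Fin n × Y => w p.2)]
  rw [permChar_eq_card hc, pw, Nat.cast_smul_eq_nsmul, ← sum_const, ← sum_product', ← sum_filter,
    filter_filter]
  refine sum_nbij' (fun p i => (p.1 i, p.2 i)) (fun f => (fun i => (f i).1, fun i => (f i).2))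
    ?_ ?_ ?_ ?_ ?_
  · rintro ⟨f, f'⟩ h
    simp only [mem_product, mem_filter, mem_univ, true_and] at h ⊢
    exact ⟨funext fun i => Prod.ext (congrFun h.1.1 i) (congrFun h.2 i), h.1.2⟩
  · intro f h
    simp only [mem_product, mem_filter, mem_univ, true_and] at h ⊢
    exact ⟨⟨funext fun i => congrArg Prod.fst (congrFun h.1 i), h.2⟩,
      funext fun i => congrArg Prod.snd (congrFun h.1 i)⟩
  · intro p _; rfl
  · intro f _; rfl
  · intro p _; rfl

lemma pw_tX (g : Perm (Fin n)) :
    pw (tX (N := n)) g = pw MvPolynomial.X g ⊗ₜ pw MvPolynomial.X g := by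
  simp only [pw, TensorProduct.sum_tmul, TensorProduct.tmul_sum, ← prod_tmul]
  rw [← sum_product']
  refine sum_nbij' (fun f => (fun i => (f i).2, fun i => (f i).1)) (fun p i => (p.2 i, p.1 i))
    ?_ ?_ ?_ ?_ ?_
  · intro f h
    simp only [mem_product, mem_filter, mem_univ, true_and] at h ⊢
    exact ⟨funext fun i => congrArg Prod.snd (congrFun h i),
      funext fun i => congrArg Prod.fst (congrFun h i)⟩
  · rintro ⟨f, f'⟩ h
    simp only [mem_product, mem_filter, mem_univ, true_and] at h ⊢
    exact funext fun i => Prod.ext (congrFun h.2 i) (congrFun h.1 i)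
  · intro f _; rfl
  · intro p _; rfl
  · intro f _; rfl

end

section
open scoped TensorProduct

variable {n : ℕ}

/-- Compositions of `n` with at most `n` entries. -/
def IsCmp (n : ℕ) (c : ℕ → ℕ) : Prop := (∀ k, n ≤ k → c k = 0) ∧ sz n c = n

lemma isCmp_of_mem_parts {κ : ℕ → ℕ} (h : κ ∈ parts n n) : IsCmp n κ :=
  ⟨(mem_parts.1 h).1.2, (mem_parts.1 h).2⟩

lemma innerChar_comm (f g : Perm (Fin n) → ℚ) : innerChar n f g = innerChar n g f := by
  simp only [innerChar, mul_comm]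

lemma innerChar_sum_right {ι : Type*} (s : Finset ι) (a : ι → ℚ) (f : Perm (Fin n) → ℚ)
    (u : ι → Perm (Fin n) → ℚ) :
    innerChar n f (∑ i ∈ s, a i • u i) = ∑ i ∈ s, a i * innerChar n f (u i) := by
  simp only [innerChar, Finset.sum_apply, Pi.smul_apply, smul_eq_mul, mul_sum, mul_div_assoc',
    ← sum_div]
  rw [sum_comm]
  congr 1
  exact sum_congr rfl fun i _ => sum_congr rfl fun g _ => by ring

lemma innerChar_sub_right (f u v : Perm (Fin n) → ℚ) :
    innerChar n f (u - v) = innerChar n f u - innerChar n f v := by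
  simp only [innerChar, Pi.sub_apply, mul_sub, sum_sub_distrib, sub_div]

lemma eq_zero_of_innerChar_self {f : Perm (Fin n) → ℚ} (h : innerChar n f f = 0) : f = 0 := by
  unfold innerChar at h
  rw [div_eq_zero_iff, or_iff_left (by exact_mod_cast n.factorial_ne_zero),
    sum_eq_zero_iff_of_nonneg fun g _ => mul_self_nonneg _] at h
  funext g
  exact mul_self_eq_zero.1 (h g (mem_univ g))

/-- A function attaining equality in Bessel's inequality is the sum of its components. -/
lemma eq_sum_of_orthonormal {ι : Type*} {s : Finset ι} {χ : ι → Perm (Fin n) → ℚ}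
    (hχ : ∀ i ∈ s, ∀ j ∈ s, innerChar n (χ i) (χ j) = if i = j then 1 else 0)
    {f : Perm (Fin n) → ℚ} {a : ι → ℚ} (ha : ∀ i ∈ s, innerChar n (χ i) f = a i)
    (hf : innerChar n f f = ∑ i ∈ s, a i * a i) : f = ∑ i ∈ s, a i • χ i := by
  have h1 : ∀ i ∈ s, innerChar n (χ i) (∑ j ∈ s, a j • χ j) = a i := fun i hi => by
    rw [innerChar_sum_right, sum_congr rfl fun j hj => by rw [hχ i hi j hj]]
    simp [hi]
  have h2 : innerChar n f (∑ j ∈ s, a j • χ j) = ∑ i ∈ s, a i * a i := by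
    rw [innerChar_sum_right]
    exact sum_congr rfl fun j hj => by rw [innerChar_comm, ha j hj]
  have h3 : innerChar n (∑ j ∈ s, a j • χ j) (∑ j ∈ s, a j • χ j) = ∑ i ∈ s, a i * a i := by
    rw [innerChar_sum_right]
    exact sum_congr rfl fun j hj => by rw [innerChar_comm, h1 j hj]
  refine sub_eq_zero.1 (eq_zero_of_innerChar_self ?_)
  generalize ∑ i ∈ s, a i • χ i = P at h1 h2 h3 ⊢
  rw [innerChar_sub_right, innerChar_comm (f - P) f, innerChar_comm (f - P) P, innerChar_sub_right,
    innerChar_sub_right, innerChar_comm P f, hf, h2, h3]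
  ring

lemma innerChar_pw {Y R : Type} [Fintype Y] [CommRing R] [Algebra ℚ R] {ε : Perm (Fin n) → ℚ}
    {S : Set ℕ} (h : Selects n ε S) (w : Y → R) {c : ℕ → ℕ} (hc : IsCmp n c) (L : R →ₗ[ℚ] ℚ) :
    innerChar n (fun g => L (pw w g)) (fun g => ε g * permChar n c g) =
      L (∏ k : Fin n, cs S w (c k)) := by
  have h1 := congrArg L (sum_permChar_pw h w hc.1 hc.2)
  simp only [map_sum, map_smul, smul_eq_mul] at h1
  unfold innerChar
  rw [div_eq_iff (by exact_mod_cast n.factorial_ne_zero), mul_comm (L _), ← h1]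
  exact sum_congr rfl fun g _ => mul_comm _ _

/-- The signed permutation character. -/
noncomputable def signPerm (n : ℕ) (c : ℕ → ℕ) (g : Perm (Fin n)) : ℚ :=
  signChar n g * permChar n c g

lemma innerChar_pw_perm {Y R : Type} [Fintype Y] [CommRing R] [Algebra ℚ R] (w : Y → R)
    {c : ℕ → ℕ} (hc : IsCmp n c) (L : R →ₗ[ℚ] ℚ) :
    innerChar n (fun g => L (pw w g)) (permChar n c) = L (∏ k : Fin n, cs Set.univ w (c k)) := by
  rw [← innerChar_pw (selects_triv n) w hc L]
  simp only [one_mul]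

lemma innerChar_pw_sign {Y R : Type} [Fintype Y] [CommRing R] [Algebra ℚ R] (w : Y → R)
    {c : ℕ → ℕ} (hc : IsCmp n c) (L : R →ₗ[ℚ] ℚ) :
    innerChar n (fun g => L (pw w g)) (signPerm n c) = L (∏ k : Fin n, cs {0, 1} w (c k)) :=
  innerChar_pw (selects_sign n) w hc L

lemma irrChar_eq' (a : ℕ → ℕ) : irrChar n a = fun g => schL n a (pw MvPolynomial.X g) :=
  funext (irrChar_eq a)

lemma innerChar_irr_perm {κ c : ℕ → ℕ} (hκ : IsPt n κ) (hc : IsCmp n c) :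
    innerChar n (irrChar n κ) (permChar n c) = nch n HStrip c κ := by
  rw [irrChar_eq', innerChar_pw_perm _ hc, schL_apply, ← (pieri_h n).cf_ad_mul_prod c hκ,
    ← Fin.prod_univ_eq_prod_range (fun k => cs Set.univ MvPolynomial.X (c k))]

lemma innerChar_irr_sign {κ c : ℕ → ℕ} (hκ : κ ∈ parts n n) (hc : IsCmp n c) :
    innerChar n (irrChar n κ) (signPerm n c) = nch n HStrip c (conjFun n κ) := by
  rw [irrChar_eq', innerChar_pw_sign _ hc, schL_apply, ← nch_vstrip (isBx_of_mem_parts le_rfl hκ),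
    ← (pieri_e n).cf_ad_mul_prod c (mem_parts.1 hκ).1,
    ← Fin.prod_univ_eq_prod_range (fun k => cs {0, 1} MvPolynomial.X (c k))]

lemma innerChar_irr_irr {κ μ : ℕ → ℕ} (hκ : κ ∈ parts n n) (hμ : μ ∈ parts n n) :
    innerChar n (irrChar n κ) (irrChar n μ) = if κ = μ then 1 else 0 := by
  have h1 : irrChar n μ = ∑ σ : Perm (Fin n), ((Perm.sign σ : ℤ) : ℚ) •
      permCharZ n (fun i => if h : i < n then (μ i : ℤ) - i + ((σ ⟨i, h⟩ : Fin n) : ℕ) else 0) := by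
    funext g
    simp [irrChar, Finset.sum_apply]
  rw [h1, innerChar_sum_right, ← cf_ad_mul_sch (mem_parts.1 hκ).1 (mem_parts.1 hμ).1,
    ← schL_apply, sch_eq_row, map_sum]
  refine sum_congr rfl fun σ _ => ?_
  rw [map_smul, smul_eq_mul]
  congr 1
  have hiff : (∀ k : ℕ, 0 ≤ if h : k < n then (μ k : ℤ) - k + ((σ ⟨k, h⟩ : Fin n) : ℕ) else 0) ↔
      ∀ i : Fin n, (i : ℕ) ≤ μ i + σ i := by
    constructor
    · intro h i
      have := h i
      rw [dif_pos i.2] at this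
      simp only [Fin.eta] at this
      omega
    · intro h k
      split_ifs with hk
      · have := h ⟨k, hk⟩
        simp only at this
        omega
      · rfl
  split_ifs with h
  · have hc : ∀ i : Fin n, ((if h : (i : ℕ) < n then
        (μ i : ℤ) - (i : ℕ) + ((σ ⟨i, h⟩ : Fin n) : ℕ) else 0).toNat) = μ i + σ i - i := fun i => by
      rw [dif_pos i.2]
      simp only [Fin.eta]
      omega
    have hcmp : IsCmp n (fun k : ℕ => (if h : k < n then
        (μ k : ℤ) - k + ((σ ⟨k, h⟩ : Fin n) : ℕ) else 0).toNat) := by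
      refine ⟨fun k hk => by simp only [dif_neg (not_lt.2 hk), Int.toNat_zero], ?_⟩
      rw [sz, ← Fin.sum_univ_eq_sum_range]
      simp only [hc]
      have h2 : ∑ i : Fin n, (μ i + (σ i : ℕ)) = n + ∑ i : Fin n, (i : ℕ) := by
        rw [sum_add_distrib, Equiv.sum_comp σ (fun i : Fin n => (i : ℕ)),
          Fin.sum_univ_eq_sum_range]
        exact congrArg (· + _) (mem_parts.1 hμ).2
      have h3 : ∑ i : Fin n, (μ i + (σ i : ℕ) - i) + ∑ i : Fin n, (i : ℕ) =
          ∑ i : Fin n, (μ i + (σ i : ℕ)) := by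
        rw [← sum_add_distrib]
        exact sum_congr rfl fun i _ => Nat.sub_add_cancel (h i)
      omega
    have h4 := innerChar_pw_perm (MvPolynomial.X : Fin n → MvPolynomial (Fin n) ℚ) hcmp (schL n κ)
    simp only [hc] at h4
    rw [← h4, irrChar_eq']
    congr 1
    funext g
    unfold permCharZ
    rw [if_pos (hiff.2 h)]
  · rw [map_zero]
    have : permCharZ n (fun i => if h : i < n then
        (μ i : ℤ) - i + ((σ ⟨i, h⟩ : Fin n) : ℕ) else 0) = fun _ => 0 := by
      funext g
      unfold permCharZ
      rw [if_neg (fun h' => h (hiff.1 h'))]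
    rw [this]
    simp [innerChar]

lemma extc_eq {c : ℕ → ℕ} (hc : ∀ k, n ≤ k → c k = 0) : extc (fun k : Fin n => c k) = c := by
  funext k
  unfold extc
  split_ifs with h
  · rfl
  · exact (hc k (by omega)).symm

lemma innerChar_perm_self {c : ℕ → ℕ} (hc : IsCmp n c) :
    innerChar n (permChar n c) (permChar n c) =
      ∑ κ ∈ parts n n, (nch n HStrip c κ : ℚ) * nch n HStrip c κ := by
  have h := innerChar_pw_perm (MvPolynomial.X : Fin n → MvPolynomial (Fin n) ℚ) hc
    (cfL fun k => c k)
  simp only [cfL_apply, ← permChar_eq_cf hc.1] at h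
  rw [h, prod_cs_eq_sum_sch Set.univ (pieri_h n), cf_sum, extc_eq hc.1,
    Fin.sum_univ_eq_sum_range c n, ← sz, hc.2]
  refine sum_congr rfl fun κ hκ => ?_
  rw [cf_smul, cf_sch (mem_parts.1 hκ).1]

/-- Young's rule. -/
lemma permChar_eq_sum {c : ℕ → ℕ} (hc : IsCmp n c) :
    permChar n c = ∑ κ ∈ parts n n, (nch n HStrip c κ : ℚ) • irrChar n κ :=
  eq_sum_of_orthonormal (fun _ h _ h' => innerChar_irr_irr h h')
    (fun _ h => innerChar_irr_perm (mem_parts.1 h).1 hc) (innerChar_perm_self hc)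

lemma signChar_mul_self (g : Perm (Fin n)) : signChar n g * signChar n g = 1 := by
  unfold signChar
  rcases Int.units_eq_one_or (Perm.sign g) with h | h <;> simp [h]

lemma conj_mem {κ : ℕ → ℕ} (h : κ ∈ parts n n) : conjFun n κ ∈ parts n n :=
  conj_mem_parts le_rfl h

lemma conj_conj_of_mem {κ : ℕ → ℕ} (h : κ ∈ parts n n) : conjFun n (conjFun n κ) = κ :=
  conj_conj (isBx_of_mem_parts le_rfl h)

/-- Young's rule for signed permutation characters. -/
lemma signPerm_eq_sum {c : ℕ → ℕ} (hc : IsCmp n c) :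
    signPerm n c = ∑ κ ∈ parts n n, (nch n HStrip c (conjFun n κ) : ℚ) • irrChar n κ := by
  refine eq_sum_of_orthonormal (fun _ h _ h' => innerChar_irr_irr h h')
    (fun _ h => innerChar_irr_sign h hc) ?_
  have h1 : innerChar n (signPerm n c) (signPerm n c) =
      innerChar n (permChar n c) (permChar n c) := by
    unfold innerChar signPerm
    congr 1
    refine sum_congr rfl fun g _ => ?_
    rw [mul_mul_mul_comm, signChar_mul_self, one_mul]
  rw [h1, innerChar_perm_self hc]
  exact sum_nbij' (conjFun n) (conjFun n) (fun _ h => conj_mem h) (fun _ h => conj_mem h)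
    (fun _ h => conj_conj_of_mem h) (fun _ h => conj_conj_of_mem h)
    (fun _ h => by rw [conj_conj_of_mem h])

lemma innerChar_mul_sign {α β c : ℕ → ℕ} (hα : α ∈ parts n n) (hβ : β ∈ parts n n)
    (hc : IsCmp n c) (hle : ∀ k, c k ≤ n) :
    innerChar n (fun g => irrChar n α g * irrChar n β g) (signPerm n c) =
      lrStarNum n n α β (fun k => c k) := by
  rw [lrStarNum_eq hα hβ fun k => hle k, ← innerChar_pw_sign _ hc]
  simp only [pw_tX, tf_tmul, irrChar_eq]

/-- Expansion of `lr*` in Kronecker coefficients. -/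
lemma lrStarNum_eq_sum_kron {α β ν : ℕ → ℕ} (hα : α ∈ parts n n) (hβ : β ∈ parts n n)
    (hν : ν ∈ parts n n) :
    (lrStarNum n n α β (fun k => conjFun n ν k) : ℚ) =
      ∑ γ ∈ parts n n, (nch n HStrip (conjFun n ν) (conjFun n γ) : ℚ) * kron n α β γ := by
  have h := conj_mem hν
  rw [← innerChar_mul_sign hα hβ (isCmp_of_mem_parts h) (isBx_of_mem_parts le_rfl h).2,
    signPerm_eq_sum (isCmp_of_mem_parts h), innerChar_sum_right]
  rfl

end

section
variable {n : ℕ}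

/-- `f` is a positive definite function on the symmetric group, as witnessed by a rational Gram
decomposition. -/
def PD (f : Perm (Fin n) → ℚ) : Prop :=
  ∃ (ι : Type) (_ : Fintype ι) (u : ι → Perm (Fin n) → ℚ),
    ∀ g h, f (g⁻¹ * h) = ∑ t, u t g * u t h

lemma PD.mul {f f' : Perm (Fin n) → ℚ} (hf : PD f) (hf' : PD f') : PD (fun g => f g * f' g) := by
  obtain ⟨ι, _, u, hu⟩ := hf
  obtain ⟨ι', _, u', hu'⟩ := hf'
  refine ⟨ι × ι', inferInstance, fun t g => u t.1 g * u' t.2 g, fun g h => ?_⟩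
  beta_reduce
  rw [hu, hu', sum_mul_sum, ← univ_product_univ, sum_product]
  exact sum_congr rfl fun _ _ => sum_congr rfl fun _ _ => by ring

lemma sum_inv_mul (f : Perm (Fin n) → ℚ) :
    ∑ g, ∑ h, f (g⁻¹ * h) = n.factorial * ∑ g, f g := by
  have h : ∀ g : Perm (Fin n), ∑ h, f (g⁻¹ * h) = ∑ h, f h := fun g =>
    Equiv.sum_comp (Equiv.mulLeft g⁻¹) f
  simp only [h, sum_const, card_univ, Fintype.card_perm, Fintype.card_fin, nsmul_eq_mul]

lemma PD.sum_nonneg {f : Perm (Fin n) → ℚ} (hf : PD f) : 0 ≤ ∑ g, f g := by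
  obtain ⟨ι, _, u, hu⟩ := hf
  refine nonneg_of_mul_nonneg_right (a := (n.factorial : ℚ)) ?_ (by exact_mod_cast n.factorial_pos)
  simp only [← sum_inv_mul, hu]
  rw [sum_congr rfl fun g _ => sum_comm, sum_comm]
  refine Finset.sum_nonneg fun t _ => ?_
  rw [← sum_mul_sum]
  exact mul_self_nonneg _

lemma pd_signChar : PD (signChar n) :=
  ⟨Unit, inferInstance, fun _ => signChar n, fun g h => by simp [signChar]⟩

lemma pd_permChar {c : ℕ → ℕ} (hc : ∀ k, n ≤ k → c k = 0) : PD (permChar n c) := by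
  refine ⟨(Fin n → Fin n) × (Fin n → Fin n), inferInstance, fun p g =>
    if (∀ k : Fin n, cnt p.1 k = c k) ∧ p.1 ∘ ⇑g⁻¹ = p.2 then 1 else 0, fun g h => ?_⟩
  rw [permChar_eq_card hc, ← univ_product_univ, sum_product, card_filter, Nat.cast_sum]
  refine sum_congr rfl fun f _ => ?_
  have h1 : f ∘ ⇑(g⁻¹ * h) = f ↔ f ∘ ⇑h⁻¹ = f ∘ ⇑g⁻¹ := by
    constructor
    · intro h'
      conv_lhs => rw [← h']
      funext x
      simp
    · intro h'
      funext x
      have := congrFun h' (h x)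
      simpa using this.symm
  by_cases hcn : ∀ k : Fin n, cnt f k = c k
  · simp only [h1, hcn, implies_true, true_and, and_true, ite_mul, one_mul, zero_mul, sum_ite_eq,
      mem_univ, if_true, Nat.cast_ite, Nat.cast_one, Nat.cast_zero]
  · simp [hcn]

lemma pd_signPerm {c : ℕ → ℕ} (hc : ∀ k, n ≤ k → c k = 0) : PD (signPerm n c) :=
  pd_signChar.mul (pd_permChar hc)

/-- Convolution on the symmetric group. -/
noncomputable def conv :
    (Perm (Fin n) → ℚ) →ₗ[ℚ] (Perm (Fin n) → ℚ) →ₗ[ℚ] (Perm (Fin n) → ℚ) :=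
  LinearMap.mk₂ ℚ (fun f f' x => ∑ y, f y * f' (y⁻¹ * x))
    (fun f f' e => by funext x; simp [add_mul, sum_add_distrib])
    (fun a f e => by funext x; simp [mul_sum, mul_assoc])
    (fun f e e' => by funext x; simp [mul_add, sum_add_distrib])
    (fun a f e => by funext x; simp [mul_sum, mul_left_comm])

lemma conv_apply (f f' : Perm (Fin n) → ℚ) (x : Perm (Fin n)) :
    conv f f' x = ∑ y, f y * f' (y⁻¹ * x) := rfl

/-- Orthogonal positive definite functions have zero convolution. -/
lemma PD.conv_eq_zero {f f' : Perm (Fin n) → ℚ} (hf : PD f) (hf' : PD f')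
    (h : innerChar n f f' = 0) : conv f f' = 0 := by
  obtain ⟨ι, _, u, hu⟩ := hf
  obtain ⟨ι', _, u', hu'⟩ := hf'
  have h0 : ∑ g, f g * f' g = 0 := by
    unfold innerChar at h
    rwa [div_eq_zero_iff, or_iff_left (by exact_mod_cast n.factorial_ne_zero)] at h
  have h1 : ∑ t, ∑ s, (∑ g, u t g * u' s g) * (∑ g, u t g * u' s g) = 0 := by
    have h2 := sum_inv_mul fun g => f g * f' g
    simp only [h0, hu, hu', mul_zero, sum_mul_sum] at h2
    rw [← h2]
    simp only [sum_mul_sum]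
    rw [sum_congr rfl fun t _ => sum_comm, sum_comm]
    refine sum_congr rfl fun g _ => ?_
    rw [sum_congr rfl fun t _ => sum_comm, sum_comm]
    exact sum_congr rfl fun _ _ => sum_congr rfl fun _ _ => sum_congr rfl fun _ _ => by ring
  have h3 : ∀ t s, ∑ g, u t g * u' s g = 0 := fun t s => by
    rw [sum_eq_zero_iff_of_nonneg fun t _ => Finset.sum_nonneg fun s _ => mul_self_nonneg _] at h1
    have h4 := h1 t (mem_univ t)
    rw [sum_eq_zero_iff_of_nonneg fun s _ => mul_self_nonneg _] at h4
    exact mul_self_eq_zero.1 (h4 s (mem_univ s))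
  funext x
  have h5 : ∀ y, f y = ∑ t, u t 1 * u t y := fun y => by rw [← hu, inv_one, one_mul]
  simp only [conv_apply, hu', Pi.zero_apply]
  rw [sum_congr rfl fun y _ => by rw [h5 y, sum_mul_sum], sum_comm]
  refine sum_eq_zero fun t _ => ?_
  rw [sum_comm]
  refine sum_eq_zero fun s _ => ?_
  have h6 : ∑ y, u t 1 * u t y * (u' s y * u' s x) = u t 1 * u' s x * ∑ y, u t y * u' s y := by
    rw [mul_sum]
    exact sum_congr rfl fun y _ => by ring
  rw [h6, h3, mul_zero]

/-- Sum of all partial sums, a strictly monotone function for the dominance order. -/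
def psum (n : ℕ) (κ : ℕ → ℕ) : ℕ := ∑ k ∈ range (n + 1), ∑ i ∈ range k, κ i

lemma psum_lt {κ μ : ℕ → ℕ} (hκ : IsPt n κ) (hμ : IsPt n μ) (h : Dominates κ μ) (hne : κ ≠ μ) :
    psum n μ < psum n κ := by
  refine lt_of_le_of_ne (sum_le_sum fun k _ => h k) fun heq => hne ?_
  have h1 := (sum_eq_sum_iff_of_le fun k _ => h k).1 heq
  funext i
  by_cases hi : i < n
  · have h2 := h1 i (by simp; omega)
    have h3 := h1 (i + 1) (by simp; omega)
    rw [sum_range_succ, sum_range_succ, h2] at h3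
    omega
  · rw [hκ.2 i (by omega), hμ.2 i (by omega)]

/-- Inversion of a unitriangular system on an up-closed set. -/
lemma eq_zero_of_triangular {V : Type*} [AddCommGroup V] [Module ℚ V] {s : Finset (ℕ → ℕ)}
    {x y : (ℕ → ℕ) → V} {K : (ℕ → ℕ) → (ℕ → ℕ) → ℕ} (m : (ℕ → ℕ) → ℕ) (U : (ℕ → ℕ) → Prop)
    (hy : ∀ ν ∈ s, y ν = ∑ γ ∈ s, (K γ ν : ℚ) • x γ) (hK : ∀ ν ∈ s, K ν ν = 1)
    (hm : ∀ ν ∈ s, ∀ γ ∈ s, K γ ν ≠ 0 → γ ≠ ν → m ν < m γ)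
    (hU : ∀ ν ∈ s, ∀ γ ∈ s, U ν → K γ ν ≠ 0 → U γ) (h0 : ∀ ν ∈ s, U ν → y ν = 0) {ν : ℕ → ℕ}
    (hν : ν ∈ s) (hνU : U ν) : x ν = 0 := by
  by_contra hne
  obtain ⟨μ, hμ, hmax⟩ := exists_max_image (s.filter fun μ => U μ ∧ x μ ≠ 0) m
    ⟨ν, mem_filter.2 ⟨hν, hνU, hne⟩⟩
  obtain ⟨hμs, hμU, hμx⟩ := mem_filter.1 hμ
  refine hμx ?_
  have h1 := hy μ hμs
  rw [h0 μ hμs hμU, ← add_sum_erase s _ hμs, hK μ hμs, sum_eq_zero, add_zero, Nat.cast_one,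
    one_smul] at h1
  · exact h1.symm
  · intro γ hγ
    obtain ⟨hne', hγs⟩ := mem_erase.1 hγ
    by_cases hk : K γ μ = 0
    · rw [hk, Nat.cast_zero, zero_smul]
    · have hlt := hm μ hμs γ hγs hk hne'
      have hx : x γ = 0 := by
        by_contra hx
        have := hmax γ (mem_filter.2 ⟨hγs, hU μ hμs γ hγs hμU hk, hx⟩)
        omega
      rw [hx, smul_zero]

lemma Dominates.trans {a b c : ℕ → ℕ} (h : Dominates a b) (h' : Dominates b c) : Dominates a c :=
  fun k => (h' k).trans (h k)

lemma sum_range_of_mem_parts {κ : ℕ → ℕ} (hκ : κ ∈ parts n n) {k : ℕ} (hk : n ≤ k) :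
    ∑ i ∈ range k, κ i = n := by
  obtain ⟨h, hs⟩ := mem_parts.1 hκ
  rw [← sum_subset (range_subset_range.2 hk) fun i _ hi => h.2 i (by simpa using hi)]
  exact hs

lemma dominates_of_nch {κ μ : ℕ → ℕ} (hκ : κ ∈ parts n n) (hμ : μ ∈ parts n n)
    (h : nch n HStrip μ κ ≠ 0) : Dominates κ μ := fun k => by
  rcases le_total k n with hk | hk
  · exact dominates_of_nch_ne_zero (mem_parts.1 hκ).1 h hk
  · rw [sum_range_of_mem_parts hκ hk, sum_range_of_mem_parts hμ hk]

lemma dominates_conj_iff {κ μ : ℕ → ℕ} (hκ : κ ∈ parts n n) (hμ : μ ∈ parts n n) :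
    Dominates (conjFun n κ) (conjFun n μ) ↔ Dominates μ κ := by
  have key : ∀ {κ μ : ℕ → ℕ}, κ ∈ parts n n → μ ∈ parts n n → Dominates μ κ →
      Dominates (conjFun n κ) (conjFun n μ) := fun hκ hμ h =>
    dominates_conj (isBx_of_mem_parts le_rfl hκ)
      ((mem_parts.1 hμ).2.trans (mem_parts.1 hκ).2.symm) h
  refine ⟨fun h => ?_, key hκ hμ⟩
  have := key (conj_mem hμ) (conj_mem hκ) h
  rwa [conj_conj_of_mem hκ, conj_conj_of_mem hμ] at this

lemma Dominates.antisymm {κ μ : ℕ → ℕ} (h : Dominates κ μ) (h' : Dominates μ κ) : κ = μ := by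
  have h1 : ∀ k, ∑ i ∈ range k, μ i = ∑ i ∈ range k, κ i := fun k => le_antisymm (h k) (h' k)
  funext i
  have h2 := h1 (i + 1)
  rw [sum_range_succ, sum_range_succ, h1 i] at h2
  omega

lemma innerChar_perm_sign_eq_zero {ν κ : ℕ → ℕ} (hν : ν ∈ parts n n) (hκ : κ ∈ parts n n)
    (h : ¬ Dominates κ ν) : innerChar n (permChar n ν) (signPerm n (conjFun n κ)) = 0 := by
  rw [signPerm_eq_sum (isCmp_of_mem_parts (conj_mem hκ)), innerChar_sum_right]
  refine sum_eq_zero fun γ hγ => ?_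
  rw [innerChar_comm, innerChar_irr_perm (mem_parts.1 hγ).1 (isCmp_of_mem_parts hν)]
  by_contra hne
  have h1 := mul_ne_zero_iff.1 hne
  rw [Nat.cast_ne_zero, Nat.cast_ne_zero] at h1
  exact h (Dominates.trans ((dominates_conj_iff hγ hκ).1
    (dominates_of_nch (conj_mem hγ) (conj_mem hκ) h1.1)) (dominates_of_nch hγ hν h1.2))

lemma bilin_irr_eq_zero {V : Type*} [AddCommGroup V] [Module ℚ V]
    (B : (Perm (Fin n) → ℚ) →ₗ[ℚ] (Perm (Fin n) → ℚ) →ₗ[ℚ] V)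
    (hB : ∀ f f', PD f → PD f' → innerChar n f f' = 0 → B f f' = 0) {lam μ : ℕ → ℕ}
    (hlam : lam ∈ parts n n) (hμ : μ ∈ parts n n) (h : ¬ Dominates μ lam) :
    B (irrChar n lam) (irrChar n μ) = 0 := by
  refine eq_zero_of_triangular (s := parts n n) (x := fun μ => B (irrChar n lam) (irrChar n μ))
    (y := fun κ => B (irrChar n lam) (signPerm n (conjFun n κ)))
    (K := fun γ κ => nch n HStrip (conjFun n κ) (conjFun n γ)) (fun κ => psum n (conjFun n κ))
    (fun κ => ¬ Dominates κ lam) ?_ ?_ ?_ ?_ ?_ hμ h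
  · intro κ hκ
    simp only [signPerm_eq_sum (isCmp_of_mem_parts (conj_mem hκ)), map_sum, map_smul]
  · exact fun κ hκ => nch_self (mem_parts.1 (conj_mem hκ)).1
  · intro κ hκ γ hγ hK hne
    refine psum_lt (mem_parts.1 (conj_mem hγ)).1 (mem_parts.1 (conj_mem hκ)).1
      (dominates_of_nch (conj_mem hγ) (conj_mem hκ) hK) fun heq => hne ?_
    rw [← conj_conj_of_mem hγ, heq, conj_conj_of_mem hκ]
  · intro κ hκ γ hγ hU hK hd
    exact hU (Dominates.trans ((dominates_conj_iff hγ hκ).1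
      (dominates_of_nch (conj_mem hγ) (conj_mem hκ) hK)) hd)
  · intro κ hκ hU
    refine eq_zero_of_triangular (s := parts n n)
      (x := fun lam => B (irrChar n lam) (signPerm n (conjFun n κ)))
      (y := fun ν => B (permChar n ν) (signPerm n (conjFun n κ)))
      (K := fun γ ν => nch n HStrip ν γ) (psum n) (fun ν => ¬ Dominates κ ν) ?_ ?_ ?_ ?_ ?_ hlam hU
    · intro ν hν
      simp only [permChar_eq_sum (isCmp_of_mem_parts hν), map_sum, map_smul, LinearMap.sum_apply,
        LinearMap.smul_apply]
    · exact fun ν hν => nch_self (mem_parts.1 hν).1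
    · exact fun ν hν γ hγ hK hne => psum_lt (mem_parts.1 hγ).1 (mem_parts.1 hν).1
        (dominates_of_nch hγ hν hK) hne
    · exact fun ν hν γ hγ hU hK hd => hU (Dominates.trans hd (dominates_of_nch hγ hν hK))
    · exact fun ν hν hU => hB _ _ (pd_permChar (isCmp_of_mem_parts hν).1)
        (pd_signPerm (isCmp_of_mem_parts (conj_mem hκ)).1) (innerChar_perm_sign_eq_zero hν hκ hU)

lemma conv_irr_eq_zero {lam μ : ℕ → ℕ} (hlam : lam ∈ parts n n) (hμ : μ ∈ parts n n)
    (hne : lam ≠ μ) : conv (irrChar n lam) (irrChar n μ) = 0 := by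
  by_cases h : Dominates μ lam
  · refine bilin_irr_eq_zero conv.flip (fun f f' hf hf' h' => ?_) hμ hlam
      fun h' => hne (Dominates.antisymm h' h)
    rw [innerChar_comm] at h'
    exact hf'.conv_eq_zero hf h'
  · exact bilin_irr_eq_zero conv (fun f f' hf hf' h' => hf.conv_eq_zero hf' h') hlam hμ h

lemma irrChar_inv (κ : ℕ → ℕ) (g : Perm (Fin n)) : irrChar n κ g⁻¹ = irrChar n κ g := by
  have h1 : ∀ c : ℕ → ℕ, permChar n c g⁻¹ = permChar n c g := fun c => by
    unfold permChar
    congr 3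
    funext f
    refine congrArg _ (propext ⟨fun h x => ?_, fun h x => ?_⟩)
    · simpa using (h (g x)).symm
    · simpa using (h (g⁻¹ x)).symm
  simp only [irrChar, permCharZ, h1]

lemma pd_conv_irr (κ : ℕ → ℕ) : PD (conv (irrChar n κ) (irrChar n κ)) := by
  refine ⟨Perm (Fin n), inferInstance, fun z g => irrChar n κ (g⁻¹ * z), fun g h => ?_⟩
  rw [conv_apply, ← Equiv.sum_comp (Equiv.mulLeft g⁻¹)]
  refine sum_congr rfl fun z _ => ?_
  simp only [Equiv.coe_mulLeft]
  rw [← irrChar_inv κ (h⁻¹ * z)]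
  congr 2
  group

lemma isCmp_ones (n : ℕ) : IsCmp n (fun k => if k < n then 1 else 0) := by
  refine ⟨fun k hk => if_neg (by omega), ?_⟩
  rw [sz, sum_congr rfl fun i hi => if_pos (mem_range.1 hi)]
  simp

lemma permChar_ones_of_ne {g : Perm (Fin n)} (hg : g ≠ 1) :
    permChar n (fun k => if k < n then 1 else 0) g = 0 := by
  rw [permChar_eq_card (isCmp_ones n).1, Nat.cast_eq_zero, card_eq_zero, filter_eq_empty_iff]
  rintro f - ⟨h1, h2⟩
  refine hg (Equiv.ext fun x => ?_)
  have hinj : Function.Injective f := (cnt_mem_iff f).1 fun x => by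
    rw [h2, if_pos x.2]
    simp
  exact hinj (congrFun h1 x)

lemma permChar_ones_one_pos : 0 < permChar n (fun k => if k < n then 1 else 0) 1 := by
  rw [permChar_eq_card (isCmp_ones n).1, Nat.cast_pos, card_pos]
  exact ⟨id, mem_filter.2 ⟨mem_univ _, rfl, fun k => by simp [cnt, filter_eq']⟩⟩

lemma irrChar_eq_smul_conv {κ : ℕ → ℕ} (hκ : κ ∈ parts n n) :
    ∃ c : ℚ, 0 ≤ c ∧ irrChar n κ = c • conv (irrChar n κ) (irrChar n κ) := by
  set C := permChar n (fun k => if k < n then 1 else 0) 1 with hC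
  have hpos : 0 < C := permChar_ones_one_pos
  have h1 : conv (irrChar n κ) (permChar n fun k => if k < n then 1 else 0) =
      C • irrChar n κ := by
    funext x
    rw [conv_apply, sum_eq_single x]
    · rw [inv_mul_cancel, Pi.smul_apply, smul_eq_mul, mul_comm]
    · intro y _ hy
      rw [permChar_ones_of_ne, mul_zero]
      exact fun h => hy (inv_mul_eq_one.1 h)
    · exact fun h => absurd (mem_univ x) h
  rw [permChar_eq_sum (isCmp_ones n), map_sum, sum_eq_single κ, map_smul] at h1
  · refine ⟨nch n HStrip (fun k => if k < n then 1 else 0) κ / C,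
      div_nonneg (Nat.cast_nonneg _) hpos.le, ?_⟩
    rw [div_eq_inv_mul, mul_smul, h1, smul_smul, inv_mul_cancel₀ hpos.ne', one_smul]
  · intro μ hμ hne
    rw [map_smul, conv_irr_eq_zero hκ hμ hne.symm, smul_zero]
  · exact fun h => absurd hκ h

/-- Kronecker coefficients are nonnegative. -/
lemma kron_nonneg {α β γ : ℕ → ℕ} (hα : α ∈ parts n n) (hβ : β ∈ parts n n)
    (hγ : γ ∈ parts n n) : 0 ≤ kron n α β γ := by
  obtain ⟨a, ha, hα'⟩ := irrChar_eq_smul_conv hα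
  obtain ⟨b, hb, hβ'⟩ := irrChar_eq_smul_conv hβ
  obtain ⟨c, hc, hγ'⟩ := irrChar_eq_smul_conv hγ
  have h := (((pd_conv_irr (n := n) α).mul (pd_conv_irr β)).mul (pd_conv_irr γ)).sum_nonneg
  have h1 : kron n α β γ = a * b * c * (∑ g, conv (irrChar n α) (irrChar n α) g *
      conv (irrChar n β) (irrChar n β) g * conv (irrChar n γ) (irrChar n γ) g) / n.factorial := by
    unfold kron innerChar
    conv_lhs => rw [hα', hβ', hγ']
    rw [mul_sum]
    congr 1
    refine sum_congr rfl fun g _ => ?_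
    simp only [Pi.smul_apply, smul_eq_mul]
    ring
  rw [h1]
  positivity

end

section
variable {n : ℕ}

lemma sum_range_getD (F : ℕ → ℕ) (hF : F 0 = 0) (l : List ℕ) (m : ℕ) (h : l.length ≤ m) :
    ∑ i ∈ range m, F (l.getD i 0) = (l.map F).sum := by
  induction l generalizing m with
  | nil => simp [hF]
  | cons a l ih =>
    obtain ⟨m, rfl⟩ : ∃ k, m = k + 1 := ⟨m - 1, by simp at h; omega⟩
    rw [sum_range_succ', List.map_cons, List.sum_cons, ← ih m (by simpa using h), add_comm]
    rfl

lemma card_parts_le (P : n.Partition) : P.parts.card ≤ n := by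
  have h := Multiset.card_nsmul_le_sum (s := P.parts) (a := 1) fun x hx => P.parts_pos hx
  rwa [P.parts_sum, nsmul_eq_mul, mul_one] at h

lemma sum_pf (F : ℕ → ℕ) (hF : F 0 = 0) (P : n.Partition) :
    ∑ i ∈ range n, F (pf P i) = (P.parts.map F).sum := by
  have h := sum_range_getD F hF (P.parts.sort (· ≤ ·)).reverse n
    (by simpa using card_parts_le P)
  rw [List.map_reverse, List.sum_reverse, ← Multiset.sum_coe, ← Multiset.map_coe,
    Multiset.sort_eq] at h
  exact h

lemma pf_antitone (P : n.Partition) {i j : ℕ} (hij : i ≤ j) : pf P j ≤ pf P i := by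
  have hs : (P.parts.sort (· ≤ ·)).reverse.Pairwise (· ≥ ·) :=
    List.pairwise_reverse.2 (Multiset.pairwise_sort P.parts (· ≤ ·))
  unfold pf
  generalize (P.parts.sort (· ≤ ·)).reverse = l at hs
  rcases lt_or_ge j l.length with hj | hj
  · rw [List.getD_eq_getElem _ _ hj, List.getD_eq_getElem _ _ (hij.trans_lt hj)]
    rcases hij.eq_or_lt with rfl | hlt
    · rfl
    · exact List.pairwise_iff_getElem.1 hs i j _ _ hlt
  · rw [List.getD_eq_default _ _ hj]
    exact Nat.zero_le _

lemma pf_mem_parts (P : n.Partition) : pf P ∈ parts n n := by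
  refine mem_parts.2 ⟨⟨fun i j h => pf_antitone P h, fun i hi => ?_⟩, ?_⟩
  · refine List.getD_eq_default _ _ ?_
    rw [List.length_reverse, Multiset.length_sort]
    exact (card_parts_le P).trans hi
  · have h := sum_pf id rfl P
    rw [Multiset.map_id, P.parts_sum] at h
    exact h

lemma count_eq_sum_map (a : ℕ) (s : Multiset ℕ) :
    s.count a = (s.map fun x => if a = x then 1 else 0).sum := by
  induction s using Multiset.induction with
  | empty => simp
  | cons b s ih => rw [Multiset.count_cons, ih, Multiset.map_cons, Multiset.sum_cons, add_comm]

lemma pf_injective : Function.Injective (pf : n.Partition → ℕ → ℕ) := fun P Q h => by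
  refine Nat.Partition.ext (Multiset.ext.2 fun a => ?_)
  by_cases ha : a = 0
  · rw [ha, Multiset.count_eq_zero_of_notMem fun h0 => (P.parts_pos h0).ne rfl,
      Multiset.count_eq_zero_of_notMem fun h0 => (Q.parts_pos h0).ne rfl]
  · rw [count_eq_sum_map, count_eq_sum_map, ← sum_pf (fun x => if a = x then 1 else 0) (if_neg ha),
      ← sum_pf (fun x => if a = x then 1 else 0) (if_neg ha), h]

lemma sum_map_filter_ne_zero (F : ℕ → ℕ) (hF : F 0 = 0) (s : Multiset ℕ) :
    ((s.filter (· ≠ 0)).map F).sum = (s.map F).sum := by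
  induction s using Multiset.induction with
  | empty => simp
  | cons b s ih =>
    by_cases hb : b = 0
    · subst hb
      simpa [hF] using ih
    · simpa [hb] using ih

lemma exists_pf_eq {κ : ℕ → ℕ} (hκ : κ ∈ parts n n) : ∃ P : n.Partition, pf P = κ := by
  set P := Nat.Partition.ofSums n ((range n).val.map κ) (mem_parts.1 hκ).2 with hP
  suffices h : conjFun n (pf P) = conjFun n κ from
    ⟨P, by rw [← conj_conj_of_mem (pf_mem_parts P), h, conj_conj_of_mem hκ]⟩
  funext j
  unfold conjFun
  rw [card_filter, card_filter, sum_pf (fun x => if j < x then 1 else 0) (if_neg (by omega))]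
  simp only [hP, Nat.Partition.ofSums]
  rw [sum_map_filter_ne_zero (fun x => if j < x then 1 else 0) (if_neg (by omega)),
    Multiset.map_map]
  rfl

lemma nch_conj_ne_zero_iff {γ ν : ℕ → ℕ} (hγ : γ ∈ parts n n) (hν : ν ∈ parts n n) :
    nch n HStrip (conjFun n ν) (conjFun n γ) ≠ 0 ↔ Dominates ν γ := by
  have h1 := conj_mem hγ
  have h2 := conj_mem hν
  rw [← dominates_conj_iff hγ hν]
  exact ⟨dominates_of_nch h1 h2, fun h => (nch_pos (mem_parts.1 h1).1 (mem_parts.1 h2).1 h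
    ((mem_parts.1 h2).2.trans (mem_parts.1 h1).2.symm)).ne'⟩

lemma kron_eq_lrStarNum_iff {α β ν : ℕ → ℕ} (hα : α ∈ parts n n) (hβ : β ∈ parts n n)
    (hν : ν ∈ parts n n) :
    kron n α β ν = lrStarNum n n α β (fun k => conjFun n ν k) ↔
      ∀ γ ∈ parts n n, Dominates ν γ → γ ≠ ν → kron n α β γ = 0 := by
  rw [lrStarNum_eq_sum_kron hα hβ hν, ← add_sum_erase _ _ hν,
    nch_self (mem_parts.1 (conj_mem hν)).1, Nat.cast_one, one_mul, left_eq_add,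
    sum_eq_zero_iff_of_nonneg fun γ hγ =>
      mul_nonneg (Nat.cast_nonneg _) (kron_nonneg hα hβ (mem_of_mem_erase hγ))]
  constructor
  · intro h γ hγ hd hne
    refine (mul_eq_zero.1 (h γ (mem_erase.2 ⟨hne, hγ⟩))).resolve_left ?_
    exact Nat.cast_ne_zero.2 ((nch_conj_ne_zero_iff hγ hν).2 hd)
  · intro h γ hγ
    obtain ⟨hne, hγ⟩ := mem_erase.1 hγ
    by_cases hd : Dominates ν γ
    · rw [h γ hγ hd hne, mul_zero]
    · rw [not_not.1 (mt (nch_conj_ne_zero_iff hγ hν).1 hd), Nat.cast_zero, zero_mul]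

end

end KroneckerMinimal

open KroneckerMinimal

/-- `χ^ν` is a minimal component of `χ^α ⊗ χ^β` iff
`k(α,β,ν) = lr*(α,β;ν')`. -/
theorem stmt13 (n : ℕ) (α β ν : n.Partition) (h : 0 < kron n (pf α) (pf β) (pf ν)) :
    (∀ γ : n.Partition, Dominates (pf ν) (pf γ) → γ ≠ ν →
        kron n (pf α) (pf β) (pf γ) = 0) ↔
      kron n (pf α) (pf β) (pf ν) =
        (lrStarNum n n (pf α) (pf β) (fun k : Fin n => conjFun n (pf ν) k) : ℚ) := by
  rw [kron_eq_lrStarNum_iff (pf_mem_parts α) (pf_mem_parts β) (pf_mem_parts ν)]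
  refine ⟨fun h γ hγ hd hne => ?_, fun h γ hd hne =>
    h (pf γ) (pf_mem_parts γ) hd fun heq => hne (pf_injective heq)⟩
  obtain ⟨γ, rfl⟩ := exists_pf_eq hγ
  exact h γ hd fun heq => hne (congrArg pf heq)
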